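/- arXiv:1911.05995 — 6 statements merged into one kernel-verified Lean document; each statement's English description precedes it below -/
import Mathlib

section
/- Fix an integer n ≥ 2. There exists a constant C > 0 depending only on n such that for every prime power q, every finite field F with |F| = q, and every regular semisimple c ∈ SL_n(F) — that is, c has determinant 1 and the characteristic polynomial of c is squarefree — the number N(c) of pairs (a,b) ∈ GL_n(F) × GL_n(F) with a·b·a⁻¹·b⁻¹ = c satisfies |N(c) − q·|GL_n(F)|| ≤ C·|GL_n(F)|. -/
namespace CommutatorFiber

open Matrix Polynomial

section Counting

open scoped Classical in
/-- The number of elements of a finite type that satisfy a predicate. -/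
noncomputable def count {α : Type*} [Fintype α] (p : α → Prop) : ℕ :=
  (Finset.univ.filter p).card

variable {α β : Type*} [Fintype α] [Fintype β]

theorem natCard_subtype (p : α → Prop) : Nat.card {x // p x} = count p := by
  classical
  rw [Nat.card_eq_fintype_card, Fintype.card_subtype, count]

theorem count_le_card (p : α → Prop) : count p ≤ Fintype.card α := by
  classical exact Finset.card_filter_le _ _

theorem count_true : count (fun _ : α => True) = Fintype.card α := by
  classical simp [count]

theorem count_eq_zero {p : α → Prop} (h : ∀ x, ¬ p x) : count p = 0 := by
  classical simp [count, h]

theorem count_mono {p q : α → Prop} (h : ∀ x, p x → q x) : count p ≤ count q := by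
  classical exact Finset.card_le_card (Finset.monotone_filter_right _ fun x _ => h x)

theorem count_congr {p q : α → Prop} (h : ∀ x, p x ↔ q x) : count p = count q := by
  rw [show p = q from funext fun x => propext (h x)]

theorem count_and_add_count_and_not (p q : α → Prop) :
    count (fun x => p x ∧ q x) + count (fun x => p x ∧ ¬ q x) = count p := by
  classical
  simp only [count, Finset.card_filter, ← Finset.sum_add_distrib]
  refine Finset.sum_congr rfl fun x _ => ?_
  by_cases hp : p x <;> by_cases hq : q x <;> simp [hp, hq]

theorem count_or_le (p q : α → Prop) : count (fun x => p x ∨ q x) ≤ count p + count q := by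
  classical
  simp only [count, Finset.card_filter, ← Finset.sum_add_distrib]
  refine Finset.sum_le_sum fun x _ => ?_
  by_cases hp : p x <;> by_cases hq : q x <;> simp [hp, hq]

theorem count_le_add {p q r : α → Prop} (h : ∀ x, p x → q x ∨ r x) :
    count p ≤ count q + count r :=
  (count_mono h).trans (count_or_le q r)

theorem count_exists_le {ι : Type*} (s : Finset ι) (p : ι → α → Prop) :
    count (fun x => ∃ i ∈ s, p i x) ≤ ∑ i ∈ s, count (p i) := by
  classical
  refine le_trans (le_of_eq ?_)
    (Finset.card_biUnion_le (s := s) (t := fun i => Finset.univ.filter (p i)))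
  unfold count
  congr 1
  ext x
  simp

theorem count_le_of_injOn {p : α → Prop} {q : β → Prop} (f : α → β) (hf : ∀ x, p x → q (f x))
    (hinj : ∀ x y, p x → p y → f x = f y → x = y) : count p ≤ count q := by
  classical
  refine Finset.card_le_card_of_injOn f (fun x hx => ?_) (fun x hx y hy h => ?_)
  · simp only [Finset.coe_filter, Finset.mem_univ, true_and, Set.mem_ofPred_eq] at hx ⊢
    exact hf x hx
  · simp only [Finset.coe_filter, Finset.mem_univ, true_and, Set.mem_ofPred_eq] at hx hy
    exact hinj x y hx hy h

theorem count_comp_equiv (e : α ≃ β) (p : β → Prop) : count (fun x => p (e x)) = count p :=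
  le_antisymm (count_le_of_injOn e (fun _ h => h) fun _ _ _ _ h => e.injective h)
    (count_le_of_injOn e.symm (fun x h => by simpa using h) fun _ _ _ _ h => e.symm.injective h)

theorem count_prod (p : α × β → Prop) : count p = ∑ a, count fun b => p (a, b) := by
  classical
  simp only [count, Finset.card_filter]
  exact Fintype.sum_prod_type _

theorem sum_count_comm (r : α → β → Prop) :
    ∑ a, count (fun b => r a b) = ∑ b, count fun a => r a b := by
  classical
  simp only [count, Finset.card_filter]
  exact Finset.sum_comm

theorem sum_ite_eq_count_mul (p : α → Prop) [DecidablePred p] (m : ℕ) :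
    ∑ a, (if p a then m else 0) = count p * m := by
  classical
  rw [← Finset.sum_filter, Finset.sum_const, smul_eq_mul, count]
  congr

theorem sum_le_count_mul {p : α → Prop} {f : α → ℕ} {m : ℕ} (h : ∀ a, p a → f a ≤ m)
    (h0 : ∀ a, ¬ p a → f a = 0) : ∑ a, f a ≤ count p * m := by
  classical
  rw [← sum_ite_eq_count_mul]
  refine Finset.sum_le_sum fun a _ => ?_
  split_ifs with ha
  · exact h a ha
  · exact (h0 a ha).le

theorem count_mul_le_sum {p : α → Prop} {f : α → ℕ} {m : ℕ} (h : ∀ a, p a → m ≤ f a) :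
    count p * m ≤ ∑ a, f a := by
  classical
  rw [← sum_ite_eq_count_mul]
  refine Finset.sum_le_sum fun a _ => ?_
  split_ifs with ha
  · exact h a ha
  · exact Nat.zero_le _

theorem count_finset_le {K : Type*} (f : α → K) (hf : Function.Injective f) (s : Finset K) :
    count (fun a => f a ∈ s) ≤ s.card := by
  classical
  refine Finset.card_le_card_of_injOn f (fun x hx => ?_) hf.injOn
  simpa using hx

end Counting

section Averaging

variable {F V : Type*} [Field F] [Fintype F] [AddCommGroup V] [Module F V] [Fintype V]

/-- Averaging over the lines in a fixed direction. -/
theorem card_mul_count_le_of_line (p : V → Prop) (d : V) (m : ℕ)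
    (h : ∀ x, count (fun y : F => p (x + y • d)) ≤ m) :
    Fintype.card F * count p ≤ m * Fintype.card V := by
  calc Fintype.card F * count p = ∑ y : F, count (fun x => p (x + y • d)) := by
        have hy : ∀ y : F, count (fun x => p (x + y • d)) = count p := fun y =>
          count_comp_equiv (Equiv.addRight (y • d)) p
        simp [hy]
    _ = ∑ x, count (fun y : F => p (x + y • d)) := sum_count_comm _
    _ ≤ ∑ _x : V, m := Finset.sum_le_sum fun x _ => h x
    _ = m * Fintype.card V := by simp [mul_comm]

end Averaging

section Columns

variable {F : Type*} [Fintype F] {n : ℕ}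

/-- Averaging over all replacements of a fixed column. -/
theorem sum_count_updateCol (k : Fin n) (p : Matrix (Fin n) (Fin n) F → Prop) :
    ∑ X : Matrix (Fin n) (Fin n) F, count (fun u : Fin n → F => p (X.updateCol k u)) =
      Fintype.card F ^ n * count p := by
  have key : ∀ X : Matrix (Fin n) (Fin n) F, ∀ u : Fin n → F,
      (X.updateCol k u).updateCol k (X.col k) = X := fun X u => by
    ext i j
    by_cases h : j = k <;> simp [h]
  let e : Matrix (Fin n) (Fin n) F × (Fin n → F) → Matrix (Fin n) (Fin n) F × (Fin n → F) :=
    fun z => (z.1.updateCol k z.2, z.1.col k)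
  have he : Function.Involutive e := fun z => by
    refine Prod.ext (key _ _) ?_
    funext i
    simp [e]
  have h1 := count_comp_equiv (he.toPerm e) (fun z => p z.1)
  rw [count_prod, count_prod] at h1
  refine h1.trans ?_
  classical
  have : ∀ X : Matrix (Fin n) (Fin n) F, count (fun _ : Fin n → F => p X) =
      if p X then Fintype.card F ^ n else 0 := fun X => by
    split_ifs with h <;> simp [h, count]
  rw [Finset.sum_congr rfl fun X _ => this X, sum_ite_eq_count_mul, mul_comm]

end Columns

section SetEntry

variable {F : Type*} {n : ℕ}

/-- Replace one entry of a matrix. -/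
def setEntry (X : Matrix (Fin n) (Fin n) F) (a b : Fin n) (t : F) : Matrix (Fin n) (Fin n) F :=
  of fun i j => if i = a ∧ j = b then t else X i j

theorem setEntry_self (X : Matrix (Fin n) (Fin n) F) (a b : Fin n) :
    setEntry X a b (X a b) = X := by
  ext i j
  by_cases h : i = a ∧ j = b
  · simp [setEntry, h]
  · simp [setEntry, h]

theorem setEntry_setEntry (X : Matrix (Fin n) (Fin n) F) (a b : Fin n) (t u : F) :
    setEntry (setEntry X a b t) a b u = setEntry X a b u := by
  ext i j
  by_cases h : i = a ∧ j = b <;> simp [setEntry, h]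

theorem setEntry_apply_self (X : Matrix (Fin n) (Fin n) F) (a b : Fin n) (t : F) :
    setEntry X a b t a b = t := by
  simp [setEntry]

end SetEntry

section Minors

variable {F : Type*} [Field F] {n : ℕ}

/-- The entries of a matrix, extended by zero to all pairs of natural numbers. -/
def entry (X : Matrix (Fin n) (Fin n) F) (i j : ℕ) : F :=
  if h : i < n ∧ j < n then X ⟨i, h.1⟩ ⟨j, h.2⟩ else 0

/-- The minor on the `k` consecutive rows from `r` on and the `k` consecutive columns
from `s` on. -/
def minor (X : Matrix (Fin n) (Fin n) F) (r s k : ℕ) : F :=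
  (of fun i j : Fin k => entry X (r + i) (s + j)).det

/-- The difference of the leading minor and the minor one row below. -/
def minorDiff (X : Matrix (Fin n) (Fin n) F) (k : ℕ) : F :=
  minor X 0 0 k - minor X 1 0 k

theorem entry_coe (X : Matrix (Fin n) (Fin n) F) (a b : Fin n) : entry X a b = X a b := by
  simp [entry]

theorem entry_setEntry (X : Matrix (Fin n) (Fin n) F) (a b : Fin n) (t : F) (i j : ℕ) :
    entry (setEntry X a b t) i j = if i = a ∧ j = b then t else entry X i j := by
  unfold entry
  by_cases h : i < n ∧ j < n
  · simp [h, setEntry, Fin.ext_iff]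
  · have : ¬ (i = a ∧ j = b) := fun h' => h ⟨h'.1 ▸ a.2, h'.2 ▸ b.2⟩
    simp [h, this]

theorem minor_zero (X : Matrix (Fin n) (Fin n) F) (r s : ℕ) : minor X r s 0 = 1 := by
  simp [minor]

theorem minor_setEntry_of_notMem (X : Matrix (Fin n) (Fin n) F) (a b : Fin n) (t : F) {r s k : ℕ}
    (h : (a : ℕ) < r ∨ r + k ≤ a ∨ (b : ℕ) < s ∨ s + k ≤ b) :
    minor (setEntry X a b t) r s k = minor X r s k := by
  unfold minor
  congr 1
  ext i j
  have hi := i.2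
  have hj := j.2
  simp only [of_apply, entry_setEntry]
  rw [if_neg]
  omega

theorem minor_setEntry_bottomLeft (X : Matrix (Fin n) (Fin n) F) (a b : Fin n) (t : F) {r s k : ℕ}
    (ha : (a : ℕ) = r + k) (hb : (b : ℕ) = s) :
    minor (setEntry X a b t) r s (k + 1) =
      minor X r s (k + 1) + (-1) ^ k * (t - X a b) * minor X r (s + 1) k := by
  have hsub : ∀ Y : Matrix (Fin n) (Fin n) F,
      ((of fun i j : Fin (k + 1) => entry Y (r + i) (s + j)).submatrix
        (Fin.last k).succAbove Fin.succ).det = minor Y r (s + 1) k := fun Y => by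
    unfold minor
    congr 1
    ext i j
    simp [add_comm, add_left_comm]
  have hX : X a b = entry X (r + k) s := by
    rw [← ha, ← hb]
    exact (entry_coe X a b).symm
  unfold minor at hsub ⊢
  rw [det_succ_column_zero, det_succ_column_zero, Fin.sum_univ_castSucc, Fin.sum_univ_castSucc,
    hsub, hsub, hX]
  have h1 : ∀ i : Fin k, (-1 : F) ^ ((Fin.castSucc i : Fin (k + 1)) : ℕ) *
      (of fun i j : Fin (k + 1) => entry (setEntry X a b t) (r + i) (s + j)) (Fin.castSucc i) 0 *
        ((of fun i j : Fin (k + 1) => entry (setEntry X a b t) (r + i) (s + j)).submatrix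
          (Fin.castSucc i).succAbove Fin.succ).det =
      (-1 : F) ^ ((Fin.castSucc i : Fin (k + 1)) : ℕ) *
      (of fun i j : Fin (k + 1) => entry X (r + i) (s + j)) (Fin.castSucc i) 0 *
        ((of fun i j : Fin (k + 1) => entry X (r + i) (s + j)).submatrix
          (Fin.castSucc i).succAbove Fin.succ).det := fun i => by
    have hi := i.2
    congr 1
    · congr 1
      simp only [of_apply, entry_setEntry]
      rw [if_neg]
      simp
      omega
    · congr 1
      ext x y
      simp only [submatrix_apply, of_apply, entry_setEntry]
      rw [if_neg]
      simp
      omega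
  rw [Finset.sum_congr rfl fun i _ => h1 i]
  have h2 : minor (setEntry X a b t) r (s + 1) k = minor X r (s + 1) k :=
    minor_setEntry_of_notMem X a b t (by omega)
  unfold minor at h2
  rw [h2]
  simp only [of_apply, Fin.val_last, Fin.val_zero, add_zero, entry_setEntry, ha, hb, and_self,
    if_true]
  ring

theorem minor_setEntry_topRight (X : Matrix (Fin n) (Fin n) F) (a b : Fin n) (t : F) {r s k : ℕ}
    (ha : (a : ℕ) = r) (hb : (b : ℕ) = s + k) :
    minor (setEntry X a b t) r s (k + 1) =
      minor X r s (k + 1) + (-1) ^ k * (t - X a b) * minor X (r + 1) s k := by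
  have hT : ∀ (Y : Matrix (Fin n) (Fin n) F) (i j l : ℕ), minor Y i j l = minor Yᵀ j i l := by
    intro Y i j l
    rw [minor, minor, ← det_transpose]
    congr 1
    ext x y
    simp [entry, and_comm]
  have hS : (setEntry X a b t)ᵀ = setEntry Xᵀ b a t := by
    ext i j
    simp [setEntry, and_comm]
  rw [hT, hS, minor_setEntry_bottomLeft Xᵀ b a t hb ha, hT X, hT X, transpose_apply]

theorem minorDiff_setEntry_of_notMem (X : Matrix (Fin n) (Fin n) F) (a b : Fin n) (t : F) {k : ℕ}
    (h : k < a ∨ k ≤ b ∨ (k ≤ a ∧ (a : ℕ) < 1)) :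
    minorDiff (setEntry X a b t) k = minorDiff X k := by
  rw [minorDiff, minorDiff, minor_setEntry_of_notMem, minor_setEntry_of_notMem] <;> omega

end Minors

section Pivot

variable {F : Type*} [Field F] [Fintype F] {n : ℕ}

theorem card_mul_count_le_of_pivot_ne_zero (a b : Fin n) {A : Matrix (Fin n) (Fin n) F → Prop}
    {g h : Matrix (Fin n) (Fin n) F → F} {ε : F} (hε : ε ≠ 0)
    (hA : ∀ X t, A X → A (setEntry X a b t))
    (hg : ∀ X t, g (setEntry X a b t) = g X + ε * (t - X a b) * h X) :
    Fintype.card F * count (fun X => A X ∧ g X = 0 ∧ h X ≠ 0) ≤ count A := by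
  have h1 : Fintype.card F * count (fun X => A X ∧ g X = 0 ∧ h X ≠ 0) =
      count (fun z : F × Matrix (Fin n) (Fin n) F => A z.2 ∧ g z.2 = 0 ∧ h z.2 ≠ 0) := by
    rw [count_prod]
    simp
  rw [h1]
  refine count_le_of_injOn (fun z => setEntry z.2 a b z.1) (fun z hz => hA _ _ hz.1) ?_
  rintro ⟨t, X⟩ ⟨t', X'⟩ ⟨-, hX, hX0⟩ ⟨-, hX', -⟩ heq
  simp only at heq hX hX' hX0
  have ht : t = t' := by
    have := congrFun (congrFun heq a) b
    rwa [setEntry_apply_self, setEntry_apply_self] at this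
  have hXX : X' = setEntry X a b (X' a b) := by
    have := congrArg (fun Z => setEntry Z a b (X' a b)) heq
    simp only [setEntry_setEntry, setEntry_self] at this
    exact this.symm
  have h2 := hg X (X' a b)
  rw [← hXX, hX, hX', zero_add, eq_comm, mul_eq_zero, mul_eq_zero, sub_eq_zero] at h2
  have h3 : X' a b = X a b := by tauto
  rw [h3, setEntry_self] at hXX
  rw [ht, hXX]

theorem card_mul_count_le_of_pivot (a b : Fin n) {A : Matrix (Fin n) (Fin n) F → Prop}
    {g h : Matrix (Fin n) (Fin n) F → F} {ε : F} (hε : ε ≠ 0)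
    (hA : ∀ X t, A X → A (setEntry X a b t))
    (hg : ∀ X t, g (setEntry X a b t) = g X + ε * (t - X a b) * h X) :
    Fintype.card F * count (fun X => A X ∧ g X = 0) ≤
      count A + Fintype.card F * count (fun X => A X ∧ h X = 0) := by
  have h1 := card_mul_count_le_of_pivot_ne_zero a b hε hA hg
  have h2 : count (fun X => A X ∧ g X = 0) ≤
      count (fun X => A X ∧ g X = 0 ∧ h X ≠ 0) + count (fun X => A X ∧ h X = 0) :=
    count_le_add fun X hX => by tauto
  calc _ ≤ Fintype.card F * _ := Nat.mul_le_mul_left _ h2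
    _ ≤ _ := by rw [mul_add]; exact Nat.add_le_add_right h1 _

end Pivot

section MinorCounts

variable {F : Type*} [Field F] [Fintype F] {n : ℕ}

theorem pow_mul_le_of_pivot {q N x y z d w : ℕ} (h : q * x ≤ y + q * z)
    (hy : q ^ d * y ≤ 2 ^ w * N) (hz : q ^ (d + 1) * z ≤ 2 ^ w * N) :
    q ^ (d + 1) * x ≤ 2 ^ (w + 1) * N := by
  calc q ^ (d + 1) * x = q ^ d * (q * x) := by ring
    _ ≤ q ^ d * (y + q * z) := Nat.mul_le_mul_left _ h
    _ = q ^ d * y + q ^ (d + 1) * z := by ring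
    _ ≤ 2 ^ w * N + 2 ^ w * N := add_le_add hy hz
    _ = 2 ^ (w + 1) * N := by ring

theorem sum_erase_add {S : Finset ℕ} {m : ℕ} (hm : m ∈ S) : ∑ i ∈ S.erase m, i + m = ∑ i ∈ S, i :=
  Finset.sum_erase_add _ _ hm

/-- Simultaneous vanishing of minors which avoid the first row, in two adjacent column windows. -/
theorem count_minor_one_le (w : ℕ) : ∀ (s : ℕ) (S T : Finset ℕ), ∑ i ∈ S, i + ∑ i ∈ T, i ≤ w →
    (∀ i ∈ S, i + 1 ≤ n ∧ i + s ≤ n) → (∀ i ∈ T, i + 1 ≤ n ∧ i + s + 1 ≤ n) →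
    (∀ i, i + 1 ∈ S → i ∉ T) →
    Fintype.card F ^ (S.card + T.card) * count (fun X : Matrix (Fin n) (Fin n) F =>
      (∀ i ∈ S, minor X 1 s i = 0) ∧ ∀ i ∈ T, minor X 1 (s + 1) i = 0) ≤
      2 ^ w * Fintype.card (Matrix (Fin n) (Fin n) F) := by
  have zero_mem : ∀ (s w : ℕ) (S T : Finset ℕ), 0 ∈ S ∨ 0 ∈ T →
      Fintype.card F ^ (S.card + T.card) * count (fun X : Matrix (Fin n) (Fin n) F =>
        (∀ i ∈ S, minor X 1 s i = 0) ∧ ∀ i ∈ T, minor X 1 (s + 1) i = 0) ≤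
        2 ^ w * Fintype.card (Matrix (Fin n) (Fin n) F) := by
    intro s w S T h
    rw [count_eq_zero, mul_zero]
    · exact Nat.zero_le _
    · rintro X ⟨h1, h2⟩
      rcases h with h | h
      · simpa [minor_zero] using h1 0 h
      · simpa [minor_zero] using h2 0 h
  have empty : ∀ (s w : ℕ), Fintype.card F ^ ((∅ : Finset ℕ).card + (∅ : Finset ℕ).card) *
      count (fun X : Matrix (Fin n) (Fin n) F =>
        (∀ i ∈ (∅ : Finset ℕ), minor X 1 s i = 0) ∧ ∀ i ∈ (∅ : Finset ℕ), minor X 1 (s + 1) i = 0) ≤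
        2 ^ w * Fintype.card (Matrix (Fin n) (Fin n) F) := by
    intro s w
    rw [Finset.card_empty, pow_zero]
    exact Nat.mul_le_mul Nat.one_le_two_pow (count_le_card _)
  induction w with
  | zero =>
    intro s S T hw hS hT hST
    by_cases h0 : 0 ∈ S ∨ 0 ∈ T
    · exact zero_mem s 0 S T h0
    push Not at h0
    have hSe : S = ∅ := Finset.eq_empty_of_forall_notMem fun i hi => by
      have := Finset.single_le_sum (f := fun i => i) (fun _ _ => Nat.zero_le _) hi
      have : i ≠ 0 := fun h => h0.1 (h ▸ hi)
      omega
    have hTe : T = ∅ := Finset.eq_empty_of_forall_notMem fun i hi => by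
      have := Finset.single_le_sum (f := fun i => i) (fun _ _ => Nat.zero_le _) hi
      have : i ≠ 0 := fun h => h0.2 (h ▸ hi)
      omega
    subst hSe hTe
    exact empty s 0
  | succ w ih =>
    have step : ∀ (s : ℕ) (S T : Finset ℕ), S.Nonempty → ∑ i ∈ S, i + ∑ i ∈ T, i ≤ w + 1 →
        (∀ i ∈ S, i + 1 ≤ n ∧ i + s ≤ n) → (∀ i ∈ T, i + 1 ≤ n ∧ i + s + 1 ≤ n) →
        (∀ i, i + 1 ∈ S → i ∉ T) →
        Fintype.card F ^ (S.card + T.card) * count (fun X : Matrix (Fin n) (Fin n) F =>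
          (∀ i ∈ S, minor X 1 s i = 0) ∧ ∀ i ∈ T, minor X 1 (s + 1) i = 0) ≤
          2 ^ (w + 1) * Fintype.card (Matrix (Fin n) (Fin n) F) := by
      intro s S T hne hw hS hT hST
      by_cases h0 : 0 ∈ S
      · exact zero_mem s _ S T (Or.inl h0)
      obtain ⟨m, hm, hmax⟩ : ∃ m ∈ S, ∀ i ∈ S, i ≤ m := ⟨S.max' hne, S.max'_mem hne, S.le_max'⟩
      obtain ⟨m, rfl⟩ : ∃ m', m = m' + 1 :=
        Nat.exists_eq_succ_of_ne_zero fun h => h0 (h ▸ hm)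
      have hmT := hST m hm
      have hmS := hS _ hm
      have hsum := sum_erase_add hm
      have hlt : ∀ i ∈ S.erase (m + 1), i < m + 1 := fun i hi =>
        lt_of_le_of_ne (hmax i (Finset.mem_of_mem_erase hi)) (Finset.ne_of_mem_erase hi)
      have hp := card_mul_count_le_of_pivot (F := F) (n := n) ⟨m + 1, by omega⟩ ⟨s, by omega⟩
        (A := fun X => (∀ i ∈ S.erase (m + 1), minor X 1 s i = 0) ∧
          ∀ i ∈ T, minor X 1 (s + 1) i = 0)
        (g := fun X => minor X 1 s (m + 1)) (h := fun X => minor X 1 (s + 1) m)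
        (ε := (-1) ^ m) (by simp)
        (fun X t hX => ⟨fun i hi => by
            have := hlt i hi
            rw [minor_setEntry_of_notMem, hX.1 i hi]
            simp only
            omega, fun i hi => by
            rw [minor_setEntry_of_notMem, hX.2 i hi]
            simp only
            omega⟩)
        (fun X t => minor_setEntry_bottomLeft X _ _ t (by simp only; omega) rfl)
      have hcard : S.card + T.card = ((S.erase (m + 1)).card + T.card) + 1 := by
        rw [Finset.card_erase_of_mem hm]
        have := Finset.card_pos.2 hne
        omega
      have hcard' : S.card + T.card = (S.erase (m + 1)).card + (insert m T).card := by
        rw [hcard, Finset.card_insert_of_notMem hmT]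
        omega
      have h1 := ih s (S.erase (m + 1)) T (by omega)
        (fun i hi => hS i (Finset.mem_of_mem_erase hi)) hT
        (fun i hi => hST i (Finset.mem_of_mem_erase hi))
      have h2 := ih s (S.erase (m + 1)) (insert m T)
        (by rw [Finset.sum_insert hmT]; omega)
        (fun i hi => hS i (Finset.mem_of_mem_erase hi))
        (fun i hi => by
          rcases Finset.mem_insert.1 hi with rfl | hi
          · omega
          · exact hT i hi)
        (fun i hi hi' => by
          rcases Finset.mem_insert.1 hi' with rfl | hi'
          · simp at hi
          · exact hST i (Finset.mem_of_mem_erase hi) hi')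
      rw [hcard]
      rw [← hcard', hcard] at h2
      refine pow_mul_le_of_pivot (le_trans (Nat.mul_le_mul_left _ (count_mono ?_)) hp) h1
        (le_trans (Nat.mul_le_mul_left _ (count_mono ?_)) h2)
      · exact fun X hX => ⟨⟨fun i hi => hX.1 i (Finset.mem_of_mem_erase hi), hX.2⟩, hX.1 _ hm⟩
      · rintro X ⟨⟨hX1, hX2⟩, hX3⟩
        refine ⟨hX1, fun i hi => ?_⟩
        rcases Finset.mem_insert.1 hi with rfl | hi
        · exact hX3
        · exact hX2 i hi
    intro s S T hw hS hT hST
    rcases S.eq_empty_or_nonempty with rfl | hne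
    · rcases T.eq_empty_or_nonempty with rfl | hne
      · exact empty s _
      · have := step (s + 1) T ∅ hne (by simpa using hw)
          (fun i hi => ⟨(hT i hi).1, by have := (hT i hi).2; omega⟩) (by simp) (by simp)
        rw [add_comm (∅ : Finset ℕ).card]
        refine le_trans (Nat.mul_le_mul_left _ (count_mono ?_)) this
        exact fun X hX => ⟨hX.2, by simp⟩
    · exact step s S T hne hw hS hT hST

theorem count_minorDiff_minor_one_le (w : ℕ) : ∀ (J S T : Finset ℕ),
    ∑ i ∈ J, i + ∑ i ∈ S, i + ∑ i ∈ T, i ≤ w →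
    (∀ i ∈ J, 1 ≤ i ∧ i + 1 ≤ n) → (∀ i ∈ S, i + 1 ≤ n) → (∀ i ∈ T, i + 2 ≤ n + 1) →
    (∀ j ∈ J, ∀ i ∈ S, j ≤ i) → (∀ j ∈ J, ∀ i ∈ T, j ≤ i) → (∀ i, i + 1 ∈ S → i ∉ T) →
    Fintype.card F ^ (J.card + S.card + T.card) * count (fun X : Matrix (Fin n) (Fin n) F =>
      (∀ i ∈ J, minorDiff X i = 0) ∧ (∀ i ∈ S, minor X 1 0 i = 0) ∧ ∀ i ∈ T, minor X 1 1 i = 0) ≤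
      2 ^ w * Fintype.card (Matrix (Fin n) (Fin n) F) := by
  have empty : ∀ (w : ℕ) (S T : Finset ℕ), ∑ i ∈ S, i + ∑ i ∈ T, i ≤ w → (∀ i ∈ S, i + 1 ≤ n) →
      (∀ i ∈ T, i + 2 ≤ n + 1) → (∀ i, i + 1 ∈ S → i ∉ T) →
      Fintype.card F ^ ((∅ : Finset ℕ).card + S.card + T.card) *
      count (fun X : Matrix (Fin n) (Fin n) F => (∀ i ∈ (∅ : Finset ℕ), minorDiff X i = 0) ∧
        (∀ i ∈ S, minor X 1 0 i = 0) ∧ ∀ i ∈ T, minor X 1 1 i = 0) ≤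
        2 ^ w * Fintype.card (Matrix (Fin n) (Fin n) F) := by
    intro w S T hw hS hT hST
    rw [Finset.card_empty, zero_add]
    refine le_trans (Nat.mul_le_mul_left _ (count_mono ?_))
      (count_minor_one_le w 0 S T hw (fun i hi => ?_) (fun i hi => ?_) hST)
    · exact fun X hX => hX.2
    · have := hS i hi; omega
    · have := hT i hi; omega
  induction w with
  | zero =>
    intro J S T hw hJ hS hT hJS hJT hST
    have hJe : J = ∅ := Finset.eq_empty_of_forall_notMem fun i hi => by
      have := Finset.single_le_sum (f := fun i => i) (fun _ _ => Nat.zero_le _) hi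
      have := hJ i hi
      omega
    subst hJe
    exact empty 0 S T (by simpa using hw) hS hT hST
  | succ w ih =>
    intro J S T hw hJ hS hT hJS hJT hST
    rcases J.eq_empty_or_nonempty with rfl | hne
    · exact empty _ S T (by simpa using hw) hS hT hST
    obtain ⟨m, hm, hmax⟩ : ∃ m ∈ J, ∀ i ∈ J, i ≤ m := ⟨J.max' hne, J.max'_mem hne, J.le_max'⟩
    obtain ⟨m, rfl⟩ : ∃ m', m = m' + 1 :=
      Nat.exists_eq_succ_of_ne_zero (Nat.one_le_iff_ne_zero.1 (hJ m hm).1)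
    have hmS : m ∉ S := fun h => by have := hJS _ hm m h; omega
    have hmJ := hJ _ hm
    have hsum := sum_erase_add hm
    have hlt : ∀ i ∈ J.erase (m + 1), i < m + 1 := fun i hi =>
      lt_of_le_of_ne (hmax i (Finset.mem_of_mem_erase hi)) (Finset.ne_of_mem_erase hi)
    have hp := card_mul_count_le_of_pivot (F := F) (n := n) ⟨0, by omega⟩ ⟨m, by omega⟩
      (A := fun X => (∀ i ∈ J.erase (m + 1), minorDiff X i = 0) ∧
        (∀ i ∈ S, minor X 1 0 i = 0) ∧ ∀ i ∈ T, minor X 1 1 i = 0)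
      (g := fun X => minorDiff X (m + 1)) (h := fun X => minor X 1 0 m)
      (ε := (-1) ^ m) (by simp)
      (fun X t hX => ⟨fun i hi => by
          have := hlt i hi
          rw [minorDiff_setEntry_of_notMem, hX.1 i hi]
          simp only
          omega, fun i hi => by
          rw [minor_setEntry_of_notMem, hX.2.1 i hi]
          simp only
          omega, fun i hi => by
          rw [minor_setEntry_of_notMem, hX.2.2 i hi]
          simp only
          omega⟩)
      (fun X t => by
        rw [minorDiff, minor_setEntry_topRight X _ _ t rfl (by simp), minorDiff,
          minor_setEntry_of_notMem (r := 1) _ _ _ _ (by simp)]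
        ring)
    have hcard : J.card + S.card + T.card = ((J.erase (m + 1)).card + S.card + T.card) + 1 := by
      rw [Finset.card_erase_of_mem hm]
      have := Finset.card_pos.2 hne
      omega
    have hcard' : J.card + S.card + T.card =
        (J.erase (m + 1)).card + (insert m S).card + T.card := by
      rw [hcard, Finset.card_insert_of_notMem hmS]
      omega
    have h1 := ih (J.erase (m + 1)) S T (by omega)
      (fun i hi => hJ i (Finset.mem_of_mem_erase hi)) hS hT
      (fun j hj => hJS j (Finset.mem_of_mem_erase hj))
      (fun j hj => hJT j (Finset.mem_of_mem_erase hj)) hST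
    have h2 := ih (J.erase (m + 1)) (insert m S) T
      (by rw [Finset.sum_insert hmS]; omega)
      (fun i hi => hJ i (Finset.mem_of_mem_erase hi))
      (fun i hi => by
        rcases Finset.mem_insert.1 hi with rfl | hi
        · omega
        · exact hS i hi) hT
      (fun j hj i hi => by
        rcases Finset.mem_insert.1 hi with rfl | hi
        · exact Nat.lt_succ_iff.1 (hlt j hj)
        · exact hJS j (Finset.mem_of_mem_erase hj) i hi)
      (fun j hj => hJT j (Finset.mem_of_mem_erase hj))
      (fun i hi hi' => by
        rcases Finset.mem_insert.1 hi with rfl | hi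
        · have := hJT _ hm i hi'
          omega
        · exact hST i hi hi')
    rw [hcard]
    rw [← hcard', hcard] at h2
    refine pow_mul_le_of_pivot (le_trans (Nat.mul_le_mul_left _ (count_mono ?_)) hp) h1
      (le_trans (Nat.mul_le_mul_left _ (count_mono ?_)) h2)
    · exact fun X hX => ⟨⟨fun i hi => hX.1 i (Finset.mem_of_mem_erase hi), hX.2⟩, hX.1 _ hm⟩
    · rintro X ⟨⟨hX1, hX2, hX3⟩, hX4⟩
      refine ⟨hX1, fun i hi => ?_, hX3⟩
      rcases Finset.mem_insert.1 hi with rfl | hi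
      · exact hX4
      · exact hX2 i hi

theorem count_minorDiff_minor_zero_le {k : ℕ} (hk : 1 ≤ k) (hkn : k ≤ n) (w : ℕ) (J T : Finset ℕ)
    (hw : ∑ i ∈ J, i + k + ∑ i ∈ T, i ≤ w) (hJ : ∀ i ∈ J, 1 ≤ i ∧ i < k)
    (hT : ∀ i ∈ T, k ≤ i + 1 ∧ i + 2 ≤ n + 1) :
    Fintype.card F ^ (J.card + 1 + T.card) * count (fun X : Matrix (Fin n) (Fin n) F =>
      (∀ i ∈ J, minorDiff X i = 0) ∧ minor X 0 0 k = 0 ∧ ∀ i ∈ T, minor X 1 1 i = 0) ≤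
      2 ^ w * Fintype.card (Matrix (Fin n) (Fin n) F) := by
  obtain ⟨k, rfl⟩ : ∃ k', k = k' + 1 := Nat.exists_eq_succ_of_ne_zero (by omega)
  obtain ⟨w, rfl⟩ : ∃ w', w = w' + 1 := Nat.exists_eq_succ_of_ne_zero (by omega)
  have hp := card_mul_count_le_of_pivot (F := F) (n := n) ⟨0, by omega⟩ ⟨k, by omega⟩
    (A := fun X => (∀ i ∈ J, minorDiff X i = 0) ∧ ∀ i ∈ T, minor X 1 1 i = 0)
    (g := fun X => minor X 0 0 (k + 1)) (h := fun X => minor X 1 0 k)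
    (ε := (-1) ^ k) (by simp)
    (fun X t hX => ⟨fun i hi => by
        have := hJ i hi
        rw [minorDiff_setEntry_of_notMem, hX.1 i hi]
        simp only
        omega, fun i hi => by
        rw [minor_setEntry_of_notMem, hX.2 i hi]
        simp only
        omega⟩)
    (fun X t => minor_setEntry_topRight X _ _ t rfl (by simp))
  have h1 := count_minorDiff_minor_one_le (F := F) (n := n) w J ∅ T (by simp; omega)
    (fun i hi => by have := hJ i hi; omega) (by simp) (fun i hi => (hT i hi).2)
    (by simp) (fun j hj i hi => by have := hJ j hj; have := hT i hi; omega) (by simp)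
  have h2 := count_minorDiff_minor_one_le (F := F) (n := n) w J {k} T (by simp; omega)
    (fun i hi => by have := hJ i hi; omega) (by simp; omega) (fun i hi => (hT i hi).2)
    (fun j hj i hi => by have := hJ j hj; simp at hi; omega)
    (fun j hj i hi => by have := hJ j hj; have := hT i hi; omega)
    (fun i hi hi' => by have := hT i hi'; simp at hi; omega)
  rw [Finset.card_empty, add_zero] at h1
  rw [Finset.card_singleton, add_right_comm] at h2
  rw [add_right_comm]
  refine pow_mul_le_of_pivot (le_trans (Nat.mul_le_mul_left _ (count_mono ?_)) hp)
    (le_trans (Nat.mul_le_mul_left _ (count_mono ?_)) h1)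
    (le_trans (Nat.mul_le_mul_left _ (count_mono ?_)) h2)
  · exact fun X hX => ⟨⟨hX.1, hX.2.2⟩, hX.2.1⟩
  · exact fun X hX => ⟨hX.1, by simp, hX.2⟩
  · exact fun X hX => ⟨hX.1.1, by simpa using hX.2, hX.1.2⟩

theorem count_minorDiff_two_minors_le {k : ℕ} (hk : 1 ≤ k) (hkn : k + 1 ≤ n) (w : ℕ)
    (J T : Finset ℕ) (hw : ∑ i ∈ J, i + k + k + ∑ i ∈ T, i ≤ w) (hJ : ∀ i ∈ J, 1 ≤ i ∧ i < k)
    (hT : ∀ i ∈ T, k ≤ i ∧ i + 2 ≤ n + 1) :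
    Fintype.card F ^ (J.card + 2 + T.card) * count (fun X : Matrix (Fin n) (Fin n) F =>
      (∀ i ∈ J, minorDiff X i = 0) ∧ minor X 0 0 k = 0 ∧ minor X 1 0 k = 0 ∧
        ∀ i ∈ T, minor X 1 1 i = 0) ≤
      2 ^ w * Fintype.card (Matrix (Fin n) (Fin n) F) := by
  obtain ⟨k, rfl⟩ : ∃ k', k = k' + 1 := Nat.exists_eq_succ_of_ne_zero (by omega)
  obtain ⟨w, rfl⟩ : ∃ w', w = w' + 1 := Nat.exists_eq_succ_of_ne_zero (by omega)
  have hkT : k ∉ T := fun h => by have := hT k h; omega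
  have hp := card_mul_count_le_of_pivot (F := F) (n := n) ⟨k + 1, by omega⟩ ⟨0, by omega⟩
    (A := fun X => (∀ i ∈ J, minorDiff X i = 0) ∧ minor X 0 0 (k + 1) = 0 ∧
      ∀ i ∈ T, minor X 1 1 i = 0)
    (g := fun X => minor X 1 0 (k + 1)) (h := fun X => minor X 1 1 k)
    (ε := (-1) ^ k) (by simp)
    (fun X t hX => ⟨fun i hi => by
        have := hJ i hi
        rw [minorDiff_setEntry_of_notMem, hX.1 i hi]
        simp only
        omega, by
        rw [minor_setEntry_of_notMem, hX.2.1]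
        simp only
        omega, fun i hi => by
        rw [minor_setEntry_of_notMem, hX.2.2 i hi]
        simp only
        omega⟩)
    (fun X t => minor_setEntry_bottomLeft X _ _ t (by simp only; omega) rfl)
  have h1 := count_minorDiff_minor_zero_le (F := F) (n := n) hk (by omega) w J T (by omega) hJ
    (fun i hi => by have := hT i hi; omega)
  have h2 := count_minorDiff_minor_zero_le (F := F) (n := n) hk (by omega) w J (insert k T)
    (by rw [Finset.sum_insert hkT]; omega) hJ
    (fun i hi => by
      rcases Finset.mem_insert.1 hi with rfl | hi
      · omega
      · have := hT i hi; omega)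
  rw [Finset.card_insert_of_notMem hkT] at h2
  rw [show J.card + 2 + T.card = J.card + 1 + T.card + 1 by omega]
  refine pow_mul_le_of_pivot (le_trans (Nat.mul_le_mul_left _ (count_mono ?_)) hp) h1
    (le_trans (Nat.mul_le_mul_left _ (count_mono ?_)) h2)
  · exact fun X hX => ⟨⟨hX.1, hX.2.1, hX.2.2.2⟩, hX.2.2.1⟩
  · rintro X ⟨⟨hX1, hX2, hX3⟩, hX4⟩
    refine ⟨hX1, hX2, fun i hi => ?_⟩
    rcases Finset.mem_insert.1 hi with rfl | hi
    · exact hX4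
    · exact hX3 i hi

theorem count_minorDiff_two_minors_le_of_ne {k : ℕ} (hk : 1 ≤ k) (hkn : k + 1 ≤ n) (w : ℕ) :
    ∀ (J T : Finset ℕ), ∑ i ∈ J, i + k + k + ∑ i ∈ T, i ≤ w →
    (∀ i ∈ J, 1 ≤ i ∧ i + 1 ≤ n ∧ i ≠ k) → (∀ i ∈ T, k ≤ i ∧ i + 2 ≤ n + 1) →
    (∀ j ∈ J, ∀ i ∈ T, j ≤ i) →
    Fintype.card F ^ (J.card + 2 + T.card) * count (fun X : Matrix (Fin n) (Fin n) F =>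
      (∀ i ∈ J, minorDiff X i = 0) ∧ minor X 0 0 k = 0 ∧ minor X 1 0 k = 0 ∧
        ∀ i ∈ T, minor X 1 1 i = 0) ≤
      2 ^ w * Fintype.card (Matrix (Fin n) (Fin n) F) := by
  induction w with
  | zero => intro J T hw; omega
  | succ w ih =>
    intro J T hw hJ hT hJT
    by_cases hlow : ∀ i ∈ J, i < k
    · exact count_minorDiff_two_minors_le hk hkn _ J T hw
        (fun i hi => ⟨(hJ i hi).1, hlow i hi⟩) hT
    push Not at hlow
    obtain ⟨j, hj, hjk⟩ := hlow
    have hne : J.Nonempty := ⟨j, hj⟩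
    obtain ⟨m, hm, hmax⟩ : ∃ m ∈ J, ∀ i ∈ J, i ≤ m := ⟨J.max' hne, J.max'_mem hne, J.le_max'⟩
    obtain ⟨m, rfl⟩ : ∃ m', m = m' + 1 :=
      Nat.exists_eq_succ_of_ne_zero (Nat.one_le_iff_ne_zero.1 (hJ m hm).1)
    have hmT : m ∉ T := fun h => by have := hJT _ hm m h; omega
    have hmJ := hJ _ hm
    have hkm : k ≤ m := by have := hmax j hj; omega
    have hsum := sum_erase_add hm
    have hlt : ∀ i ∈ J.erase (m + 1), i < m + 1 := fun i hi =>
      lt_of_le_of_ne (hmax i (Finset.mem_of_mem_erase hi)) (Finset.ne_of_mem_erase hi)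
    have hp := card_mul_count_le_of_pivot (F := F) (n := n) ⟨m + 1, by omega⟩ ⟨0, by omega⟩
      (A := fun X => (∀ i ∈ J.erase (m + 1), minorDiff X i = 0) ∧
        minor X 0 0 k = 0 ∧ minor X 1 0 k = 0 ∧ ∀ i ∈ T, minor X 1 1 i = 0)
      (g := fun X => minorDiff X (m + 1)) (h := fun X => minor X 1 1 m)
      (ε := -(-1) ^ m) (by simp)
      (fun X t hX => ⟨fun i hi => by
          have := hlt i hi
          rw [minorDiff_setEntry_of_notMem, hX.1 i hi]
          simp only
          omega, by
          rw [minor_setEntry_of_notMem, hX.2.1]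
          simp only
          omega, by
          rw [minor_setEntry_of_notMem, hX.2.2.1]
          simp only
          omega, fun i hi => by
          rw [minor_setEntry_of_notMem, hX.2.2.2 i hi]
          simp only
          omega⟩)
      (fun X t => by
        rw [minorDiff, minor_setEntry_bottomLeft (r := 1) X _ _ t (by simp only; omega) rfl,
          minorDiff, minor_setEntry_of_notMem (r := 0) _ _ _ _ (by simp)]
        ring)
    have hcard : J.card + 2 + T.card = ((J.erase (m + 1)).card + 2 + T.card) + 1 := by
      rw [Finset.card_erase_of_mem hm]
      have := Finset.card_pos.2 hne
      omega
    have hcard' : J.card + 2 + T.card = (J.erase (m + 1)).card + 2 + (insert m T).card := by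
      rw [hcard, Finset.card_insert_of_notMem hmT]
      omega
    have h1 := ih (J.erase (m + 1)) T (by omega)
      (fun i hi => hJ i (Finset.mem_of_mem_erase hi)) hT
      (fun j hj => hJT j (Finset.mem_of_mem_erase hj))
    have h2 := ih (J.erase (m + 1)) (insert m T)
      (by rw [Finset.sum_insert hmT]; omega)
      (fun i hi => hJ i (Finset.mem_of_mem_erase hi))
      (fun i hi => by
        rcases Finset.mem_insert.1 hi with rfl | hi
        · omega
        · exact hT i hi)
      (fun j hj i hi => by
        rcases Finset.mem_insert.1 hi with rfl | hi
        · exact Nat.lt_succ_iff.1 (hlt j hj)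
        · exact hJT j (Finset.mem_of_mem_erase hj) i hi)
    rw [hcard]
    rw [← hcard', hcard] at h2
    refine pow_mul_le_of_pivot (le_trans (Nat.mul_le_mul_left _ (count_mono ?_)) hp) h1
      (le_trans (Nat.mul_le_mul_left _ (count_mono ?_)) h2)
    · exact fun X hX => ⟨⟨fun i hi => hX.1 i (Finset.mem_of_mem_erase hi), hX.2⟩, hX.1 _ hm⟩
    · rintro X ⟨⟨hX1, hX2, hX3, hX4⟩, hX5⟩
      refine ⟨hX1, hX2, hX3, fun i hi => ?_⟩
      rcases Finset.mem_insert.1 hi with rfl | hi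
      · exact hX5
      · exact hX4 i hi

theorem sum_Ico_le (n : ℕ) : ∑ i ∈ Finset.Ico 1 n, i ≤ n * n := by
  calc ∑ i ∈ Finset.Ico 1 n, i ≤ ∑ _i ∈ Finset.Ico 1 n, n :=
        Finset.sum_le_sum fun i hi => (Finset.mem_Ico.1 hi).2.le
    _ = (n - 1) * n := by simp
    _ ≤ n * n := Nat.mul_le_mul_right _ (Nat.sub_le _ _)

/-- Matrices with vanishing minor differences and one vanishing minor. -/
theorem count_minorDiff_minor_le {k : ℕ} (hk : 1 ≤ k) (hkn : k ≤ n) :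
    Fintype.card F ^ n * count (fun X : Matrix (Fin n) (Fin n) F =>
      (∀ i ∈ Finset.Ico 1 n, minorDiff X i = 0) ∧ minor X 0 0 k = 0) ≤
      2 ^ (n * n + 2 * n) * Fintype.card (Matrix (Fin n) (Fin n) F) := by
  have hs := sum_Ico_le n
  rcases hkn.eq_or_lt with rfl | hkn
  · have := count_minorDiff_minor_zero_le (F := F) hk le_rfl (k * k + 2 * k) (Finset.Ico 1 k) ∅
      (by simp only [Finset.sum_empty]; omega) (fun i hi => Finset.mem_Ico.1 hi) (by simp)
    rw [Finset.card_empty, Nat.card_Ico, add_zero, Nat.sub_add_cancel hk] at this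
    refine le_trans (Nat.mul_le_mul_left _ (count_mono ?_)) this
    exact fun X hX => ⟨hX.1, hX.2, by simp⟩
  · have hmem : k ∈ Finset.Ico 1 n := Finset.mem_Ico.2 ⟨hk, hkn⟩
    have hsum := sum_erase_add hmem
    have := count_minorDiff_two_minors_le_of_ne (F := F) hk hkn (n * n + 2 * n)
      ((Finset.Ico 1 n).erase k) ∅ (by simp only [Finset.sum_empty]; omega)
      (fun i hi => by
        have h1 := Finset.ne_of_mem_erase hi
        have h2 := Finset.mem_Ico.1 (Finset.mem_of_mem_erase hi)
        exact ⟨h2.1, h2.2, h1⟩) (by simp) (by simp)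
    rw [Finset.card_empty, Finset.card_erase_of_mem hmem, Nat.card_Ico, add_zero,
      show n - 1 - 1 + 2 = n by omega] at this
    refine le_trans (Nat.mul_le_mul_left _ (count_mono ?_)) this
    intro X hX
    refine ⟨fun i hi => hX.1 i (Finset.mem_of_mem_erase hi), hX.2, ?_, by simp⟩
    have := hX.1 k hmem
    rwa [minorDiff, hX.2, zero_sub, neg_eq_zero] at this

theorem pow_mul_count_minorDiff_of_ne_zero (m : ℕ) (hm : m + 1 ≤ n) :
    Fintype.card F ^ m * count (fun X : Matrix (Fin n) (Fin n) F =>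
      (∀ i, i + 1 < n → minor X 1 0 i ≠ 0) ∧ ∀ i ∈ Finset.Ico 1 (m + 1), minorDiff X i = 0) ≤
      Fintype.card (Matrix (Fin n) (Fin n) F) := by
  induction m with
  | zero => simpa using count_le_card _
  | succ m ih =>
    have hp := card_mul_count_le_of_pivot_ne_zero (F := F) (n := n) ⟨0, by omega⟩ ⟨m, by omega⟩
      (A := fun X => (∀ i, i + 1 < n → minor X 1 0 i ≠ 0) ∧
        ∀ i ∈ Finset.Ico 1 (m + 1), minorDiff X i = 0)
      (g := fun X => minorDiff X (m + 1)) (h := fun X => minor X 1 0 m)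
      (ε := (-1) ^ m) (by simp)
      (fun X t hX => ⟨fun i hi => by
          rw [minor_setEntry_of_notMem]
          · exact hX.1 i hi
          · simp, fun i hi => by
          have := Finset.mem_Ico.1 hi
          rw [minorDiff_setEntry_of_notMem, hX.2 i hi]
          simp only
          omega⟩)
      (fun X t => by
        rw [minorDiff, minor_setEntry_topRight X _ _ t rfl (by simp), minorDiff,
          minor_setEntry_of_notMem (r := 1) _ _ _ _ (by simp)]
        ring)
    refine le_trans ?_ (ih (by omega))
    rw [pow_succ, mul_assoc]
    refine Nat.mul_le_mul_left _ (le_trans (Nat.mul_le_mul_left _ (count_mono ?_)) hp)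
    intro X hX
    refine ⟨⟨hX.1, fun i hi => hX.2 i ?_⟩, hX.2 _ ?_, hX.1 _ (by omega)⟩
    · rw [Finset.mem_Ico] at hi ⊢
      omega
    · rw [Finset.mem_Ico]
      omega

/-- The number of matrices all of whose proper minor differences vanish. -/
theorem count_minorDiff_le (hn : 1 ≤ n) :
    Fintype.card F ^ n * count (fun X : Matrix (Fin n) (Fin n) F =>
      ∀ i ∈ Finset.Ico 1 n, minorDiff X i = 0) ≤
      (Fintype.card F + n * 2 ^ (n * n + 2 * n)) * Fintype.card (Matrix (Fin n) (Fin n) F) := by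
  have h1 := pow_mul_count_minorDiff_of_ne_zero (F := F) (n := n) (n - 1) (by omega)
  rw [Nat.sub_add_cancel hn] at h1
  have h2 := count_exists_le (Finset.Ico 1 n) (fun k (X : Matrix (Fin n) (Fin n) F) =>
    (∀ i ∈ Finset.Ico 1 n, minorDiff X i = 0) ∧ minor X 0 0 k = 0)
  have h3 : ∀ k ∈ Finset.Ico 1 n, Fintype.card F ^ n * count (fun X : Matrix (Fin n) (Fin n) F =>
      (∀ i ∈ Finset.Ico 1 n, minorDiff X i = 0) ∧ minor X 0 0 k = 0) ≤
      2 ^ (n * n + 2 * n) * Fintype.card (Matrix (Fin n) (Fin n) F) := fun k hk => by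
    rw [Finset.mem_Ico] at hk
    exact count_minorDiff_minor_le hk.1 hk.2.le
  have h4 : count (fun X : Matrix (Fin n) (Fin n) F =>
      ∀ i ∈ Finset.Ico 1 n, minorDiff X i = 0) ≤
      count (fun X : Matrix (Fin n) (Fin n) F => (∀ i, i + 1 < n → minor X 1 0 i ≠ 0) ∧
        ∀ i ∈ Finset.Ico 1 n, minorDiff X i = 0) +
      count (fun X : Matrix (Fin n) (Fin n) F => ∃ k ∈ Finset.Ico 1 n,
        (∀ i ∈ Finset.Ico 1 n, minorDiff X i = 0) ∧ minor X 0 0 k = 0) := by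
    refine count_le_add fun X hX => ?_
    by_cases h : ∀ i, i + 1 < n → minor X 1 0 i ≠ 0
    · exact Or.inl ⟨h, hX⟩
    push Not at h
    obtain ⟨i, hi, h0⟩ := h
    have hi1 : 1 ≤ i := by
      by_contra hlt
      obtain rfl : i = 0 := by omega
      simp [minor_zero] at h0
    have hmem : i ∈ Finset.Ico 1 n := Finset.mem_Ico.2 ⟨hi1, by omega⟩
    refine Or.inr ⟨i, hmem, hX, ?_⟩
    have := hX i hmem
    rwa [minorDiff, h0, sub_zero] at this
  have hpow : Fintype.card F ^ n = Fintype.card F * Fintype.card F ^ (n - 1) := by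
    rw [← pow_succ', Nat.sub_add_cancel hn]
  calc _ ≤ Fintype.card F ^ n * _ := Nat.mul_le_mul_left _ (h4.trans (Nat.add_le_add_left h2 _))
    _ ≤ Fintype.card F * Fintype.card (Matrix (Fin n) (Fin n) F) +
        ∑ _k ∈ Finset.Ico 1 n, 2 ^ (n * n + 2 * n) * Fintype.card (Matrix (Fin n) (Fin n) F) := by
        rw [mul_add, Finset.mul_sum]
        refine add_le_add ?_ (Finset.sum_le_sum h3)
        rw [hpow, mul_assoc]
        exact Nat.mul_le_mul_left _ h1
    _ ≤ _ := by
        rw [Finset.sum_const, Nat.card_Ico, smul_eq_mul, add_mul, ← mul_assoc]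
        exact Nat.add_le_add_left (Nat.mul_le_mul_right _ (Nat.mul_le_mul_right _
          (Nat.sub_le _ _))) _

end MinorCounts

section Peeling

variable {F : Type*} [Field F] {n : ℕ}

/-- A matrix whose `i`-th row is the `i + 1`-st standard basis vector, except for the last row. -/
def IsShift (c : Matrix (Fin n) (Fin n) F) : Prop :=
  ∀ i : Fin n, ∀ h : (i : ℕ) + 1 < n, c i = Pi.single ⟨i + 1, h⟩ 1

/-- Interpolates between `1 - s X` (for `k = 0`) and `-X` (for `k = n`). -/
noncomputable def peelMatrix (k : ℕ) (X : Matrix (Fin n) (Fin n) F) : Matrix (Fin n) (Fin n) F[X] :=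
  of fun i j => if (j : ℕ) < k then -C (X i j) else
    (1 : Matrix (Fin n) (Fin n) F[X]) i j - Polynomial.X * C (X i j)

/-- Interpolates between the difference of the reversed characteristic polynomials of `X` and
`c * X` and the difference of the determinants of `-X` and `-(c * X)`. -/
noncomputable def peel (c : Matrix (Fin n) (Fin n) F) (k : ℕ) (X : Matrix (Fin n) (Fin n) F) :
    F[X] :=
  (peelMatrix k X).det - (peelMatrix k (c * X)).det

theorem mul_updateCol (c X : Matrix (Fin n) (Fin n) F) (k : Fin n) (u : Fin n → F) :
    c * X.updateCol k u = (c * X).updateCol k (c *ᵥ u) := by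
  ext i j
  by_cases h : j = k
  · subst h
    simp [mul_apply, mulVec, dotProduct]
  · simp [mul_apply, h]

theorem peelMatrix_updateCol (k : Fin n) (X : Matrix (Fin n) (Fin n) F) (u : Fin n → F) :
    peelMatrix k (X.updateCol k u) = (peelMatrix k X).updateCol k
      (fun i => (1 : Matrix (Fin n) (Fin n) F[X]) i k - Polynomial.X * C (u i)) := by
  ext1 i j
  by_cases h : j = k
  · subst h
    simp [peelMatrix]
  · simp [peelMatrix, h]

theorem peelMatrix_succ_updateCol (k : Fin n) (X : Matrix (Fin n) (Fin n) F) (u : Fin n → F) :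
    peelMatrix (k + 1) (X.updateCol k u) = (peelMatrix k X).updateCol k (fun i => -C (u i)) := by
  ext1 i j
  by_cases h : j = k
  · subst h
    simp [peelMatrix]
  · have h' : (j : ℕ) ≠ k := fun h' => h (Fin.ext h')
    have : j ≤ k ↔ j < k := by rw [Fin.le_def, Fin.lt_def]; omega
    simp [peelMatrix, h, this]

theorem det_peelMatrix_updateCol_sub (k : Fin n) (X : Matrix (Fin n) (Fin n) F) (u v : Fin n → F) :
    (peelMatrix k (X.updateCol k u)).det - (peelMatrix k (X.updateCol k v)).det =
      Polynomial.X * (peelMatrix (k + 1) (X.updateCol k (u - v))).det := by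
  rw [peelMatrix_succ_updateCol, peelMatrix_updateCol, peelMatrix_updateCol, ← det_updateCol_smul,
    sub_eq_iff_eq_add, ← det_updateCol_add]
  congr 2
  ext1 i
  simp only [Pi.add_apply, Pi.smul_apply, Pi.sub_apply, smul_eq_mul, C_sub]
  ring

theorem peel_updateCol_sub (c : Matrix (Fin n) (Fin n) F) (k : Fin n)
    (X : Matrix (Fin n) (Fin n) F) (u v : Fin n → F) :
    peel c k (X.updateCol k u) - peel c k (X.updateCol k v) =
      Polynomial.X * peel c (k + 1) (X.updateCol k (u - v)) := by
  simp only [peel, mul_updateCol, mulVec_sub]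
  rw [mul_sub, ← det_peelMatrix_updateCol_sub, ← det_peelMatrix_updateCol_sub]
  ring

theorem peel_zero (c X : Matrix (Fin n) (Fin n) F) :
    peel c 0 X = X.charpolyRev - (c * X).charpolyRev := by
  have h : ∀ Y : Matrix (Fin n) (Fin n) F, (peelMatrix 0 Y).det = Y.charpolyRev := fun Y => by
    rw [charpolyRev]
    congr 1
  rw [peel, h, h]

theorem charpolyRev_injective {X Y : Matrix (Fin n) (Fin n) F} (h : X.charpolyRev = Y.charpolyRev) :
    X.charpoly = Y.charpoly := by
  rw [← reverse_charpoly, ← reverse_charpoly, reverse, reverse, charpoly_natDegree_eq_dim,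
    charpoly_natDegree_eq_dim] at h
  have := congrArg (reflect (Fintype.card (Fin n))) h
  rwa [reflect_reflect, reflect_reflect] at this

theorem peel_zero_eq_zero_iff (c X : Matrix (Fin n) (Fin n) F) :
    peel c 0 X = 0 ↔ X.charpoly = (c * X).charpoly := by
  rw [peel_zero, sub_eq_zero]
  refine ⟨charpolyRev_injective, fun h => ?_⟩
  rw [← reverse_charpoly, ← reverse_charpoly, h]

theorem eval_zero_det_peelMatrix {k : ℕ} (hk : k ≤ n) (X : Matrix (Fin n) (Fin n) F) :
    (peelMatrix k X).det.eval 0 = (-1) ^ k * minor X 0 0 k := by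
  rw [← coe_evalRingHom, RingHom.map_det]
  set M := (evalRingHom (0 : F)).mapMatrix (peelMatrix k X) with hM
  have hMij : ∀ i j, M i j =
      if (j : ℕ) < k then -X i j else (1 : Matrix (Fin n) (Fin n) F) i j := by
    intro i j
    rw [hM]
    simp only [RingHom.mapMatrix_apply, map_apply, peelMatrix, of_apply, coe_evalRingHom]
    split_ifs
    · simp
    · rw [one_apply, one_apply]
      split_ifs <;> simp
  rw [twoBlockTriangular_det' M (fun i => (i : ℕ) < k)]
  · have h2 : (M.toSquareBlockProp fun i => ¬ (i : ℕ) < k) = 1 := by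
      ext ⟨i, hi⟩ ⟨j, hj⟩
      simp only [toSquareBlockProp, toBlock_apply, hMij, if_neg hj, one_apply, Subtype.mk.injEq]
    rw [h2, det_one, mul_one, minor]
    let e : Fin k ≃ {i : Fin n // (i : ℕ) < k} :=
      { toFun := fun i => ⟨⟨i, by omega⟩, i.2⟩
        invFun := fun i => ⟨i.1, i.2⟩
        left_inv := fun i => rfl
        right_inv := fun i => rfl }
    rw [← det_submatrix_equiv_self e]
    have : (M.toSquareBlockProp fun i => (i : ℕ) < k).submatrix e e =
        -(of fun i j : Fin k => entry X (0 + i) (0 + j)) := by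
      ext i j
      have hi : (i : ℕ) < n := by omega
      have hj : (j : ℕ) < n := by omega
      simp [toSquareBlockProp, hMij, e, entry, hi, hj]
    rw [this, det_neg, Fintype.card_fin]
  · intro i hi j hj
    rw [hMij, if_neg hj, one_apply_ne]
    rintro rfl
    exact hj hi

theorem minor_shift_mul {c : Matrix (Fin n) (Fin n) F} (hc : IsShift c)
    (X : Matrix (Fin n) (Fin n) F) {k : ℕ} (hk : k < n) : minor (c * X) 0 0 k = minor X 1 0 k := by
  unfold minor
  congr 1
  ext i j
  have hi : (i : ℕ) < n := by omega
  have hi' : (i : ℕ) + 1 < n := by omega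
  have hj : (j : ℕ) < n := by omega
  simp only [of_apply, zero_add, entry, hi, hj, and_self, dif_pos, add_comm 1 (i : ℕ), hi']
  rw [mul_apply, hc ⟨i, hi⟩ hi']
  simp [Pi.single_apply]

theorem minorDiff_eq_zero_of_peel {c : Matrix (Fin n) (Fin n) F} (hc : IsShift c)
    {X : Matrix (Fin n) (Fin n) F} {k : ℕ} (hk : k < n) (h : peel c k X = 0) :
    minorDiff X k = 0 := by
  have h1 := congrArg (eval 0) h
  rw [peel, eval_sub, eval_zero_det_peelMatrix hk.le, eval_zero_det_peelMatrix hk.le,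
    minor_shift_mul hc X hk, ← mul_sub, eval_zero] at h1
  exact (mul_eq_zero.1 h1).resolve_left (by simp)

theorem minor_updateCol_of_le (X : Matrix (Fin n) (Fin n) F) (k : Fin n) (u : Fin n → F)
    {i r : ℕ} (h : i ≤ k) : minor (X.updateCol k u) r 0 i = minor X r 0 i := by
  unfold minor
  congr 1
  ext x y
  have hy : (0 + (y : ℕ)) ≠ k := by omega
  simp only [of_apply, entry]
  split_ifs with h'
  · rw [updateCol_ne]
    exact fun h => hy (congrArg Fin.val h)
  · rfl

theorem minorDiff_updateCol_of_le (X : Matrix (Fin n) (Fin n) F) (k : Fin n) (u : Fin n → F)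
    {i : ℕ} (h : i ≤ k) : minorDiff (X.updateCol k u) i = minorDiff X i := by
  rw [minorDiff, minorDiff, minor_updateCol_of_le X k u h, minor_updateCol_of_le X k u h]

theorem count_peel_le_succ [Fintype F] {c : Matrix (Fin n) (Fin n) F} (hc : IsShift c)
    {E : Matrix (Fin n) (Fin n) F → Prop}
    (hE : ∀ X k u v, E (updateCol X k u) → E (updateCol X k v) → E (updateCol X k (u - v)))
    (k : ℕ) (hk : k < n) :
    count (fun X => peel c k X = 0 ∧ (∀ i ∈ Finset.Ico 1 k, minorDiff X i = 0) ∧ E X) ≤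
    count (fun X => peel c (k + 1) X = 0 ∧
      (∀ i ∈ Finset.Ico 1 (k + 1), minorDiff X i = 0) ∧ E X) := by
  have hq : 0 < Fintype.card F ^ n := pow_pos Fintype.card_pos _
  refine Nat.le_of_mul_le_mul_left ?_ hq
  rw [← sum_count_updateCol ⟨k, hk⟩, ← sum_count_updateCol ⟨k, hk⟩]
  refine Finset.sum_le_sum fun X _ => ?_
  by_cases hex : ∃ v, peel c k (X.updateCol ⟨k, hk⟩ v) = 0 ∧
      (∀ i ∈ Finset.Ico 1 k, minorDiff (X.updateCol ⟨k, hk⟩ v) i = 0) ∧ E (X.updateCol ⟨k, hk⟩ v)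
  · obtain ⟨v, hv1, hv2, hv3⟩ := hex
    refine count_le_of_injOn (fun u => u - v) ?_ (fun x y _ _ h => sub_left_injective h)
    rintro u ⟨hu1, hu2, hu3⟩
    refine ⟨?_, fun i hi => ?_, hE _ _ _ _ hu3 hv3⟩
    · have := peel_updateCol_sub c ⟨k, hk⟩ X u v
      rw [hu1, hv1, sub_zero, eq_comm, mul_eq_zero] at this
      exact this.resolve_left X_ne_zero
    · have h1 := Finset.mem_Ico.1 hi
      have h2 : i ≤ k := by omega
      rw [minorDiff_updateCol_of_le (k := ⟨k, hk⟩) X _ h2,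
        ← minorDiff_updateCol_of_le (k := ⟨k, hk⟩) X v h2]
      rcases h2.eq_or_lt with rfl | h2
      · exact minorDiff_eq_zero_of_peel hc hk hv1
      · exact hv2 i (Finset.mem_Ico.2 ⟨h1.1, h2⟩)
  · push Not at hex
    rw [count_eq_zero]
    · exact Nat.zero_le _
    · exact fun u hu => hex u hu.1 hu.2.1 hu.2.2

theorem count_peel_le [Fintype F] {c : Matrix (Fin n) (Fin n) F} (hc : IsShift c)
    {E : Matrix (Fin n) (Fin n) F → Prop}
    (hE : ∀ X k u v, E (updateCol X k u) → E (updateCol X k v) → E (updateCol X k (u - v)))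
    (k : ℕ) (hk : k ≤ n) :
    count (fun X => peel c k X = 0 ∧ (∀ i ∈ Finset.Ico 1 k, minorDiff X i = 0) ∧ E X) ≤
    count (fun X : Matrix (Fin n) (Fin n) F =>
      (∀ i ∈ Finset.Ico 1 n, minorDiff X i = 0) ∧ E X) := by
  induction hk using Nat.decreasingInduction with
  | self => exact count_mono fun X hX => hX.2
  | of_succ k hk ih => exact (count_peel_le_succ hc hE k hk).trans ih

theorem pow_mul_count_peel_le [Fintype F] (hn : 1 ≤ n) {c : Matrix (Fin n) (Fin n) F}
    (hc : IsShift c) {k : ℕ} (hk : k ≤ 1) :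
    Fintype.card F ^ n * count (fun X => peel c k X = 0) ≤
      (Fintype.card F + n * 2 ^ (n * n + 2 * n)) * Fintype.card (Matrix (Fin n) (Fin n) F) := by
  refine le_trans (Nat.mul_le_mul_left _ ?_) (count_minorDiff_le hn)
  refine le_trans (count_mono ?_) ((count_peel_le hc (E := fun _ => True)
    (fun _ _ _ _ _ _ => trivial) k (by omega)).trans (count_mono fun X hX => hX.1))
  refine fun X hX => ⟨hX, fun i hi => ?_, trivial⟩
  rw [Finset.mem_Ico] at hi
  omega

theorem pow_mul_count_peel_det_le [Fintype F] (hn : 1 ≤ n) {c : Matrix (Fin n) (Fin n) F}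
    (hc : IsShift c) :
    Fintype.card F ^ n * count (fun X => peel c 0 X = 0 ∧ X.det = 0) ≤
      2 ^ (n * n + 2 * n) * Fintype.card (Matrix (Fin n) (Fin n) F) := by
  refine le_trans (Nat.mul_le_mul_left _ ?_) (count_minorDiff_minor_le hn le_rfl)
  refine le_trans (count_mono ?_) ((count_peel_le hc (E := fun X => X.det = 0) ?_ 0
    (Nat.zero_le _)).trans (count_mono fun X hX => ⟨hX.1, ?_⟩))
  · refine fun X hX => ⟨hX.1, fun i hi => ?_, hX.2⟩
    rw [Finset.mem_Ico] at hi
    omega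
  · intro X k u v hu hv
    have := det_updateCol_add X k (u - v) v
    rw [sub_add_cancel, hu, hv, add_zero] at this
    exact this.symm
  · rw [minor, ← hX.2]
    congr 1
    ext i j
    simp [entry]

end Peeling

section Krylov

variable {R : Type*} [CommRing R] {n : ℕ}

/-- The matrix with rows `w, w B, w B², …`. -/
def krylov (w : Fin n → R) (B : Matrix (Fin n) (Fin n) R) : Matrix (Fin n) (Fin n) R :=
  of fun i : Fin n => w ᵥ* B ^ (i : ℕ)

/-- The coordinates of `X, X², …, Xⁿ` modulo `p` with respect to `1, X, …, Xⁿ⁻¹`. -/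
noncomputable def modMatrix (n : ℕ) (p : R[X]) : Matrix (Fin n) (Fin n) R :=
  of fun i j => ((Polynomial.X ^ ((i : ℕ) + 1)) %ₘ p).coeff j

theorem krylov_row (w : Fin n → R) (B : Matrix (Fin n) (Fin n) R) (i : Fin n) :
    krylov w B i = w ᵥ* B ^ (i : ℕ) := rfl

theorem vecMul_krylov_eq_vecMul_sum (w v : Fin n → R) (B : Matrix (Fin n) (Fin n) R) :
    v ᵥ* krylov w B = w ᵥ* ∑ i : Fin n, v i • B ^ (i : ℕ) := by
  rw [vecMul_eq_sum, vecMul_sum]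
  exact Finset.sum_congr rfl fun i _ => by rw [vecMul_smul, krylov_row]

theorem vecMul_aeval_eq (w : Fin n → R) (B : Matrix (Fin n) (Fin n) R) {p : R[X]}
    (hp : p.natDegree < n) :
    w ᵥ* aeval B p = (fun j : Fin n => p.coeff j) ᵥ* krylov w B := by
  rw [vecMul_krylov_eq_vecMul_sum, aeval_eq_sum_range' hp, ← Fin.sum_univ_eq_sum_range
    (fun i => p.coeff i • B ^ i)]

theorem krylov_mul_self [Nontrivial R] (w : Fin n → R) (B : Matrix (Fin n) (Fin n) R) :
    krylov w B * B = modMatrix n B.charpoly * krylov w B := by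
  ext1 i
  have h1 : (krylov w B * B) i = w ᵥ* B ^ ((i : ℕ) + 1) := by
    rw [mul_apply_eq_vecMul, krylov_row, vecMul_vecMul, pow_succ]
  have hn : B.charpoly.natDegree = n := by simp
  have hdeg : ((Polynomial.X ^ ((i : ℕ) + 1)) %ₘ B.charpoly).natDegree < n := by
    have hi := i.2
    have := natDegree_modByMonic_lt (Polynomial.X ^ ((i : ℕ) + 1)) B.charpoly_monic
      (fun h => by rw [h, natDegree_one] at hn; omega)
    omega
  rw [h1, pow_eq_aeval_mod_charpoly, vecMul_aeval_eq w B hdeg, mul_apply_eq_vecMul]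
  exact fun _ => rfl

theorem krylov_map {S : Type*} [CommRing S] (f : R →+* S) (w : Fin n → R)
    (B : Matrix (Fin n) (Fin n) R) :
    krylov (fun i => f (w i)) (B.map f) = (krylov w B).map f := by
  ext i j
  have : (B.map f) ^ (i : ℕ) = (B ^ (i : ℕ)).map f := (Matrix.map_pow B f i).symm
  rw [krylov_row, this, map_apply, krylov_row, RingHom.map_vecMul]
  rfl

end Krylov

section RowCyclic

variable {F : Type*} [Field F] {n : ℕ}

/-- The row vector `w` is cyclic for `B`. -/
def RowCyclic (w : Fin n → F) (B : Matrix (Fin n) (Fin n) F) : Prop :=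
  (krylov w B).det ≠ 0

/-- Some eigenspace of `B` has dimension at least two. -/
def HasMultipleEigenvectors (B : Matrix (Fin n) (Fin n) F) : Prop :=
  ∃ (μ : F) (x y : Fin n → F), LinearIndependent F ![x, y] ∧ B *ᵥ x = μ • x ∧ B *ᵥ y = μ • y

theorem exists_eigenvector_of_not_rowCyclic [IsAlgClosed F] {w : Fin n → F}
    {B : Matrix (Fin n) (Fin n) F} (h : ¬ RowCyclic w B) :
    ∃ (μ : F) (x : Fin n → F), x ≠ 0 ∧ B *ᵥ x = μ • x ∧ w ⬝ᵥ x = 0 := by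
  rw [RowCyclic, not_not, ← exists_mulVec_eq_zero_iff] at h
  obtain ⟨v, hv0, hv⟩ := h
  let W := LinearMap.ker (krylov w B).mulVecLin
  have hW : ∀ x ∈ W, B.mulVecLin x ∈ W := fun x hx => by
    simp only [W, LinearMap.mem_ker, mulVecLin_apply] at hx ⊢
    rw [mulVec_mulVec, krylov_mul_self, ← mulVec_mulVec, hx, mulVec_zero]
  have : Nontrivial W := ⟨⟨⟨v, by simpa [W] using hv⟩, 0, fun h => hv0 (congrArg Subtype.val h)⟩⟩
  obtain ⟨μ, hμ⟩ := Module.End.exists_eigenvalue (B.mulVecLin.restrict hW)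
  obtain ⟨x, hx, hx0⟩ := hμ.exists_hasEigenvector
  refine ⟨μ, x, fun h => hx0 (Subtype.ext h), ?_, ?_⟩
  · have := congrArg Subtype.val (Module.End.mem_eigenspace_iff.1 hx)
    simpa using this
  · have hx : krylov w B *ᵥ (x : Fin n → F) = 0 := LinearMap.mem_ker.1 x.2
    rcases n.eq_zero_or_pos with rfl | hn
    · simp [dotProduct]
    have h0 := congrFun hx ⟨0, hn⟩
    simpa [mulVec, krylov_row] using h0

theorem RowCyclic.eq_zero_of_eigenvector {w : Fin n → F} {B : Matrix (Fin n) (Fin n) F}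
    (h : RowCyclic w B) {μ : F} {x : Fin n → F} (hx : B *ᵥ x = μ • x) (hwx : w ⬝ᵥ x = 0) :
    x = 0 := by
  refine eq_zero_of_mulVec_eq_zero h ?_
  have hpow : ∀ i : ℕ, B ^ i *ᵥ x = μ ^ i • x := fun i => by
    induction i with
    | zero => simp
    | succ i ih => rw [pow_succ, ← mulVec_mulVec, hx, mulVec_smul, ih, smul_smul, ← pow_succ']
  ext i
  change krylov w B i ⬝ᵥ x = 0
  rw [krylov_row, ← dotProduct_mulVec, hpow, dotProduct_smul, hwx, smul_zero]

theorem RowCyclic.not_hasMultipleEigenvectors {w : Fin n → F} {B : Matrix (Fin n) (Fin n) F}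
    (h : RowCyclic w B) : ¬ HasMultipleEigenvectors B := by
  rintro ⟨μ, x, y, hli, hx, hy⟩
  rw [LinearIndependent.pair_iff] at hli
  have h1 : (w ⬝ᵥ y) • x + (-(w ⬝ᵥ x)) • y = 0 := by
    refine h.eq_zero_of_eigenvector (μ := μ) ?_ ?_
    · rw [mulVec_add, mulVec_smul, mulVec_smul, hx, hy, smul_add, smul_comm, smul_comm _ μ]
    · rw [dotProduct_add, dotProduct_smul, dotProduct_smul, smul_eq_mul, smul_eq_mul]
      ring
  have hy0 := h.eq_zero_of_eigenvector hy (hli _ _ h1).1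
  have := hli 0 1 (by simp [hy0])
  simp at this

theorem rowCyclic_map_iff {K : Type*} [Field K] (f : F →+* K) (w : Fin n → F)
    (B : Matrix (Fin n) (Fin n) F) : RowCyclic (fun i => f (w i)) (B.map f) ↔ RowCyclic w B := by
  have : (krylov (fun i => f (w i)) (B.map f)).det = f (krylov w B).det := by
    rw [krylov_map, RingHom.map_det]
    rfl
  rw [RowCyclic, RowCyclic, this, _root_.map_ne_zero]

theorem rowCyclic_smul_iff {a : F} (ha : a ≠ 0) (w : Fin n → F) (B : Matrix (Fin n) (Fin n) F) :
    RowCyclic w (a • B) ↔ RowCyclic w B := by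
  have : krylov w (a • B) = diagonal (fun i : Fin n => a ^ (i : ℕ)) * krylov w B := by
    ext i j
    rw [diagonal_mul, krylov_row, krylov_row, _root_.smul_pow, vecMul_smul]
    rfl
  rw [RowCyclic, RowCyclic, this, det_mul, det_diagonal, mul_ne_zero_iff]
  exact and_iff_right (Finset.prod_ne_zero_iff.2 fun i _ => pow_ne_zero _ ha)

theorem natDegree_det_le {M : Matrix (Fin n) (Fin n) F[X]} {d : ℕ}
    (h : ∀ i j, (M i j).natDegree ≤ d) : M.det.natDegree ≤ n * d := by
  rw [det_apply]
  refine natDegree_sum_le_of_forall_le _ _ fun σ _ => ?_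
  refine (natDegree_smul_le _ _).trans ((natDegree_prod_le _ _).trans ?_)
  calc ∑ i, (M (σ i) i).natDegree ≤ ∑ _i : Fin n, d := Finset.sum_le_sum fun i _ => h _ _
    _ = n * d := by simp

theorem exists_finset_not_rowCyclic {w : Fin n → F} (A : Matrix (Fin n) (Fin n) F)
    {B : Matrix (Fin n) (Fin n) F} (h : RowCyclic w B) :
    ∃ S : Finset F, S.card ≤ n * n ∧ ∀ z, ¬ RowCyclic w (z • A + B) → z ∈ S := by
  classical
  let M : Matrix (Fin n) (Fin n) F[X] := (Polynomial.X : F[X]) • A.map C + B.map C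
  let P := (krylov (fun i => C (w i)) M).det
  have heval : ∀ z, P.eval z = (krylov w (z • A + B)).det := fun z => by
    have hM : M.map (evalRingHom z) = z • A + B := by
      ext i j
      simp only [M, Matrix.add_apply, Matrix.smul_apply, map_apply, smul_eq_mul, coe_evalRingHom,
        eval_add, eval_mul, eval_X, eval_C]
    have := krylov_map (evalRingHom z) (fun i => C (w i)) M
    rw [hM] at this
    simp only [coe_evalRingHom, eval_C] at this
    rw [this, ← coe_evalRingHom, RingHom.map_det]
    rfl
  have hP : P ≠ 0 := fun h0 => h <| by
    have := heval 0
    rw [h0, eval_zero, zero_smul, zero_add] at this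
    exact this.symm
  have hMdeg : ∀ i j, (M i j).natDegree ≤ 1 := fun i j => by
    simp only [M, Matrix.add_apply, Matrix.smul_apply, map_apply, smul_eq_mul]
    refine natDegree_add_le_of_degree_le ?_ (by simp)
    exact (natDegree_mul_C_le _ _).trans natDegree_X_le
  have hpow : ∀ (m : ℕ) (j : Fin n), (((fun i => C (w i)) ᵥ* M ^ m) j).natDegree ≤ m := by
    intro m
    induction m with
    | zero => simp
    | succ m ih =>
      intro j
      rw [pow_succ, ← vecMul_vecMul]
      change (∑ i, ((fun i => C (w i)) ᵥ* M ^ m) i * M i j).natDegree ≤ m + 1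
      refine natDegree_sum_le_of_forall_le _ _ fun i _ => ?_
      exact natDegree_mul_le_of_le (ih i) (hMdeg i j)
  refine ⟨P.roots.toFinset, (Multiset.toFinset_card_le _).trans ((card_roots' P).trans
    (natDegree_det_le fun i j => (hpow i j).trans i.2.le)), fun z hz => ?_⟩
  rw [RowCyclic, not_not, ← heval] at hz
  simpa [hP] using hz

theorem count_rowCyclic_commute_le [Fintype F] {w : Fin n → F} {B : Matrix (Fin n) (Fin n) F}
    (h : RowCyclic w B) : count (fun X => X * B = B * X) ≤ Fintype.card F ^ n := by
  have hcard : Fintype.card F ^ n = count fun _ : Fin n → F => True := by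
    rw [count_true]; simp
  rw [hcard]
  refine count_le_of_injOn (fun X => w ᵥ* X) (fun _ _ => trivial) fun X Y hX hY hXY => ?_
  have key : ∀ Z : Matrix (Fin n) (Fin n) F, Z * B = B * Z →
      krylov w B * Z = krylov (w ᵥ* Z) B := fun Z hZ => by
    ext1 i
    have hc : Commute Z (B ^ (i : ℕ)) := (show Commute Z B from hZ).pow_right _
    rw [mul_apply_eq_vecMul, krylov_row, krylov_row, vecMul_vecMul, vecMul_vecMul, hc.eq]
    exact fun _ => rfl
  have : krylov w B * X = krylov w B * Y := by
    rw [key X hX, key Y hY]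
    exact congrArg (fun v => krylov v B) hXY
  have hu : IsUnit (krylov w B) := (isUnit_iff_isUnit_det _).2 (isUnit_iff_ne_zero.2 h)
  exact hu.mul_left_cancel this

theorem isRoot_charpoly_of_eigenvector {B : Matrix (Fin n) (Fin n) F} {μ : F} {x : Fin n → F}
    (hx0 : x ≠ 0) (hx : B *ᵥ x = μ • x) : B.charpoly.IsRoot μ := by
  rw [IsRoot.def, eval_charpoly, ← exists_mulVec_eq_zero_iff]
  refine ⟨x, hx0, ?_⟩
  rw [sub_mulVec, hx, scalar_apply, ← smul_one_eq_diagonal, smul_mulVec, one_mulVec, sub_self]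

theorem card_roots_charpoly_le (B : Matrix (Fin n) (Fin n) F) [DecidableEq F] :
    B.charpoly.roots.toFinset.card ≤ n :=
  (Multiset.toFinset_card_le _).trans ((card_roots' _).trans (by simp))

theorem hasMultipleEigenvectors_of_forall_not_rowCyclic [Fintype F] (hq : n < Fintype.card F)
    {B : Matrix (Fin n) (Fin n) F} (h : ∀ w, ¬ RowCyclic w B) (K : Type*) [Field K]
    [IsAlgClosed K] [Algebra F K] : HasMultipleEigenvectors (B.map (algebraMap F K)) := by
  classical
  by_contra hm
  let S := (B.map (algebraMap F K)).charpoly.roots.toFinset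
  let p : K → (Fin n → F) → Prop := fun μ w => ∃ x : Fin n → K, x ≠ 0 ∧
    B.map (algebraMap F K) *ᵥ x = μ • x ∧ (fun i => algebraMap F K (w i)) ⬝ᵥ x = 0
  have hS : ∀ w, ∃ μ ∈ S, p μ w := fun w => by
    obtain ⟨μ, x, hx0, hx, hwx⟩ := exists_eigenvector_of_not_rowCyclic
      (fun h' => h w ((rowCyclic_map_iff (algebraMap F K) w B).1 h'))
    exact ⟨μ, by simpa [S, charpoly_monic _ |>.ne_zero] using isRoot_charpoly_of_eigenvector hx0 hx,
      x, hx0, hx, hwx⟩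
  have hp : ∀ μ, Fintype.card F * count (p μ) ≤ 1 * Fintype.card (Fin n → F) := fun μ => by
    by_cases hμ : ∃ x : Fin n → K, x ≠ 0 ∧ B.map (algebraMap F K) *ᵥ x = μ • x
    · obtain ⟨x, hx0, hx⟩ := hμ
      obtain ⟨j, hj⟩ := Function.ne_iff.1 hx0
      have hpx : ∀ w, p μ w → (fun i => algebraMap F K (w i)) ⬝ᵥ x = 0 :=
          fun w ⟨z, hz0, hz, hwz⟩ => by
        by_contra hwx
        refine hm ⟨μ, x, z, (LinearIndependent.pair_iff' hx0).2 fun a ha => ?_, hx, hz⟩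
        rw [← ha, dotProduct_smul, smul_eq_mul, mul_eq_zero, or_iff_left hwx] at hwz
        rw [hwz, zero_smul] at ha
        exact hz0 ha.symm
      refine card_mul_count_le_of_line _ (Pi.single j 1) 1 fun w => ?_
      refine (count_mono fun y hy => ?_ : _ ≤ count fun y : F => algebraMap F K y ∈
        ({-((fun i => algebraMap F K (w i)) ⬝ᵥ x) / x j} : Finset K)).trans
        ((count_finset_le _ (algebraMap F K).injective _).trans (by simp))
      have h1 := hpx _ hy
      have h2 : (fun i => algebraMap F K ((w + y • Pi.single j (1 : F) : Fin n → F) i)) =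
          (fun i => algebraMap F K (w i)) + Pi.single j (algebraMap F K y) := by
        ext i
        by_cases hij : i = j
        · subst hij; simp
        · simp [hij]
      rw [h2, add_dotProduct, single_dotProduct] at h1
      rw [Finset.mem_singleton, eq_div_iff hj]
      linear_combination h1
    · rw [count_eq_zero fun w ⟨x, hx0, hx, _⟩ => hμ ⟨x, hx0, hx⟩]
      simp
  have h1 : Fintype.card (Fin n → F) ≤ ∑ μ ∈ S, count (p μ) := by
    rw [← count_true]
    exact (count_mono fun w _ => hS w).trans (count_exists_le S p)
  have h2 : Fintype.card F * Fintype.card (Fin n → F) ≤ n * Fintype.card (Fin n → F) :=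
    calc _ ≤ ∑ μ ∈ S, Fintype.card F * count (p μ) := by
          rw [← Finset.mul_sum]; exact Nat.mul_le_mul_left _ h1
      _ ≤ ∑ μ ∈ S, 1 * Fintype.card (Fin n → F) := Finset.sum_le_sum fun μ _ => hp μ
      _ ≤ n * Fintype.card (Fin n → F) := by
          rw [Finset.sum_const, smul_eq_mul, one_mul]
          exact Nat.mul_le_mul_right _ (card_roots_charpoly_le _)
  exact absurd (Nat.le_of_mul_le_mul_right h2 Fintype.card_pos) (not_le.2 hq)

theorem not_squarefree_charpoly_of_hasMultipleEigenvectors [PerfectField F] {K : Type*} [Field K]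
    [Algebra F K] {B : Matrix (Fin n) (Fin n) F}
    (h : HasMultipleEigenvectors (B.map (algebraMap F K))) : ¬ Squarefree B.charpoly := by
  intro hs
  obtain ⟨μ, x, y, hli, hx, hy⟩ := h
  have hsep := (PerfectField.separable_iff_squarefree.2 hs).map (f := algebraMap F K)
  rw [← charpoly_map] at hsep
  have h1 := rootMultiplicity_le_one_of_separable hsep μ
  have h2 := LinearMap.finrank_eigenspace_le (toLin' (B.map (algebraMap F K))) μ
  rw [charpoly_toLin'] at h2
  let E := Module.End.eigenspace (toLin' (B.map (algebraMap F K))) μ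
  let v : Fin 2 → E := ![⟨x, Module.End.mem_eigenspace_iff.2 hx⟩,
    ⟨y, Module.End.mem_eigenspace_iff.2 hy⟩]
  have hv : LinearIndependent K v := by
    refine LinearIndependent.of_comp E.subtype ?_
    have : E.subtype ∘ v = ![x, y] := by
      ext i : 1
      fin_cases i <;> rfl
    rwa [this]
  have h3 := hv.fintype_card_le_finrank
  rw [Fintype.card_fin] at h3
  change Module.finrank K E ≤ _ at h2
  omega

theorem exists_rowCyclic_of_squarefree_charpoly [Fintype F] (hq : n < Fintype.card F)
    {B : Matrix (Fin n) (Fin n) F} (hs : Squarefree B.charpoly) : ∃ w, RowCyclic w B := by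
  by_contra! h
  exact not_squarefree_charpoly_of_hasMultipleEigenvectors
    (hasMultipleEigenvectors_of_forall_not_rowCyclic hq h (AlgebraicClosure F)) hs

theorem isShift_modMatrix {p : F[X]} (hp : p.Monic) (hn : p.natDegree = n) :
    IsShift (modMatrix n p) := fun i h => by
  ext j
  have hlt : (Polynomial.X ^ ((i : ℕ) + 1) : F[X]).degree < p.degree := by
    rw [degree_X_pow, degree_eq_natDegree hp.ne_zero, hn]
    exact_mod_cast h
  change ((Polynomial.X ^ ((i : ℕ) + 1)) %ₘ p).coeff j = _
  rw [(modByMonic_eq_self_iff hp).2 hlt, coeff_X_pow, Pi.single_apply]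
  exact if_congr (by rw [Fin.ext_iff]) rfl rfl

theorem krylov_single_of_isShift (hn : 0 < n) {c : Matrix (Fin n) (Fin n) F} (hc : IsShift c) :
    krylov (Pi.single ⟨0, hn⟩ 1) c = 1 := by
  have : ∀ (i : ℕ) (hi : i < n), Pi.single ⟨0, hn⟩ 1 ᵥ* c ^ i = Pi.single ⟨i, hi⟩ 1 := by
    intro i
    induction i with
    | zero => intro hi; simp
    | succ i ih =>
      intro hi
      rw [pow_succ, ← vecMul_vecMul, ih (by omega), single_one_vecMul]
      exact hc ⟨i, by omega⟩ hi
  ext i j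
  rw [krylov_row, this i i.2, one_apply, Pi.single_apply]
  exact if_congr eq_comm rfl rfl

theorem card_mul_count_not_rowCyclic_le [Fintype F] (hn : 0 < n) :
    Fintype.card F * count (fun X : Matrix (Fin n) (Fin n) F =>
      ¬ RowCyclic (Pi.single ⟨0, hn⟩ 1) X) ≤
      (n * n + 1) * Fintype.card (Matrix (Fin n) (Fin n) F) := by
  classical
  have hshift : IsShift (modMatrix n (Polynomial.X ^ n : F[X])) :=
    isShift_modMatrix (monic_X_pow n) (natDegree_X_pow n)
  have hN : RowCyclic (Pi.single ⟨0, hn⟩ 1) (modMatrix n (Polynomial.X ^ n : F[X])) := by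
    rw [RowCyclic, krylov_single_of_isShift hn hshift, det_one]
    exact one_ne_zero
  refine card_mul_count_le_of_line _ (modMatrix n (Polynomial.X ^ n : F[X])) _ fun X => ?_
  obtain ⟨S, hS, hSX⟩ := exists_finset_not_rowCyclic X hN
  refine (count_mono fun y hy => ?_ : _ ≤ count fun y : F => y⁻¹ ∈ insert 0 S).trans
    ((count_finset_le _ inv_injective _).trans ((Finset.card_insert_le _ _).trans (by omega)))
  rcases eq_or_ne y 0 with rfl | hy0
  · simp
  · refine Finset.mem_insert_of_mem (hSX _ fun h => hy ?_)
    rwa [← rowCyclic_smul_iff hy0, smul_add, smul_inv_smul₀ hy0] at h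

end RowCyclic

section CyclicCommutant

variable {F : Type*} [Field F]

theorem comp_X_sub_C_ne_zero {g : F[X]} (hg : g ≠ 0) (t : F) :
    g.comp (Polynomial.X - C t) ≠ 0 := fun h => hg <| by
  have := congrArg (fun p => p.comp (Polynomial.X + C t)) h
  simpa [comp_assoc] using this

theorem exists_isCoprime_comp_X_sub_C [Fintype F] {g h : F[X]} (hg : g ≠ 0) (hh : h ≠ 0)
    (hq : h.natDegree * g.natDegree < Fintype.card F) :
    ∃ t, IsCoprime (g.comp (Polynomial.X - C t)) h := by
  classical
  by_contra! H
  let K := AlgebraicClosure F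
  let S : Finset K := Finset.image₂ (fun z r => z - r) (h.aroots K).toFinset (g.aroots K).toFinset
  have hS : S.card ≤ h.natDegree * g.natDegree := by
    refine (Finset.card_image₂_le _ _ _).trans (Nat.mul_le_mul ?_ ?_) <;>
    · refine (Multiset.toFinset_card_le _).trans ((card_roots' _).trans ?_)
      rw [natDegree_map]
  have hmem : ∀ t : F, algebraMap F K t ∈ S := fun t => by
    have := H t
    rw [isCoprime_iff_aeval_ne_zero_of_isAlgClosed F K] at this
    push Not at this
    obtain ⟨z, hz1, hz2⟩ := this
    rw [aeval_comp] at hz1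
    refine Finset.mem_image₂.2 ⟨z, ?_, z - algebraMap F K t, ?_, by ring⟩
    · rw [Multiset.mem_toFinset, mem_aroots]
      exact ⟨hh, hz2⟩
    · rw [Multiset.mem_toFinset, mem_aroots]
      exact ⟨hg, by simpa using hz1⟩
  have := (count_finset_le _ (algebraMap F K).injective S).trans hS
  rw [count_congr fun t => iff_true_intro (hmem t), count_true] at this
  omega

theorem exists_pairwise_isCoprime_comp [Fintype F] {ι : Type*} (S : Finset ι) {g : ι → F[X]}
    (hg : ∀ i ∈ S, g i ≠ 0) {n : ℕ} (hn : ∑ i ∈ S, (g i).natDegree ≤ n)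
    (hq : n * n < Fintype.card F) :
    ∃ s : ι → F, (S : Set ι).Pairwise
      fun i j => IsCoprime ((g i).comp (Polynomial.X - C (s i)))
        ((g j).comp (Polynomial.X - C (s j))) := by
  classical
  induction S using Finset.induction_on with
  | empty => exact ⟨0, by simp⟩
  | insert a S ha ih =>
    rw [Finset.sum_insert ha] at hn
    obtain ⟨s, hs⟩ := ih (fun i hi => hg i (Finset.mem_insert_of_mem hi)) (by omega)
    have hdeg : (∏ i ∈ S, (g i).comp (Polynomial.X - C (s i))).natDegree ≤ n := by
      refine (natDegree_prod_le _ _).trans ?_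
      simp only [natDegree_comp, natDegree_X_sub_C, mul_one]
      omega
    obtain ⟨t, ht⟩ := exists_isCoprime_comp_X_sub_C (hg a (Finset.mem_insert_self a S))
      (Finset.prod_ne_zero_iff.2 fun i hi => comp_X_sub_C_ne_zero
        (hg i (Finset.mem_insert_of_mem hi)) _)
      ((Nat.mul_le_mul hdeg (by omega)).trans_lt hq)
    rw [IsCoprime.prod_right_iff] at ht
    refine ⟨Function.update s a t, ?_⟩
    have hne : ∀ i ∈ S, i ≠ a := fun i hi h => ha (h ▸ hi)
    have : Std.Symm fun i j => IsCoprime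
        ((g i).comp (Polynomial.X - C (Function.update s a t i)))
        ((g j).comp (Polynomial.X - C (Function.update s a t j))) := ⟨fun _ _ h => h.symm⟩
    rw [Finset.coe_insert, Set.pairwise_insert_of_symm]
    refine ⟨fun i hi j hj hij => ?_, fun j hj _ => ?_⟩
    · beta_reduce
      rw [Function.update_of_ne (hne i hi), Function.update_of_ne (hne j hj)]
      exact hs hi hj hij
    · rw [Function.update_self, Function.update_of_ne (hne j hj)]
      exact ht j hj

theorem exists_commute_cyclic [Fintype F] {V : Type*} [AddCommGroup V] [Module F V]
    [FiniteDimensional F V] (hq : Module.finrank F V * Module.finrank F V < Fintype.card F)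
    (f : Module.End F V) : ∃ f' : Module.End F V, Commute f' f ∧ ∃ v : V, ∀ h : F[X],
      h.natDegree < Module.finrank F V → aeval f' h v = 0 → h = 0 := by
  classical
  obtain ⟨ι, _, p, hp, k, ⟨e⟩⟩ := Module.equiv_directSum_of_isTorsion
    (Module.AEval.isTorsion_of_finiteDimensional F V f)
  let g : ι → F[X] := fun i => p i ^ k i
  have hg : ∀ i, g i ≠ 0 := fun i => pow_ne_zero _ (hp i).ne_zero
  let e' : Module.AEval' f ≃ₗ[F[X]] ∀ i, F[X] ⧸ Ideal.span {g i} :=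
    e.trans (DirectSum.linearEquivFunOnFintype F[X] ι _)
  let u : V ≃ₗ[F] ∀ i, F[X] ⧸ Ideal.span {g i} :=
    (Module.AEval'.of f).trans (e'.restrictScalars F)
  have hu : ∀ x, u (f x) = (Polynomial.X : F[X]) • u x := fun x => by
    exact (congrArg e' (Module.AEval'.X_smul_of f x).symm).trans (e'.map_smul _ _)
  have hrank : ∑ i, (g i).natDegree = Module.finrank F V := by
    have : ∀ i, Module.Finite F (F[X] ⧸ Ideal.span {g i}) := fun i =>
      (AdjoinRoot.powerBasis (hg i)).finite
    rw [u.finrank_eq, Module.finrank_pi_fintype]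
    exact Finset.sum_congr rfl fun i _ => finrank_quotient_span_eq_natDegree.symm
  obtain ⟨s, hs⟩ := exists_pairwise_isCoprime_comp Finset.univ (fun i _ => hg i) hrank.le hq
  let Φ : (∀ i, F[X] ⧸ Ideal.span {g i}) →ₗ[F[X]] ∀ i, F[X] ⧸ Ideal.span {g i} :=
    LinearMap.pi fun i => (Polynomial.X + C (s i)) • LinearMap.proj i
  let f' : Module.End F V := u.symm.toLinearMap ∘ₗ Φ.restrictScalars F ∘ₗ u.toLinearMap
  have huf' : ∀ x, u (f' x) = Φ (u x) := fun x => u.apply_symm_apply _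
  have haeval : ∀ (h : F[X]) (x : V) (i : ι),
      u (aeval f' h x) i = h.comp (Polynomial.X + C (s i)) • u x i := fun h => by
    induction h using Polynomial.induction_on with
    | C a =>
      intro x i
      rw [aeval_C, C_comp, Module.algebraMap_end_apply, map_smul, Pi.smul_apply, ← algebraMap_eq,
        algebraMap_smul]
    | add p q hp hq =>
      intro x i
      rw [map_add, LinearMap.add_apply, map_add, Pi.add_apply, hp, hq, add_comp, add_smul]
    | monomial m a ih =>
      intro x i
      rw [pow_succ, ← mul_assoc, map_mul, Module.End.mul_apply, aeval_X, ih, huf',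
        mul_comp _ Polynomial.X,
        mul_smul, X_comp]
      rfl
  refine ⟨f', LinearMap.ext fun x => u.injective ?_, u.symm 1, fun h hdeg h0 => ?_⟩
  · rw [Module.End.mul_apply, Module.End.mul_apply, huf', hu, hu, huf', map_smul]
  · by_contra hne
    have hdvd : ∀ i, (g i).comp (Polynomial.X - C (s i)) ∣ h := fun i => by
      have h1 := haeval h (u.symm 1) i
      rw [h0, map_zero, Pi.zero_apply, u.apply_symm_apply, Pi.one_apply] at h1
      have h2 : (Ideal.Quotient.mk (Ideal.span {g i})) (h.comp (Polynomial.X + C (s i))) = 0 := by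
        rw [← mul_one (h.comp _), ← smul_eq_mul]
        exact h1.symm
      obtain ⟨r, hr⟩ := Ideal.mem_span_singleton.1 (Ideal.Quotient.eq_zero_iff_mem.1 h2)
      refine ⟨r.comp (Polynomial.X - C (s i)), ?_⟩
      rw [← mul_comp, ← hr, comp_assoc]
      simp
    have hprod := natDegree_le_of_dvd
      (Finset.prod_dvd_of_coprime (fun i hi j hj hij => hs hi hj hij) fun i _ => hdvd i) hne
    rw [natDegree_prod _ _ fun i _ => comp_X_sub_C_ne_zero (hg i) _] at hprod
    simp only [natDegree_comp, natDegree_X_sub_C, mul_one] at hprod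
    omega

theorem exists_commute_rowCyclic [Fintype F] {n : ℕ} (hq : n * n < Fintype.card F)
    (a : Matrix (Fin n) (Fin n) F) : ∃ a' : Matrix (Fin n) (Fin n) F, a' * a = a * a' ∧
      ∃ w, RowCyclic w a' := by
  have hfin : Module.finrank F (Fin n → F) = n := by simp
  obtain ⟨f', hf', v, hv⟩ := exists_commute_cyclic (V := Fin n → F) (by rwa [hfin]) (toLin' aᵀ)
  rw [hfin] at hv
  obtain ⟨b, rfl⟩ := toLin'.surjective f'
  refine ⟨bᵀ, ?_, v, fun hdet => ?_⟩
  · have : b * aᵀ = aᵀ * b := toLin'.injective (by rw [toLin'_mul, toLin'_mul]; exact hf'.eq)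
    have := congrArg transpose this
    simpa only [transpose_mul, transpose_transpose] using this.symm
  · obtain ⟨x, hx0, hx⟩ := exists_vecMul_eq_zero_iff.2 hdet
    rw [vecMul_krylov_eq_vecMul_sum] at hx
    let h : F[X] := ∑ i : Fin n, monomial i (x i)
    have hcoeff : ∀ j : Fin n, h.coeff j = x j := fun j => by
      rw [finsetSum_coeff, Finset.sum_eq_single j]
      · rw [coeff_monomial, if_pos rfl]
      · exact fun i _ hij => by rw [coeff_monomial, if_neg fun h => hij (Fin.ext h)]
      · simp
    have hdeg : h.natDegree < n := by
      rcases n.eq_zero_or_pos with rfl | hn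
      · exact absurd (Subsingleton.elim x 0) hx0
      · refine (natDegree_sum_le_of_forall_le (n := n - 1) _ _ fun i _ => ?_).trans_lt (by omega)
        exact (natDegree_monomial_le _).trans (by omega)
    have h0 := hv h hdeg (by
      have h1 : aeval b h = (∑ i : Fin n, x i • bᵀ ^ (i : ℕ))ᵀ := by
        simp only [h, map_sum, aeval_monomial, transpose_sum, transpose_smul, transpose_pow,
          transpose_transpose, ← Algebra.smul_def]
      change aeval (toLinAlgEquiv' b) h v = 0
      rw [aeval_algHom_apply toLinAlgEquiv' b h, h1, toLinAlgEquiv'_apply, mulVec_transpose, hx])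
    exact hx0 (funext fun j => by rw [← hcoeff, h0, coeff_zero, Pi.zero_apply])

end CyclicCommutant

section CommutatorPair

variable {F : Type*} [Field F] {n : ℕ}

/-- Pairs of invertible matrices whose commutator is `c`. -/
def IsCommutatorPair (c a b : Matrix (Fin n) (Fin n) F) : Prop :=
  a.det ≠ 0 ∧ b.det ≠ 0 ∧ a * b = c * b * a

theorem mul_nonsing_inv_comm {a b : Matrix (Fin n) (Fin n) F} (hb : IsUnit b.det)
    (h : a * b = b * a) : a * b⁻¹ = b⁻¹ * a := by
  rw [← nonsing_inv_mul_cancel_left _ (a * b⁻¹) hb, ← Matrix.mul_assoc b, ← h,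
    mul_nonsing_inv_cancel_right _ _ hb]

theorem IsCommutatorPair.charpoly_eq {c a b : Matrix (Fin n) (Fin n) F}
    (h : IsCommutatorPair c a b) : b.charpoly = (c * b).charpoly := by
  obtain ⟨ha, -, hab⟩ := h
  have hu : IsUnit a.det := isUnit_iff_ne_zero.2 ha
  obtain ⟨u, rfl⟩ := (isUnit_iff_isUnit_det a).2 hu
  rw [← charpoly_units_conj u b, hab, mul_nonsing_inv_cancel_right _ _ hu]

end CommutatorPair

section UpperBound

variable {F : Type*} [Field F] [Fintype F] {n : ℕ}

theorem count_not_rowCyclic_mul_add_le (hq : n < Fintype.card F) {w : Fin n → F}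
    {a b : Matrix (Fin n) (Fin n) F} (ha : RowCyclic w a) (hb : b.det ≠ 0) :
    count (fun y : F => ∀ v, ¬ RowCyclic v (b * (a + y • 1))) ≤ n * n * n := by
  classical
  let K := AlgebraicClosure F
  let f := algebraMap F K
  have hbK : IsUnit (b.map f).det := by
    have : (b.map f).det = f b.det := (RingHom.map_det f b).symm
    rw [this]
    exact ((isUnit_iff_ne_zero.2 hb).map f)
  obtain ⟨S, hS, hSw⟩ := exists_finset_not_rowCyclic (-(b.map f)⁻¹) ((rowCyclic_map_iff f w a).2 ha)
  let T : Finset K := S.biUnion fun z => (z • -(b.map f)⁻¹ + a.map f).charpoly.roots.toFinset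
  have hT : T.card ≤ n * n * n :=
    Finset.card_biUnion_le.trans <|
      (Finset.sum_le_card_nsmul _ _ n fun z _ => card_roots_charpoly_le _).trans
        (Nat.mul_le_mul_right _ hS)
  refine (count_mono fun y hy => ?_).trans
    ((count_finset_le (fun y => -f y) (neg_injective.comp f.injective) T).trans hT)
  obtain ⟨μ, x, x', hli, hx, hx'⟩ := hasMultipleEigenvectors_of_forall_not_rowCyclic hq hy K
  have hmap : (b * (a + y • 1)).map f = b.map f * (a.map f + f y • 1) := by
    rw [Matrix.map_mul, Matrix.map_add f (map_add f)]
    congr 2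
    ext i j
    rcases eq_or_ne i j with rfl | h
    · simp
    · simp [h]
  have key : ∀ x : Fin n → K, (b * (a + y • 1)).map f *ᵥ x = μ • x →
      (μ • -(b.map f)⁻¹ + a.map f) *ᵥ x = (-f y) • x := fun x hx => by
    have h1 := congrArg (fun z => (b.map f)⁻¹ *ᵥ z) hx
    simp only [hmap] at h1
    rw [mulVec_mulVec, ← Matrix.mul_assoc, nonsing_inv_mul _ hbK, Matrix.one_mul, add_mulVec,
      smul_mulVec, one_mulVec, mulVec_smul] at h1
    rw [add_mulVec, smul_mulVec, neg_mulVec, smul_neg, ← h1, neg_smul]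
    abel
  refine Finset.mem_biUnion.2 ⟨μ, hSw μ fun h =>
    h.not_hasMultipleEigenvectors ⟨-f y, x, x', hli, key x hx, key x' hx'⟩, ?_⟩
  rw [Multiset.mem_toFinset, mem_roots (charpoly_monic _).ne_zero]
  exact isRoot_charpoly_of_eigenvector (hli.ne_zero 0) (key x hx)

theorem count_det_add_smul_one_eq_zero_le (a : Matrix (Fin n) (Fin n) F) :
    count (fun y : F => (a + y • 1).det = 0) ≤ n := by
  classical
  refine (count_mono fun y hy => ?_).trans
    ((count_finset_le Neg.neg neg_injective a.charpoly.roots.toFinset).trans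
      (card_roots_charpoly_le a))
  obtain ⟨x, hx0, hx⟩ := exists_mulVec_eq_zero_iff.2 hy
  rw [Multiset.mem_toFinset, mem_roots (charpoly_monic _).ne_zero]
  refine isRoot_charpoly_of_eigenvector hx0 ?_
  rw [add_mulVec, smul_mulVec, one_mulVec] at hx
  rw [neg_smul, eq_neg_iff_add_eq_zero, hx]

theorem card_mul_count_not_rowCyclic_of_isCommutatorPair_le (hq : n * n < Fintype.card F)
    (c a : Matrix (Fin n) (Fin n) F) :
    Fintype.card F * count (fun b => IsCommutatorPair c a b ∧ ∀ v, ¬ RowCyclic v b) ≤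
      (n * n * n + n) * count (IsCommutatorPair c a) := by
  have hq' : n < Fintype.card F := (Nat.le_mul_self n).trans_lt hq
  obtain ⟨a', ha', w, hw⟩ := exists_commute_rowCyclic hq a
  set Q := count fun b => IsCommutatorPair c a b ∧ ∀ v, ¬ RowCyclic v b
  have h1 : ∀ y : F, (a' + y • 1).det ≠ 0 → Q ≤ count fun b =>
      IsCommutatorPair c a b ∧ ∀ v, ¬ RowCyclic v (b * (a' + y • 1)) := fun y hy => by
    have hu : IsUnit (a' + y • 1).det := isUnit_iff_ne_zero.2 hy
    have hcomm : a * (a' + y • 1)⁻¹ = (a' + y • 1)⁻¹ * a := by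
      refine mul_nonsing_inv_comm hu ?_
      rw [Matrix.mul_add, Matrix.add_mul, ha', Matrix.mul_smul, Matrix.mul_one,
        Matrix.smul_mul, Matrix.one_mul]
    refine count_le_of_injOn (fun b => b * (a' + y • 1)⁻¹) (fun b ⟨⟨ha, hb, hab⟩, hv⟩ => ?_)
      fun b b' _ _ h => ?_
    · refine ⟨⟨ha, ?_, ?_⟩, ?_⟩
      · rw [det_mul]
        exact mul_ne_zero hb (isUnit_nonsing_inv_det _ hu).ne_zero
      · rw [← Matrix.mul_assoc, hab, ← Matrix.mul_assoc c b, Matrix.mul_assoc (c * b),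
          Matrix.mul_assoc (c * b), hcomm]
      · rwa [nonsing_inv_mul_cancel_right _ _ hu]
    · have := congrArg (· * (a' + y • 1)) h
      simpa only [nonsing_inv_mul_cancel_right _ _ hu] using this
  have h2 : count (fun y : F => (a' + y • 1).det ≠ 0) * Q ≤
      count (IsCommutatorPair c a) * (n * n * n) := by
    refine (count_mul_le_sum h1).trans ?_
    rw [sum_count_comm]
    refine sum_le_count_mul (fun b hb => ?_) fun b hb => count_eq_zero fun _ h => hb h.1
    exact (count_mono fun y h => h.2).trans (count_not_rowCyclic_mul_add_le hq' hw hb.2.1)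
  have h3 : Fintype.card F ≤ n + count (fun y : F => (a' + y • 1).det ≠ 0) := by
    rw [← count_true]
    refine (count_le_add fun y _ => em _).trans
      (Nat.add_le_add_right (count_det_add_smul_one_eq_zero_le a') _)
  have h4 : Q ≤ count (IsCommutatorPair c a) := count_mono fun b h => h.1
  calc Fintype.card F * Q ≤ (n + count (fun y : F => (a' + y • 1).det ≠ 0)) * Q :=
        Nat.mul_le_mul_right _ h3
    _ ≤ n * count (IsCommutatorPair c a) + count (IsCommutatorPair c a) * (n * n * n) := by
        rw [add_mul]
        exact Nat.add_le_add (Nat.mul_le_mul_left _ h4) h2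
    _ = _ := by ring

theorem count_isCommutatorPair_le_of_rowCyclic (c : Matrix (Fin n) (Fin n) F) {w : Fin n → F}
    {b : Matrix (Fin n) (Fin n) F} (hw : RowCyclic w b) :
    count (fun a => IsCommutatorPair c a b) ≤ Fintype.card F ^ n := by
  by_cases h : ∃ a, IsCommutatorPair c a b
  · obtain ⟨a₀, ha₀, hb, h₀⟩ := h
    have hu : IsUnit a₀.det := isUnit_iff_ne_zero.2 ha₀
    refine (count_le_of_injOn (fun a => a₀⁻¹ * a) (fun a ⟨_, _, ha⟩ => ?_)
      fun a a' _ _ h => ?_).trans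
      (count_rowCyclic_commute_le hw)
    · have := congrArg (a₀ * ·) h
      simpa only [mul_nonsing_inv_cancel_left _ _ hu] using this
    · have : a₀⁻¹ * (c * b) = b * a₀⁻¹ := by
        rw [← mul_nonsing_inv_cancel_right _ (c * b) hu, ← h₀, ← Matrix.mul_assoc,
          nonsing_inv_mul_cancel_left _ _ hu]
      rw [Matrix.mul_assoc, ha, ← Matrix.mul_assoc, this, Matrix.mul_assoc]
  · rw [count_eq_zero fun a ha => h ⟨a, ha⟩]
    exact Nat.zero_le _

theorem card_mul_count_isCommutatorPair_le (hn : 1 ≤ n) (hq : n * n < Fintype.card F)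
    {c : Matrix (Fin n) (Fin n) F} (hc : IsShift c) :
    Fintype.card F * count (fun p : Matrix (Fin n) (Fin n) F × Matrix (Fin n) (Fin n) F =>
        IsCommutatorPair c p.1 p.2) ≤
      Fintype.card F * ((Fintype.card F + n * 2 ^ (n * n + 2 * n)) *
        Fintype.card (Matrix (Fin n) (Fin n) F)) +
      (n * n * n + n) * count (fun p : Matrix (Fin n) (Fin n) F × Matrix (Fin n) (Fin n) F =>
        IsCommutatorPair c p.1 p.2) := by
  rw [count_prod]
  have h1 : ∀ a, count (fun b => IsCommutatorPair c a b) =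
      count (fun b => IsCommutatorPair c a b ∧ ∃ v, RowCyclic v b) +
        count (fun b => IsCommutatorPair c a b ∧ ∀ v, ¬ RowCyclic v b) := fun a => by
    rw [← count_and_add_count_and_not _ fun b => ∃ v, RowCyclic v b]
    simp only [not_exists]
  have h2 : ∑ a, count (fun b => IsCommutatorPair c a b ∧ ∃ v, RowCyclic v b) ≤
      (Fintype.card F + n * 2 ^ (n * n + 2 * n)) * Fintype.card (Matrix (Fin n) (Fin n) F) := by
    rw [sum_count_comm]
    refine (sum_le_count_mul (p := fun b => peel c 0 b = 0) (m := Fintype.card F ^ n)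
      (fun b _ => ?_) fun b hb => ?_).trans ?_
    · by_cases hv : ∃ v, RowCyclic v b
      · obtain ⟨v, hv⟩ := hv
        exact (count_mono fun a h => h.1).trans (count_isCommutatorPair_le_of_rowCyclic c hv)
      · rw [count_eq_zero fun a h => hv h.2]
        exact Nat.zero_le _
    · exact count_eq_zero fun a h => hb ((peel_zero_eq_zero_iff c b).2 h.1.charpoly_eq)
    · rw [mul_comm]
      exact pow_mul_count_peel_le hn hc zero_le_one
  calc _ = Fintype.card F * ∑ a, count (fun b => IsCommutatorPair c a b ∧ ∃ v, RowCyclic v b) +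
      ∑ a, Fintype.card F * count (fun b => IsCommutatorPair c a b ∧ ∀ v, ¬ RowCyclic v b) := by
        rw [← Finset.mul_sum, ← mul_add, ← Finset.sum_add_distrib]
        exact congrArg _ (Finset.sum_congr rfl fun a _ => h1 a)
    _ ≤ _ := by
        refine Nat.add_le_add (Nat.mul_le_mul_left _ h2) ?_
        rw [Finset.mul_sum]
        exact Finset.sum_le_sum fun a _ =>
          card_mul_count_not_rowCyclic_of_isCommutatorPair_le hq c a

end UpperBound

section Fibers

variable {F : Type*} [Field F]

theorem finrank_degreeLT (m : ℕ) : Module.finrank F (degreeLT F m) = m := by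
  rw [(degreeLTEquiv F m).finrank_eq, Module.finrank_fin_fun]

theorem card_pow_two_le_or_card_le_of_degreeLT [Fintype F] {V : Type*} [AddCommGroup V]
    [Module F V] [Fintype V] {m : ℕ} (hV : Module.finrank F V = m + 1) (φ : V →ₗ[F] F[X])
    (hφ : ∀ u, φ u ∈ degreeLT F m) : Fintype.card F ≤ count (fun u => φ u = 0) ∧
      (Fintype.card F ^ 2 ≤ count (fun u => φ u = 0) ∨
        ∀ h ∈ degreeLT F m, Fintype.card F ≤ count fun u => φ u = h) := by
  have hfin : FiniteDimensional F V := Module.Finite.of_finite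
  have hcard : count (fun u => φ u = 0) = Fintype.card F ^ Module.finrank F φ.ker := by
    classical
    rw [← natCard_subtype, ← Nat.card_eq_fintype_card (α := F), ← Module.natCard_eq_pow_finrank]
    rfl
  have hfindeg : FiniteDimensional F (degreeLT F m) :=
    Module.Finite.equiv (degreeLTEquiv F m).symm
  have hle : φ.range ≤ degreeLT F m := by
    rintro _ ⟨u, rfl⟩
    exact hφ u
  have hrank := φ.finrank_range_add_finrank_ker
  have hrange := (Submodule.finrank_mono hle).trans_eq (finrank_degreeLT m)
  have h1 : Fintype.card F ≤ count (fun u => φ u = 0) := by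
    rw [hcard]
    exact Nat.le_self_pow (by omega) _
  refine ⟨h1, ?_⟩
  rcases Nat.lt_or_ge (Module.finrank F φ.ker) 2 with h | h
  · refine Or.inr fun p hp => h1.trans ?_
    have htop : φ.range = degreeLT F m :=
      Submodule.eq_of_le_of_finrank_eq hle (by rw [finrank_degreeLT]; omega)
    obtain ⟨v, rfl⟩ := htop.ge hp
    exact count_le_of_injOn (fun u => u + v) (fun u hu => by rw [map_add, hu, zero_add])
      fun _ _ _ _ h => add_right_cancel h
  · left
    rw [hcard]
    exact Nat.pow_le_pow_right Fintype.card_pos h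

variable {n : ℕ}

/-- `peel c (k + 1)` as a linear function of the `k`-th column. -/
noncomputable def peelMap (c : Matrix (Fin n) (Fin n) F) (k : Fin n)
    (X : Matrix (Fin n) (Fin n) F) : (Fin n → F) →ₗ[F] F[X] where
  toFun u := peel c (k + 1) (X.updateCol k u)
  map_add' u v := by
    have h1 := peel_updateCol_sub c k X (u + v) v
    have h2 := peel_updateCol_sub c k X v 0
    have h3 := peel_updateCol_sub c k X (u + v) 0
    rw [add_sub_cancel_right] at h1
    rw [sub_zero] at h2 h3
    refine mul_left_cancel₀ (X_ne_zero (R := F)) ?_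
    rw [mul_add, ← h1, ← h2, ← h3]
    ring
  map_smul' a u := by
    have h : ∀ (Y : Matrix (Fin n) (Fin n) F) (v : Fin n → F),
        (peelMatrix (k + 1) (Y.updateCol k (a • v))).det =
          C a * (peelMatrix (k + 1) (Y.updateCol k v)).det := fun Y v => by
      rw [peelMatrix_succ_updateCol, peelMatrix_succ_updateCol, ← det_updateCol_smul]
      congr 2
      ext1 i
      simp
    simp only [peel, mul_updateCol, mulVec_smul, h, RingHom.id_apply, smul_eq_C_mul]
    ring

theorem peel_zero_mem_degreeLT {c : Matrix (Fin n) (Fin n) F} (hc : c.det = 1)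
    (X : Matrix (Fin n) (Fin n) F) : peel c 0 X ∈ degreeLT F n := by
  have hdeg : ∀ Y : Matrix (Fin n) (Fin n) F, Y.charpolyRev.natDegree ≤ n := fun Y => by
    rw [← reverse_charpoly]
    exact (reverse_natDegree_le _).trans (by simp)
  have hcoeff : ∀ Y : Matrix (Fin n) (Fin n) F, Y.charpolyRev.coeff n = (-1) ^ n * Y.det :=
    fun Y => by
      rw [← reverse_charpoly, coeff_reverse, charpoly_natDegree_eq_dim, Fintype.card_fin,
        revAt_le le_rfl, Nat.sub_self, det_eq_sign_charpoly_coeff, Fintype.card_fin, ← mul_assoc,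
        ← mul_pow, neg_mul_neg, one_mul, one_pow, one_mul]
  rw [mem_degreeLT, peel_zero, degree_lt_iff_coeff_zero]
  intro m hm
  rw [coeff_sub]
  rcases hm.eq_or_lt with rfl | hm
  · rw [hcoeff, hcoeff, det_mul, hc, one_mul, sub_self]
  · rw [coeff_eq_zero_of_natDegree_lt ((hdeg _).trans_lt hm),
      coeff_eq_zero_of_natDegree_lt ((hdeg _).trans_lt hm), sub_self]

theorem mem_degreeLT_of_X_mul {m : ℕ} {p : F[X]} (h : Polynomial.X * p ∈ degreeLT F (m + 1)) :
    p ∈ degreeLT F m := by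
  rw [mem_degreeLT, degree_lt_iff_coeff_zero] at h ⊢
  intro i hi
  rw [← coeff_X_mul]
  exact h _ (by omega)

theorem card_le_count_peel_updateCol [Fintype F] {m : ℕ} {c : Matrix (Fin (m + 1)) (Fin (m + 1)) F}
    (hc : c.det = 1) (X : Matrix (Fin (m + 1)) (Fin (m + 1)) F) :
    Fintype.card F ≤ count (fun u => peel c 1 (X.updateCol 0 u) = 0) ∧
      (Fintype.card F ^ 2 ≤ count (fun u => peel c 1 (X.updateCol 0 u) = 0) ∨
        Fintype.card F ≤ count fun u => peel c 0 (X.updateCol 0 u) = 0) := by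
  have hφ : ∀ u, Polynomial.X * peelMap c 0 X u =
      peel c 0 (X.updateCol 0 u) - peel c 0 (X.updateCol 0 0) := fun u => by
    have := peel_updateCol_sub c 0 X u 0
    rw [sub_zero] at this
    exact this.symm
  obtain ⟨h1, h2⟩ := card_pow_two_le_or_card_le_of_degreeLT (by simp) (peelMap c 0 X) fun u =>
    mem_degreeLT_of_X_mul (m := m) (hφ u ▸ sub_mem (peel_zero_mem_degreeLT hc _)
      (peel_zero_mem_degreeLT hc _))
  refine ⟨h1, h2.imp id fun h2 => ?_⟩
  have h0 : (peel c 0 (X.updateCol 0 0)).coeff 0 = 0 := by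
    rw [peel_zero, coeff_zero_eq_eval_zero, eval_sub, eval_charpolyRev, eval_charpolyRev, sub_self]
  obtain ⟨p, hp⟩ := X_dvd_iff.2 h0
  refine (h2 (-p) (neg_mem (mem_degreeLT_of_X_mul (hp ▸ peel_zero_mem_degreeLT hc _)))).trans
    (count_mono fun u hu => ?_)
  have := hφ u
  rw [hu, hp] at this
  linear_combination -this

end Fibers

section LowerBound

variable {F : Type*} [Field F] {n : ℕ}

theorem RowCyclic.updateCol {k : Fin n} {X : Matrix (Fin n) (Fin n) F}
    (h : RowCyclic (Pi.single k 1) X) (u : Fin n → F) :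
    RowCyclic (Pi.single k 1) (X.updateCol k u) := by
  let f := algebraMap F (AlgebraicClosure F)
  by_contra hX
  rw [← rowCyclic_map_iff f] at h hX
  obtain ⟨μ, x, hx0, hx, hwx⟩ := exists_eigenvector_of_not_rowCyclic hX
  refine hx0 (h.eq_zero_of_eigenvector (μ := μ) ?_ hwx)
  have hk : x k = 0 := by
    have : (fun i => f ((Pi.single k 1 : Fin n → F) i)) = Pi.single k 1 := by
      ext i
      rcases eq_or_ne i k with rfl | hi
      · simp
      · simp [hi]
    rwa [this, single_dotProduct, one_mul] at hwx
  rw [← hx]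
  ext i
  change ∑ j, X.map f i j * x j = ∑ j, (X.updateCol k u).map f i j * x j
  refine Finset.sum_congr rfl fun j _ => ?_
  rcases eq_or_ne j k with rfl | hj
  · rw [hk, mul_zero, mul_zero]
  · rw [map_apply, map_apply, updateCol_ne hj]

theorem isCommutatorPair_inv_krylov_mul {c b : Matrix (Fin n) (Fin n) F} {w w' : Fin n → F}
    (hb : b.det ≠ 0) (hw : RowCyclic w b) (hw' : RowCyclic w' (c * b))
    (h : b.charpoly = (c * b).charpoly) :
    IsCommutatorPair c ((krylov w' (c * b))⁻¹ * krylov w b) b := by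
  have hu : IsUnit (krylov w' (c * b)).det := isUnit_iff_ne_zero.2 hw'
  refine ⟨?_, hb, ?_⟩
  · rw [det_mul]
    exact mul_ne_zero (isUnit_nonsing_inv_det _ hu).ne_zero hw
  · have h1 := krylov_mul_self w' (c * b)
    have h2 : c * b * (krylov w' (c * b))⁻¹ =
        (krylov w' (c * b))⁻¹ * modMatrix n (c * b).charpoly := by
      rw [← nonsing_inv_mul_cancel_left _ (c * b * _) hu, ← Matrix.mul_assoc (krylov _ _), h1,
        mul_nonsing_inv_cancel_right _ _ hu]
    rw [Matrix.mul_assoc, krylov_mul_self, h, ← Matrix.mul_assoc, ← h2, ← Matrix.mul_assoc]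

variable [Fintype F]

theorem card_pow_le_count_isCommutatorPair (hn : 0 < n) {c b : Matrix (Fin n) (Fin n) F}
    {w w' : Fin n → F} (hb : b.det ≠ 0) (hw : RowCyclic w b) (hw' : RowCyclic w' (c * b))
    (h : b.charpoly = (c * b).charpoly) :
    Fintype.card F * Fintype.card F ^ n ≤ n * Fintype.card F ^ n +
      Fintype.card F * count (fun a => IsCommutatorPair c a b) := by
  obtain ⟨a₀, ha₀, -, h₀⟩ : ∃ a, IsCommutatorPair c a b :=
    ⟨_, isCommutatorPair_inv_krylov_mul hb hw hw' h⟩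
  let p : (Fin n → F) → Matrix (Fin n) (Fin n) F := fun f => ∑ i : Fin n, f i • b ^ (i : ℕ)
  have hpw : ∀ f, w ᵥ* p f = f ᵥ* krylov w b := fun f => (vecMul_krylov_eq_vecMul_sum w f b).symm
  have hpb : ∀ f, p f * b = b * p f := fun f => by
    simp only [p, Finset.sum_mul, Finset.mul_sum, Matrix.smul_mul, Matrix.mul_smul, ← pow_succ,
      ← pow_succ']
  have hline : ∀ (f : Fin n → F) (y : F), p (f + y • Pi.single ⟨0, hn⟩ 1) = p f + y • 1 :=
    fun f y => by
      simp only [p, Pi.add_apply, Pi.smul_apply, add_smul, Finset.sum_add_distrib]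
      rw [Finset.sum_eq_single (⟨0, hn⟩ : Fin n) (f := fun i => (y • _) • _)]
      · simp
      · intro i _ hi
        simp [hi]
      · simp
  have hcard : Fintype.card (Fin n → F) = Fintype.card F ^ n := by simp
  have h1 : Fintype.card F * count (fun f => (p f).det = 0) ≤ n * Fintype.card F ^ n := by
    rw [← hcard]
    refine card_mul_count_le_of_line _ (Pi.single ⟨0, hn⟩ 1) n fun f => ?_
    simp only [hline]
    exact count_det_add_smul_one_eq_zero_le (p f)
  have h2 : count (fun f => (p f).det ≠ 0) ≤ count (fun a => IsCommutatorPair c a b) := by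
    refine count_le_of_injOn (fun f => a₀ * p f) (fun f hf => ⟨?_, hb, ?_⟩) fun f g _ _ hfg => ?_
    · rw [det_mul]
      exact mul_ne_zero ha₀ hf
    · rw [Matrix.mul_assoc, hpb, ← Matrix.mul_assoc, h₀, Matrix.mul_assoc]
    · have hp : p f = p g := ((isUnit_iff_isUnit_det a₀).2
        (isUnit_iff_ne_zero.2 ha₀)).mul_left_cancel hfg
      have : f ᵥ* krylov w b = g ᵥ* krylov w b := by rw [← hpw, ← hpw, hp]
      exact vecMul_injective_of_isUnit ((isUnit_iff_isUnit_det _).2 (isUnit_iff_ne_zero.2 hw)) this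
  have h3 : Fintype.card F ^ n ≤
      count (fun f => (p f).det = 0) + count (fun f => (p f).det ≠ 0) := by
    rw [← hcard, ← count_true]
    exact count_le_add fun f _ => em _
  calc _ ≤ Fintype.card F *
        (count (fun f => (p f).det = 0) + count (fun f => (p f).det ≠ 0)) :=
        Nat.mul_le_mul_left _ h3
    _ ≤ _ := by
        rw [mul_add]
        exact Nat.add_le_add h1 (Nat.mul_le_mul_left _ h2)

theorem card_mul_count_sq_le_count_peel_le {m : ℕ}
    {c : Matrix (Fin (m + 1)) (Fin (m + 1)) F} (hdet : c.det = 1) (hc : IsShift c) :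
    Fintype.card F * count (fun X : Matrix (Fin (m + 1)) (Fin (m + 1)) F => Fintype.card F ^ 2 ≤
        count fun u => peel c 1 (X.updateCol 0 u) = 0) ≤
      (m + 1) * 2 ^ ((m + 1) * (m + 1) + 2 * (m + 1)) *
        Fintype.card (Matrix (Fin (m + 1)) (Fin (m + 1)) F) := by
  set q := Fintype.card F
  set M := Fintype.card (Matrix (Fin (m + 1)) (Fin (m + 1)) F)
  set N := count fun X : Matrix (Fin (m + 1)) (Fin (m + 1)) F =>
    q ^ 2 ≤ count fun u => peel c 1 (X.updateCol 0 u) = 0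
  have hq : 2 ≤ q := Fintype.one_lt_card
  have h1 : ∑ X : Matrix (Fin (m + 1)) (Fin (m + 1)) F,
      count (fun u => peel c 1 (X.updateCol 0 u) = 0) ≤
        (q + (m + 1) * 2 ^ ((m + 1) * (m + 1) + 2 * (m + 1))) * M := by
    rw [sum_count_updateCol 0 fun X => peel c 1 X = 0]
    exact pow_mul_count_peel_le (by omega) hc le_rfl
  have h2 : M * q + N * (q ^ 2 - q) ≤ ∑ X : Matrix (Fin (m + 1)) (Fin (m + 1)) F,
      count (fun u => peel c 1 (X.updateCol 0 u) = 0) := by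
    classical
    rw [← sum_ite_eq_count_mul, show M * q = ∑ X : Matrix (Fin (m + 1)) (Fin (m + 1)) F, q by
      simp [M], ← Finset.sum_add_distrib]
    refine Finset.sum_le_sum fun X _ => ?_
    have := (card_le_count_peel_updateCol hdet X).1
    split_ifs with h <;> omega
  have h3 : N * q ≤ N * (q ^ 2 - q) := Nat.mul_le_mul_left _ (by
    have : 2 * q ≤ q ^ 2 := by rw [sq]; exact Nat.mul_le_mul_right _ hq
    omega)
  rw [add_mul] at h1
  rw [mul_comm q N]
  rw [mul_comm q M] at h1
  omega

theorem card_mul_card_le_pow_mul_count_rowCyclic {m : ℕ}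
    {c : Matrix (Fin (m + 1)) (Fin (m + 1)) F} (hdet : c.det = 1) (hc : IsShift c) :
    Fintype.card F * Fintype.card (Matrix (Fin (m + 1)) (Fin (m + 1)) F) ≤
      Fintype.card F ^ (m + 1) * count (fun X : Matrix (Fin (m + 1)) (Fin (m + 1)) F =>
        X.det ≠ 0 ∧ peel c 0 X = 0 ∧ RowCyclic (Pi.single 0 1) X ∧
          RowCyclic (Pi.single 0 1) (c * X)) +
      (2 * ((m + 1) * (m + 1) + 1) + (m + 2) * 2 ^ ((m + 1) * (m + 1) + 2 * (m + 1))) *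
        Fintype.card (Matrix (Fin (m + 1)) (Fin (m + 1)) F) := by
  set q := Fintype.card F
  set M := Fintype.card (Matrix (Fin (m + 1)) (Fin (m + 1)) F)
  let e : Fin (m + 1) → F := Pi.single 0 1
  let good : Matrix (Fin (m + 1)) (Fin (m + 1)) F → Prop := fun X =>
    RowCyclic e X ∧ RowCyclic e (c * X)
  let large : Matrix (Fin (m + 1)) (Fin (m + 1)) F → Prop := fun X =>
    q ^ 2 ≤ count fun u => peel c 1 (X.updateCol 0 u) = 0
  have h1 : q * count (fun X => ¬ RowCyclic e X) ≤ ((m + 1) * (m + 1) + 1) * M :=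
    card_mul_count_not_rowCyclic_le (Nat.succ_pos m)
  have h2 : count (fun X => ¬ RowCyclic e (c * X)) = count (fun X => ¬ RowCyclic e X) := by
    have hu : IsUnit c := (isUnit_iff_isUnit_det c).2 (hdet ▸ isUnit_one)
    exact count_comp_equiv hu.unit.mulLeft fun X => ¬ RowCyclic e X
  have h3 : q * count large ≤ _ := card_mul_count_sq_le_count_peel_le hdet hc
  have h4 : M ≤ count (fun X => good X ∧ ¬ large X) + (count (fun X => ¬ RowCyclic e X) +
      count (fun X => ¬ RowCyclic e (c * X)) + count large) := by
    rw [show M = count fun _ : Matrix (Fin (m + 1)) (Fin (m + 1)) F => True from count_true.symm]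
    refine (count_le_add (r := fun X => (¬ RowCyclic e X ∨ ¬ RowCyclic e (c * X)) ∨ large X)
      fun X _ => ?_).trans (Nat.add_le_add_left ((count_or_le _ _).trans
        (Nat.add_le_add_right (count_or_le _ _) _)) _)
    simp only [good]
    tauto
  have h5 : count (fun X => good X ∧ ¬ large X) * q ≤
      q ^ (m + 1) * count (fun X => peel c 0 X = 0 ∧ good X) := by
    rw [← sum_count_updateCol 0 fun X => peel c 0 X = 0 ∧ good X]
    refine count_mul_le_sum fun X ⟨⟨hX, hcX⟩, hl⟩ => ?_
    refine ((card_le_count_peel_updateCol hdet X).2.resolve_left hl).trans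
      (count_mono fun u hu => ⟨hu, hX.updateCol u, ?_⟩)
    rw [mul_updateCol]
    exact hcX.updateCol _
  have h6 : count (fun X => peel c 0 X = 0 ∧ good X) ≤
      count (fun X => X.det ≠ 0 ∧ peel c 0 X = 0 ∧ good X) +
        count (fun X => peel c 0 X = 0 ∧ X.det = 0) :=
    count_le_add fun X ⟨h, h'⟩ => (em (X.det = 0)).symm.imp (fun h0 => ⟨h0, h, h'⟩)
      fun h0 => ⟨h, h0⟩
  have h7 : q ^ (m + 1) * count (fun X => peel c 0 X = 0 ∧ X.det = 0) ≤ _ :=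
    pow_mul_count_peel_det_le (by omega) hc
  change q * M ≤ q ^ (m + 1) * count (fun X => X.det ≠ 0 ∧ peel c 0 X = 0 ∧ good X) + _
  have h8 := Nat.mul_le_mul_left q h4
  have h9 := Nat.mul_le_mul_left (q ^ (m + 1)) h6
  rw [h2] at h8
  simp only [mul_add, add_mul] at *
  nlinarith

theorem card_sq_mul_card_le (hn : 1 ≤ n) {c : Matrix (Fin n) (Fin n) F} (hdet : c.det = 1)
    (hc : IsShift c) :
    Fintype.card F * (Fintype.card F * Fintype.card (Matrix (Fin n) (Fin n) F)) ≤
      Fintype.card F * count (fun p : Matrix (Fin n) (Fin n) F × Matrix (Fin n) (Fin n) F =>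
        IsCommutatorPair c p.1 p.2) +
      (n * (Fintype.card F + n * 2 ^ (n * n + 2 * n)) +
        Fintype.card F * (2 * (n * n + 1) + (n + 1) * 2 ^ (n * n + 2 * n))) *
        Fintype.card (Matrix (Fin n) (Fin n) F) := by
  obtain ⟨m, rfl⟩ := Nat.exists_eq_add_of_le' hn
  have h1 := card_mul_card_le_pow_mul_count_rowCyclic hdet hc
  set q := Fintype.card F
  set M := Fintype.card (Matrix (Fin (m + 1)) (Fin (m + 1)) F)
  let good : Matrix (Fin (m + 1)) (Fin (m + 1)) F → Prop := fun X =>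
    X.det ≠ 0 ∧ peel c 0 X = 0 ∧ RowCyclic (Pi.single 0 1) X ∧ RowCyclic (Pi.single 0 1) (c * X)
  have h2 : count good * (q * q ^ (m + 1)) ≤ count good * ((m + 1) * q ^ (m + 1)) +
      q * ∑ b, count (fun a => IsCommutatorPair c a b) := by
    classical
    rw [← sum_ite_eq_count_mul, ← sum_ite_eq_count_mul, Finset.mul_sum, ← Finset.sum_add_distrib]
    refine Finset.sum_le_sum fun b _ => ?_
    split_ifs with hb
    · exact card_pow_le_count_isCommutatorPair (Nat.succ_pos m) hb.1 hb.2.2.1 hb.2.2.2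
        ((peel_zero_eq_zero_iff c b).1 hb.2.1)
    · exact Nat.zero_le _
  have h3 : q ^ (m + 1) * count good ≤
      (q + (m + 1) * 2 ^ ((m + 1) * (m + 1) + 2 * (m + 1))) * M :=
    (Nat.mul_le_mul_left _ (count_mono fun X h => h.2.1)).trans
      (pow_mul_count_peel_le (by omega) hc zero_le_one)
  rw [count_prod, sum_count_comm]
  have h4 := Nat.mul_le_mul_left q h1
  have h5 := Nat.mul_le_mul_left (m + 1) h3
  change q * (q * M) ≤ q * (q ^ (m + 1) * count good + _) at h4
  calc q * (q * M) ≤ _ := h4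
    _ ≤ _ := by
      simp only [mul_add, add_mul] at *
      nlinarith

end LowerBound

section GeneralLinearGroup

variable {F : Type*} [Field F] {n : ℕ}

/-- Invertible matrices as matrices with nonzero determinant. -/
noncomputable def glEquiv : GL (Fin n) F ≃ {X : Matrix (Fin n) (Fin n) F // X.det ≠ 0} where
  toFun g := ⟨g, g.det.ne_zero⟩
  invFun X := GeneralLinearGroup.mkOfDetNeZero X.1 X.2
  left_inv _ := Units.ext rfl
  right_inv _ := rfl

theorem isCommutatorPair_coe_iff (c : Matrix (Fin n) (Fin n) F) (a b : GL (Fin n) F) :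
    IsCommutatorPair c a b ↔
      ((a * b * a⁻¹ * b⁻¹ : GL (Fin n) F) : Matrix (Fin n) (Fin n) F) = c := by
  have h : IsCommutatorPair c a b ↔
      (a * b : Matrix (Fin n) (Fin n) F) = c * b * a :=
    ⟨fun h => h.2.2, fun h => ⟨a.det.ne_zero, b.det.ne_zero, h⟩⟩
  rw [h, Units.val_mul, Units.val_mul, Units.val_mul, Units.mul_inv_eq_iff_eq_mul,
    Units.mul_inv_eq_iff_eq_mul]

theorem IsCommutatorPair.conj {c c' T a b : Matrix (Fin n) (Fin n) F} (hT : T.det ≠ 0)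
    (hc : T * c = c' * T) (h : IsCommutatorPair c a b) :
    IsCommutatorPair c' (T * a * T⁻¹) (T * b * T⁻¹) := by
  have hu : IsUnit T.det := isUnit_iff_ne_zero.2 hT
  have hi : T⁻¹.det ≠ 0 := (isUnit_nonsing_inv_det _ hu).ne_zero
  refine ⟨?_, ?_, ?_⟩
  · rw [det_mul, det_mul]
    exact mul_ne_zero (mul_ne_zero hT h.1) hi
  · rw [det_mul, det_mul]
    exact mul_ne_zero (mul_ne_zero hT h.2.1) hi
  · calc T * a * T⁻¹ * (T * b * T⁻¹) = T * (a * b) * T⁻¹ := by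
          simp only [Matrix.mul_assoc, nonsing_inv_mul_cancel_left _ _ hu]
      _ = T * c * b * a * T⁻¹ := by rw [h.2.2]; simp only [Matrix.mul_assoc]
      _ = c' * (T * b * T⁻¹) * (T * a * T⁻¹) := by
          rw [hc]
          simp only [Matrix.mul_assoc, nonsing_inv_mul_cancel_left _ _ hu]

variable [Fintype F]

theorem natCard_gl : Nat.card (GL (Fin n) F) =
    count (fun X : Matrix (Fin n) (Fin n) F => X.det ≠ 0) := by
  rw [Nat.card_congr glEquiv, natCard_subtype]

theorem natCard_gl_le :
    Nat.card (GL (Fin n) F) ≤ Fintype.card (Matrix (Fin n) (Fin n) F) := by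
  rw [natCard_gl]
  exact count_le_card _

theorem card_mul_card_le_card_mul_natCard_gl :
    Fintype.card F * Fintype.card (Matrix (Fin n) (Fin n) F) ≤
      Fintype.card F * Nat.card (GL (Fin n) F) + n * Fintype.card (Matrix (Fin n) (Fin n) F) := by
  have h1 := card_mul_count_le_of_line (F := F)
    (fun X : Matrix (Fin n) (Fin n) F => X.det = 0) 1 n count_det_add_smul_one_eq_zero_le
  have h2 : Fintype.card (Matrix (Fin n) (Fin n) F) ≤
      count (fun X : Matrix (Fin n) (Fin n) F => X.det ≠ 0) +
        count (fun X : Matrix (Fin n) (Fin n) F => X.det = 0) := by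
    rw [← count_true]
    exact count_le_add fun X _ => (ne_or_eq X.det 0)
  rw [natCard_gl]
  calc _ ≤ _ := Nat.mul_le_mul_left _ h2
    _ ≤ _ := by
      rw [mul_add]
      exact Nat.add_le_add_left h1 _

theorem natCard_commutator_fiber (c : Matrix (Fin n) (Fin n) F) :
    Nat.card {p : GL (Fin n) F × GL (Fin n) F //
        ((p.1 * p.2 * p.1⁻¹ * p.2⁻¹ : GL (Fin n) F) : Matrix (Fin n) (Fin n) F) = c} =
      count (fun p : Matrix (Fin n) (Fin n) F × Matrix (Fin n) (Fin n) F =>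
        IsCommutatorPair c p.1 p.2) := by
  rw [← natCard_subtype]
  refine Nat.card_congr
    { toFun := fun p => ⟨(p.1.1, p.1.2), (isCommutatorPair_coe_iff c _ _).2 p.2⟩
      invFun := fun p => ⟨(GeneralLinearGroup.mkOfDetNeZero p.1.1 p.2.1,
        GeneralLinearGroup.mkOfDetNeZero p.1.2 p.2.2.1), (isCommutatorPair_coe_iff c _ _).1 p.2⟩
      left_inv := fun p => Subtype.ext (Prod.ext (Units.ext rfl) (Units.ext rfl))
      right_inv := fun _ => rfl }

theorem natCard_commutator_fiber_le (c : Matrix (Fin n) (Fin n) F) :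
    Nat.card {p : GL (Fin n) F × GL (Fin n) F //
        ((p.1 * p.2 * p.1⁻¹ * p.2⁻¹ : GL (Fin n) F) : Matrix (Fin n) (Fin n) F) = c} ≤
      Nat.card (GL (Fin n) F) * Nat.card (GL (Fin n) F) := by
  classical
  rw [← Nat.card_prod]
  exact Nat.card_le_card_of_injective _ Subtype.val_injective

theorem count_isCommutatorPair_le_of_conj {c c' T : Matrix (Fin n) (Fin n) F} (hT : T.det ≠ 0)
    (hc : T * c = c' * T) :
    count (fun p : Matrix (Fin n) (Fin n) F × Matrix (Fin n) (Fin n) F =>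
        IsCommutatorPair c p.1 p.2) ≤
      count (fun p : Matrix (Fin n) (Fin n) F × Matrix (Fin n) (Fin n) F =>
        IsCommutatorPair c' p.1 p.2) := by
  have hinj : ∀ x y : Matrix (Fin n) (Fin n) F, T * x * T⁻¹ = T * y * T⁻¹ → x = y := by
    intro x y h
    have hu : IsUnit T.det := isUnit_iff_ne_zero.2 hT
    have h := congrArg (fun Z => T⁻¹ * (Z * T)) h
    simpa only [Matrix.mul_assoc, nonsing_inv_mul_cancel_left _ _ hu, nonsing_inv_mul _ hu,
      Matrix.mul_one] using h
  exact count_le_of_injOn (fun p => (T * p.1 * T⁻¹, T * p.2 * T⁻¹)) (fun p hp => hp.conj hT hc)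
    fun p p' _ _ h => Prod.ext (hinj _ _ (Prod.ext_iff.1 h).1) (hinj _ _ (Prod.ext_iff.1 h).2)

theorem count_isCommutatorPair_eq_of_conj {c c' T : Matrix (Fin n) (Fin n) F} (hT : T.det ≠ 0)
    (hc : T * c = c' * T) :
    count (fun p : Matrix (Fin n) (Fin n) F × Matrix (Fin n) (Fin n) F =>
        IsCommutatorPair c p.1 p.2) =
      count (fun p : Matrix (Fin n) (Fin n) F × Matrix (Fin n) (Fin n) F =>
        IsCommutatorPair c' p.1 p.2) := by
  have hu : IsUnit T.det := isUnit_iff_ne_zero.2 hT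
  refine (count_isCommutatorPair_le_of_conj hT hc).antisymm
    (count_isCommutatorPair_le_of_conj (isUnit_nonsing_inv_det _ hu).ne_zero ?_)
  rw [← mul_nonsing_inv_cancel_right _ (T⁻¹ * c') hu, Matrix.mul_assoc T⁻¹, ← hc,
    nonsing_inv_mul_cancel_left _ _ hu]

theorem exists_isShift_of_squarefree_charpoly (hq : n < Fintype.card F)
    {c : Matrix (Fin n) (Fin n) F} (hs : Squarefree c.charpoly) :
    ∃ c' T : Matrix (Fin n) (Fin n) F, IsShift c' ∧ T.det ≠ 0 ∧ T * c = c' * T := by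
  obtain ⟨w, hw⟩ := exists_rowCyclic_of_squarefree_charpoly hq hs
  exact ⟨_, _, isShift_modMatrix c.charpoly_monic (by simp), hw, krylov_mul_self w c⟩

end GeneralLinearGroup

section Estimates

theorem abs_sub_le_of_large {Q M N G n A D E : ℝ} (hQ1 : 1 ≤ Q) (hQD : 2 * D ≤ Q)
    (hQn : 2 * n ≤ Q) (hM : 0 ≤ M) (hN : 0 ≤ N) (hn : 0 ≤ n) (hA : 0 ≤ A) (hD : 0 ≤ D)
    (hE : 0 ≤ E) (hGM : G ≤ M) (hMG : Q * M ≤ Q * G + n * M)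
    (hupper : Q * N ≤ Q * ((Q + A) * M) + D * N)
    (hlower : Q * (Q * M) ≤ Q * N + (n * (Q + A) + Q * E) * M) :
    |N - Q * G| ≤ 2 * (n + A + 2 * D * (1 + A) + n * (1 + A) + E) * G := by
  have hQ : 0 < Q := by linarith
  have hM2 : M ≤ 2 * G := by
    refine le_of_mul_le_mul_left ?_ hQ
    nlinarith [mul_le_mul_of_nonneg_right hQn hM]
  have hQA : Q + A ≤ Q * (1 + A) := by nlinarith
  have hN2 : N ≤ 2 * ((Q + A) * M) := by
    refine le_of_mul_le_mul_left ?_ hQ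
    nlinarith [mul_le_mul_of_nonneg_right hQD hN]
  have hN3 : N ≤ (Q + A) * M + 2 * D * (1 + A) * M := by
    refine le_of_mul_le_mul_left ?_ hQ
    have h1 := mul_le_mul_of_nonneg_left hN2 hD
    have h2 := mul_le_mul_of_nonneg_left hQA (mul_nonneg hD hM)
    nlinarith
  have hN4 : Q * M ≤ N + (n * (1 + A) + E) * M := by
    refine le_of_mul_le_mul_left ?_ hQ
    have h2 := mul_le_mul_of_nonneg_left hQA (mul_nonneg hn hM)
    nlinarith
  have hQG := mul_le_mul_of_nonneg_left hGM hQ.le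
  have hx : 0 ≤ n * (1 + A) + E := by positivity
  have hy : 0 ≤ n + A + 2 * D * (1 + A) := by positivity
  have hx1 := mul_le_mul_of_nonneg_left hM2 hx
  have hy1 := mul_le_mul_of_nonneg_left hM2 hy
  have hG : 0 ≤ G := by linarith
  have hx2 := mul_nonneg hx hG
  have hy2 := mul_nonneg hy hG
  rw [abs_le]
  constructor <;> nlinarith

theorem abs_sub_le_of_small {Q N G B b : ℝ} (hN : 0 ≤ N) (hG : 0 ≤ G) (hQ : 0 ≤ Q)
    (hB : 0 ≤ B) (hb : 0 ≤ b) (hQB : Q ≤ B) (hGb : G ≤ b) (hNG : N ≤ G * G) :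
    |N - Q * G| ≤ (b + B) * G := by
  have h1 := mul_le_mul_of_nonneg_right hQB hG
  have h2 := mul_le_mul_of_nonneg_right hGb hG
  have h3 := mul_nonneg hQ hG
  have h4 := mul_nonneg hB hG
  have h5 := mul_nonneg hb hG
  rw [abs_le]
  constructor <;> linarith

end Estimates

end CommutatorFiber

open CommutatorFiber

/-- **Numerical geometric connectedness over regular semisimple elements.**
For fixed `n ≥ 2` there is a constant `C > 0`, depending only on `n`, such that for every
prime power `q`, every finite field `F` with `q` elements and every regular semisimple
`c ∈ SL_n(F)` (i.e. the characteristic polynomial of `c` is squarefree), the number of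
pairs `(a, b) ∈ GL_n(F)²` with `a * b * a⁻¹ * b⁻¹ = c` is `q·|GL_n(F)|` up to an error of
at most `C·|GL_n(F)|`. -/
theorem commutator_fiber_card_regular_semisimple (n : ℕ) (hn : 2 ≤ n) :
    ∃ C : ℝ, 0 < C ∧
      ∀ (q : ℕ), IsPrimePow q →
        ∀ (F : Type) [Field F] [Fintype F], Fintype.card F = q →
          ∀ c : Matrix.SpecialLinearGroup (Fin n) F,
            Squarefree (Matrix.charpoly (c : Matrix (Fin n) (Fin n) F)) →
              |(Nat.card {p : GL (Fin n) F × GL (Fin n) F //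
                    ((p.1 * p.2 * p.1⁻¹ * p.2⁻¹ : GL (Fin n) F) : Matrix (Fin n) (Fin n) F) =
                      (c : Matrix (Fin n) (Fin n) F)} : ℝ) -
                  (q : ℝ) * (Nat.card (GL (Fin n) F) : ℝ)| ≤
                C * (Nat.card (GL (Fin n) F) : ℝ) := by
  obtain ⟨D, hD⟩ : ∃ D, D = n * n * n + n := ⟨_, rfl⟩
  obtain ⟨A, hA⟩ : ∃ A, A = n * 2 ^ (n * n + 2 * n) := ⟨_, rfl⟩
  obtain ⟨E, hE⟩ : ∃ E, E = 2 * (n * n + 1) + (n + 1) * 2 ^ (n * n + 2 * n) := ⟨_, rfl⟩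
  let C₁ : ℝ := 2 * (n + A + 2 * D * (1 + A) + n * (1 + A) + E)
  let C₂ : ℝ := ((2 * D) ^ (n * n) : ℕ) + (2 * D : ℕ)
  have hD0 : 0 < D := by lia
  have hC₁ : 0 ≤ C₁ := by positivity
  have hC₂ : 0 < C₂ := by positivity
  refine ⟨C₁ + C₂, by positivity, fun q _ F _ _ hqF c hs => ?_⟩
  rw [add_mul]
  have hM : Fintype.card (Matrix (Fin n) (Fin n) F) = q ^ (n * n) := by
    have h : Fintype.card (Fin n → Fin n → F) = q ^ (n * n) := by simp [hqF, pow_mul]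
    rw [← h]
    exact Fintype.card_congr Matrix.of.symm
  rcases le_or_gt (2 * D) q with hB | hB
  · refine le_add_of_le_of_nonneg ?_ (by positivity)
    have hnn : n * n < q := by
      refine lt_of_lt_of_le ?_ hB
      have : n * n * 1 ≤ n * n * n := Nat.mul_le_mul_left _ (by lia)
      lia
    have hnq : n < q := lt_of_le_of_lt (Nat.le_mul_self n) hnn
    obtain ⟨c', T, hshift, hT, hc⟩ :=
      exists_isShift_of_squarefree_charpoly (by rwa [hqF]) hs
    have hdet : c'.det = 1 := by
      have := congrArg Matrix.det hc
      rw [Matrix.det_mul, Matrix.det_mul, c.det_coe, mul_comm] at this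
      exact (mul_right_cancel₀ hT this).symm
    have hupper := card_mul_count_isCommutatorPair_le (by lia) (by rwa [hqF]) hshift
    have hlower := card_sq_mul_card_le (by lia) hdet hshift
    have hgl := card_mul_card_le_card_mul_natCard_gl (F := F) (n := n)
    rw [natCard_commutator_fiber, count_isCommutatorPair_eq_of_conj hT hc]
    rw [hqF, ← hA, ← hD] at hupper
    rw [hqF, ← hA, ← hE] at hlower
    rw [hqF] at hgl
    refine abs_sub_le_of_large (M := Fintype.card (Matrix (Fin n) (Fin n) F)) ?_ ?_ ?_ ?_ ?_ ?_ ?_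
      ?_ ?_ ?_ ?_ ?_ ?_
    · exact_mod_cast (by lia : 1 ≤ q)
    · exact_mod_cast hB
    · have : 2 * n ≤ q := by lia
      exact_mod_cast this
    · positivity
    · positivity
    · positivity
    · positivity
    · positivity
    · positivity
    · exact_mod_cast natCard_gl_le
    · exact_mod_cast hgl
    · exact_mod_cast hupper
    · exact_mod_cast hlower
  · refine le_add_of_nonneg_of_le (by positivity) ?_
    refine abs_sub_le_of_small (by positivity) (by positivity) (by positivity) (by positivity)
      (by positivity) ?_ ?_ ?_
    · exact_mod_cast hB.le
    · have := (natCard_gl_le (F := F) (n := n)).trans_eq hM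
      exact_mod_cast this.trans (Nat.pow_le_pow_left hB.le _)
    · exact_mod_cast natCard_commutator_fiber_le _
end

section
/- Fix an integer n ≥ 2. There exists a constant C > 0 depending only on n such that for every prime power q, every finite field F with |F| = q, and every ξ ∈ F^× with ξ^n = 1, letting d be the multiplicative order of ξ (so d divides n) and c = ξ·I_n the corresponding central element of SL_n(F), the number N(c) of pairs (a,b) ∈ GL_n(F) × GL_n(F) with a·b·a⁻¹·b⁻¹ = c satisfies |N(c) − q^{n/d}·|GL_n(F)|| ≤ C·q^{n/d − 1}·|GL_n(F)|. -/
section helpers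

open Polynomial

/-- The set of monic polynomials of degree `k`. -/
def monicOfDegree (F : Type*) [Field F] (k : ℕ) : Set F[X] := {g | g.Monic ∧ g.natDegree = k}

theorem finite_monicOfDegree (F : Type*) [Field F] [Finite F] (k : ℕ) :
    (monicOfDegree F k).Finite :=
  Set.finite_coe_iff.mp <|
    Finite.of_equiv _ ((monicEquivDegreeLT k).trans (degreeLTEquiv F k).toEquiv).symm

theorem ncard_monicOfDegree (F : Type*) [Field F] [Finite F] (k : ℕ) :
    (monicOfDegree F k).ncard = Nat.card F ^ k := by
  have h := Nat.card_congr ((monicEquivDegreeLT (R := F) k).trans (degreeLTEquiv F k).toEquiv)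
  rw [Nat.card_fun, Nat.card_fin] at h
  exact h

/-- Monic polynomials of degree `k` that vanish at `0` or have a repeated factor. -/
def degenerateOfDegree (F : Type*) [Field F] (k : ℕ) : Set F[X] :=
  {g ∈ monicOfDegree F k | ¬ (g.coeff 0 ≠ 0 ∧ Squarefree g)}

theorem degenerateOfDegree_subset (F : Type*) [Field F] (k : ℕ) (hk : 1 ≤ k) :
    degenerateOfDegree F k ⊆ (fun u => X * u) '' monicOfDegree F (k - 1) ∪
      ⋃ j ∈ Finset.Icc 1 (k / 2), (fun w : F[X] × F[X] => w.1 * w.1 * w.2) ''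
        (monicOfDegree F j ×ˢ monicOfDegree F (k - 2 * j)) := by
  rintro g ⟨⟨hg, hgk⟩, hbad⟩
  by_cases h0 : g.coeff 0 = 0
  · left
    obtain ⟨u, rfl⟩ := X_dvd_iff.mpr h0
    have hu : u.Monic := monic_X.of_mul_monic_left hg
    refine ⟨u, ⟨hu, ?_⟩, rfl⟩
    rw [monic_X.natDegree_mul hu, natDegree_X] at hgk
    omega
  · right
    have hns : ¬ Squarefree g := fun h => hbad ⟨h0, h⟩
    simp only [Squarefree, not_forall] at hns
    obtain ⟨h, ⟨v, hv⟩, hu⟩ := hns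
    have hh0 : h ≠ 0 := by
      rintro rfl
      simp [hv] at hg
    have hlc : h.leadingCoeff ≠ 0 := leadingCoeff_ne_zero.mpr hh0
    set h' := h * C h.leadingCoeff⁻¹ with hh'
    have hm : h'.Monic := monic_mul_leadingCoeff_inv hh0
    set v' := C (h.leadingCoeff * h.leadingCoeff) * v with hv'
    have hgv : g = h' * h' * v' := by
      have : C h.leadingCoeff⁻¹ * C h.leadingCoeff = 1 := by
        rw [← C_mul, inv_mul_cancel₀ hlc, C_1]
      rw [hv, hh', hv', C_mul]
      linear_combination (-h * h * v * (C h.leadingCoeff⁻¹ * C h.leadingCoeff + 1)) * this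
    have hv'm : v'.Monic := (hm.mul hm).of_mul_monic_left (hgv ▸ hg)
    have hdeg : h'.natDegree = h.natDegree := natDegree_mul_leadingCoeff_inv h hh0
    have hpos : 1 ≤ h.natDegree := by
      rw [Nat.one_le_iff_ne_zero]
      intro h0
      exact hu (isUnit_iff_degree_eq_zero.mpr ((degree_eq_iff_natDegree_eq hh0).mpr h0))
    have hsum : h.natDegree + h.natDegree + v'.natDegree = k := by
      rw [← hgk, hgv, (hm.mul hm).natDegree_mul hv'm, hm.natDegree_mul hm, hdeg]
    simp only [Set.mem_iUnion]
    refine ⟨h.natDegree, Finset.mem_Icc.mpr ⟨hpos, by omega⟩, (h', v'), ⟨⟨hm, hdeg⟩, hv'm, ?_⟩,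
      hgv.symm⟩
    dsimp only
    omega

theorem ncard_degenerateOfDegree_le (F : Type*) [Field F] [Finite F] (k : ℕ) (hk : 1 ≤ k) :
    (degenerateOfDegree F k).ncard ≤ (k + 1) * Nat.card F ^ (k - 1) := by
  have hfin := finite_monicOfDegree F
  have hbound : ∀ j ∈ Finset.Icc 1 (k / 2), ((fun w : F[X] × F[X] => w.1 * w.1 * w.2) ''
      (monicOfDegree F j ×ˢ monicOfDegree F (k - 2 * j))).ncard ≤ Nat.card F ^ (k - 1) := by
    intro j hj
    rw [Finset.mem_Icc] at hj
    refine (Set.ncard_image_le ((hfin _).prod (hfin _))).trans ?_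
    rw [Set.ncard_prod, ncard_monicOfDegree, ncard_monicOfDegree, ← pow_add]
    exact Nat.pow_le_pow_right Nat.card_pos (by omega)
  calc (degenerateOfDegree F k).ncard
      ≤ _ := Set.ncard_le_ncard (degenerateOfDegree_subset F k hk) <|
        ((hfin _).image _).union <| Set.Finite.biUnion (Finset.finite_toSet _)
          fun j _ => ((hfin _).prod (hfin _)).image _
    _ ≤ _ := Set.ncard_union_le _ _
    _ ≤ Nat.card F ^ (k - 1) + (k / 2) * Nat.card F ^ (k - 1) := by
        refine add_le_add ?_ ?_
        · rw [← ncard_monicOfDegree F (k - 1)]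
          exact Set.ncard_image_le (hfin _)
        · refine (Finset.set_ncard_biUnion_le _ _).trans ?_
          refine (Finset.sum_le_card_nsmul _ _ _ hbound).trans ?_
          simp
    _ ≤ _ := by
        rw [← one_add_mul]
        exact Nat.mul_le_mul_right _ (by omega)

theorem squarefree_expand {F : Type*} [Field F] [PerfectField F] {d : ℕ} (hd : (d : F) ≠ 0)
    {g : F[X]} (h0 : g.coeff 0 ≠ 0) (hg : Squarefree g) : Squarefree (expand F d g) := by
  have hd0 : 0 < d := Nat.pos_of_ne_zero (by rintro rfl; simp at hd)
  rw [← PerfectField.separable_iff_squarefree] at hg ⊢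
  rw [Separable, derivative_expand]
  have h1 : IsCoprime (expand F d g) (expand F d (derivative g)) := IsCoprime.map hg (expand F d).toRingHom
  have h2 : IsCoprime (expand F d g) X := by
    refine IsCoprime.symm ?_
    refine (irreducible_X.coprime_iff_not_dvd).mpr ?_
    rw [X_dvd_iff, coeff_expand hd0]
    simpa using h0
  have h3 : IsUnit (d : F[X]) := by
    rw [← C_eq_natCast]
    exact isUnit_C.mpr hd.isUnit
  refine h1.mul_right (IsCoprime.mul_right ?_ h2.pow_right)
  exact IsCoprime.of_isCoprime_of_dvd_right isCoprime_one_right (isUnit_iff_dvd_one.mp h3)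

theorem exists_conj_iff_isConj {G : Type*} [Group G] (z b : G) :
    (∃ a, a * b * a⁻¹ * b⁻¹ = z) ↔ IsConj b (z * b) := by
  simp only [isConj_iff, mul_inv_eq_iff_eq_mul]

/-- The conjugacy classes containing some `b` that is conjugate to `z * b`. -/
def ConjClasses.invariant {G : Type*} [Group G] (z : G) : Set (ConjClasses G) :=
  {κ | ∃ b, ConjClasses.mk b = κ ∧ IsConj b (z * b)}

theorem ConjClasses.mk_mem_invariant {G : Type*} [Group G] {z : G} (hz : ∀ a, Commute z a) {b : G} :
    ConjClasses.mk b ∈ ConjClasses.invariant z ↔ IsConj b (z * b) := by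
  refine ⟨?_, fun h => ⟨b, rfl, h⟩⟩
  rintro ⟨b', hb', h⟩
  rw [ConjClasses.mk_eq_mk_iff_isConj] at hb'
  refine hb'.symm.trans (h.trans ?_)
  obtain ⟨c, rfl⟩ := isConj_iff.mp hb'
  exact isConj_iff.mpr ⟨c, by simp only [← mul_assoc, (hz c).eq]⟩

theorem card_commutator_eq {G : Type*} [Group G] [Finite G] {z : G} (hz : ∀ a, Commute z a) :
    Nat.card {p : G × G // p.1 * p.2 * p.1⁻¹ * p.2⁻¹ = z} =
      (ConjClasses.invariant z).ncard * Nat.card G := by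
  classical
  have := Fintype.ofFinite G
  have key : ∀ κ : ConjClasses G,
      ∑ b ∈ (Finset.univ : Finset G) with ConjClasses.mk b = κ,
        (Finset.univ.filter fun a : G => a * b * a⁻¹ * b⁻¹ = z).card =
      if κ ∈ ConjClasses.invariant z then Fintype.card G else 0 := by
    intro κ
    split_ifs with hκ
    · obtain ⟨b₀, rfl⟩ := ConjClasses.exists_rep κ
      have hcard : ∀ b ∈ (Finset.univ : Finset G).filter
          (fun b => ConjClasses.mk b = ConjClasses.mk b₀),
          (Finset.univ.filter fun a : G => a * b * a⁻¹ * b⁻¹ = z).card =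
            Fintype.card (MulAction.stabilizer (ConjAct G) b₀) := by
        intro b hb
        have hbb : ConjClasses.mk b = ConjClasses.mk b₀ := (Finset.mem_filter.mp hb).2
        rw [← hbb, ConjClasses.mk_mem_invariant hz, isConj_iff] at hκ
        obtain ⟨c, hc⟩ := hκ
        obtain ⟨t, ht⟩ := isConj_iff.mp (ConjClasses.mk_eq_mk_iff_isConj.mp hbb)
        rw [← Fintype.card_subtype]
        refine Fintype.card_congr (Equiv.subtypeEquiv (((Equiv.mulLeft (t * c⁻¹)).trans
          (Equiv.mulRight t⁻¹)).trans ConjAct.toConjAct.toEquiv) fun a => ?_)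
        rw [MulAction.mem_stabilizer_iff, mul_inv_eq_iff_eq_mul, ← hc, ← ht]
        have : ConjAct.toConjAct (t * c⁻¹ * a * t⁻¹) • (t * b * t⁻¹) =
            t * c⁻¹ * (a * b * a⁻¹) * (c * t⁻¹) := by
          rw [ConjAct.toConjAct_smul]
          group
        change _ ↔ ConjAct.toConjAct (t * c⁻¹ * a * t⁻¹) • (t * b * t⁻¹) = t * b * t⁻¹
        rw [this]
        constructor
        · intro h
          rw [h]
          group
        · intro h
          calc a * b * a⁻¹ = c * t⁻¹ * (t * c⁻¹ * (a * b * a⁻¹) * (c * t⁻¹)) * (t * c⁻¹) := by group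
            _ = c * b * c⁻¹ := by
              rw [h]
              group
      rw [Finset.sum_congr rfl hcard, Finset.sum_const, smul_eq_mul]
      refine Eq.trans ?_ (MulAction.card_orbit_mul_card_stabilizer_eq_card_group (ConjAct G) b₀)
      rw [← Fintype.card_subtype]
      congr 1
      refine Fintype.card_congr (Equiv.subtypeEquivRight fun b => ?_)
      rw [ConjAct.mem_orbit_conjAct, ConjClasses.mk_eq_mk_iff_isConj]
    · refine Finset.sum_eq_zero fun b hb => ?_
      rw [Finset.card_eq_zero, Finset.filter_eq_empty_iff]
      intro a _ ha
      exact hκ ⟨b, (Finset.mem_filter.mp hb).2, (exists_conj_iff_isConj z b).mp ⟨a, ha⟩⟩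
  calc Nat.card {p : G × G // p.1 * p.2 * p.1⁻¹ * p.2⁻¹ = z}
      = ∑ b : G, (Finset.univ.filter fun a : G => a * b * a⁻¹ * b⁻¹ = z).card := by
        rw [Nat.card_eq_fintype_card, Fintype.card_subtype, Finset.card_filter,
          Fintype.sum_prod_type_right]
        simp only [Finset.card_filter]
    _ = ∑ κ : ConjClasses G, if κ ∈ ConjClasses.invariant z then Fintype.card G else 0 := by
        rw [← Finset.sum_fiberwise _ (ConjClasses.mk : G → ConjClasses G)]
        exact Finset.sum_congr rfl fun κ _ => key κ
    _ = _ := by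
        rw [← Finset.sum_filter, Finset.sum_const, smul_eq_mul, Nat.card_eq_fintype_card,
          ← Set.ncard_coe_finset]
        simp

section
variable {F : Type*} [Field F] {n : ℕ}

/-- The `F[X]`-module on `Fin n → F` on which `X` acts as the matrix `A`. -/
abbrev MatrixModule (A : Matrix (Fin n) (Fin n) F) : Type _ := Module.AEval' (Matrix.toLin' A)

theorem isConj_of_matrixModule_equiv {A B : GL (Fin n) F}
    (e : MatrixModule A.val ≃ₗ[F[X]] MatrixModule B.val) : IsConj A B := by
  let g : (Fin n → F) ≃ₗ[F] (Fin n → F) :=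
    (Module.AEval'.of (Matrix.toLin' A.val)).trans
      ((e.restrictScalars F).trans (Module.AEval'.of (Matrix.toLin' B.val)).symm)
  have hg : ∀ v, g (Matrix.toLin' A.val v) = Matrix.toLin' B.val (g v) := by
    intro v
    simp only [g, LinearEquiv.trans_apply, LinearEquiv.restrictScalars_apply]
    rw [← Module.AEval'.X_smul_of, map_smul, Module.AEval'.of_symm_X_smul]
  let P : GL (Fin n) F := Matrix.GeneralLinearGroup.toLin.symm
    (LinearMap.GeneralLinearGroup.ofLinearEquiv g)
  have hP : Matrix.toLin' P.val = g.toLinearMap := by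
    have : Matrix.GeneralLinearGroup.toLin P = LinearMap.GeneralLinearGroup.ofLinearEquiv g :=
      MulEquiv.apply_symm_apply _ _
    exact congrArg Units.val this
  refine isConj_iff.mpr ⟨P, ?_⟩
  rw [mul_inv_eq_iff_eq_mul]
  refine Units.ext (Matrix.toLin'.injective (LinearMap.ext fun v => ?_))
  simp only [Units.val_mul, Matrix.toLin'_mul, hP, LinearMap.comp_apply]
  exact hg v

theorem aeval_toLin' (A : Matrix (Fin n) (Fin n) F) (f : F[X]) :
    aeval (Matrix.toLin' A) f = Matrix.toLin' (aeval A f) :=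
  aeval_algHom_apply (Matrix.toLinAlgEquiv' : Matrix (Fin n) (Fin n) F ≃ₐ[F] _) A f

theorem smul_matrixModule_eq_zero_of_aeval {A : Matrix (Fin n) (Fin n) F} {f : F[X]}
    (hf : aeval A f = 0) (x : MatrixModule A) : f • x = 0 := by
  obtain ⟨v, rfl⟩ := (Module.AEval'.of (Matrix.toLin' A)).surjective x
  rw [Module.AEval'.of, ← Module.AEval.of_aeval_smul, aeval_toLin', hf]
  simp

theorem isTorsion_matrixModule (A : Matrix (Fin n) (Fin n) F) :
    Module.IsTorsion F[X] (MatrixModule A) := fun {x} =>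
  ⟨⟨A.charpoly, mem_nonZeroDivisors_of_ne_zero A.charpoly_monic.ne_zero⟩,
    smul_matrixModule_eq_zero_of_aeval A.aeval_self_charpoly x⟩

theorem exists_matrixModule_equiv_pi (A : Matrix (Fin n) (Fin n) F) :
    ∃ I : Fin n → Ideal F[X], (∀ i, A.charpoly ∈ I i) ∧
      Nonempty (MatrixModule A ≃ₗ[F[X]] ((i : Fin n) → F[X] ⧸ I i)) := by
  let b := Pi.basisFun F[X] (Fin n)
  let π : (Fin n → F[X]) →ₗ[F[X]] MatrixModule A :=
    b.constr F[X] fun i => Module.AEval'.of (Matrix.toLin' A) (Pi.single i 1)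
  have hπ : Function.Surjective π := by
    intro x
    obtain ⟨v, rfl⟩ := (Module.AEval'.of (Matrix.toLin' A)).surjective x
    refine ⟨fun i => C (v i), ?_⟩
    have : v = ∑ i, v i • (Pi.single i 1 : Fin n → F) := by
      ext j
      simp [Finset.sum_apply, Pi.single_apply]
    conv_rhs => rw [this]
    simp [π, b, Module.Basis.constr_apply_fintype, map_sum]
  let e := π.quotKerEquivOfSurjective hπ
  have hrank : Module.finrank F[X] (LinearMap.ker π) = Module.finrank F[X] (Fin n → F[X]) := by
    rw [← Submodule.finrank_quotient_add_finrank (LinearMap.ker π), e.finrank_eq,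
      Module.finrank_eq_zero_iff_isTorsion.mpr (isTorsion_matrixModule A), zero_add]
  let e' := e.symm.trans (Submodule.quotientEquivPiSpan _ b hrank)
  refine ⟨_, fun i => ?_, ⟨e'⟩⟩
  have h := smul_matrixModule_eq_zero_of_aeval A.aeval_self_charpoly (e'.symm (Pi.single i 1))
  rw [← map_smul, LinearEquiv.map_eq_zero_iff] at h
  have hi := congrFun h i
  rw [Pi.smul_apply, Pi.single_eq_same, Pi.zero_apply, Algebra.smul_def, mul_one] at hi
  exact Ideal.Quotient.eq_zero_iff_mem.mp hi

theorem ncard_ideal_le {f : F[X]} (hf : f ≠ 0) :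
    {I : Ideal F[X] | f ∈ I}.Finite ∧ {I : Ideal F[X] | f ∈ I}.ncard ≤ 2 ^ f.natDegree := by
  classical
  let K := AlgebraicClosure F
  have hgen : ∀ I ∈ {I : Ideal F[X] | f ∈ I}, ∃ g : F[X], g.Monic ∧ I = Ideal.span {g} := by
    intro I hI
    obtain ⟨g, rfl⟩ := IsPrincipalIdealRing.principal I
    have hg : g ≠ 0 := by
      rintro rfl
      exact hf (by simpa using hI)
    refine ⟨_, monic_mul_leadingCoeff_inv hg, ?_⟩
    exact (Ideal.span_singleton_mul_right_unit
      (isUnit_C.mpr (inv_ne_zero (leadingCoeff_ne_zero.mpr hg)).isUnit) g).symm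
  choose! gen hgen using hgen
  let φ : Ideal F[X] → Multiset K := fun I => ((gen I).map (algebraMap F K)).roots
  let T : Finset (Multiset K) := (f.map (algebraMap F K)).roots.powerset.toFinset
  have hmaps : Set.MapsTo φ {I : Ideal F[X] | f ∈ I} (T : Set (Multiset K)) := by
    intro I hI
    have h1 : gen I ∣ f := by
      rw [← Ideal.mem_span_singleton, ← (hgen I hI).2]
      exact hI
    simp only [T, Finset.mem_coe, Multiset.mem_toFinset, Multiset.mem_powerset]
    exact roots.le_of_dvd (Polynomial.map_ne_zero hf) (Polynomial.map_dvd _ h1)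
  have hinj : Set.InjOn φ {I : Ideal F[X] | f ∈ I} := by
    intro I hI J hJ h
    rw [(hgen I hI).2, (hgen J hJ).2]
    have key : ∀ g : F[X], g.Monic →
        g.map (algebraMap F K) = ((g.map (algebraMap F K)).roots.map fun a => X - C a).prod :=
      fun g hg => (IsAlgClosed.splits _).eq_prod_roots_of_monic (hg.map _)
    have : gen I = gen J := map_injective _ (algebraMap F K).injective (by
      rw [key _ (hgen I hI).1, key _ (hgen J hJ).1]
      exact congrArg (fun s : Multiset K => (s.map fun a => X - C a).prod) h)
    rw [this]
  refine ⟨Set.Finite.of_injOn hmaps hinj T.finite_toSet, ?_⟩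
  calc _ ≤ (T : Set (Multiset K)).ncard := Set.ncard_le_ncard_of_injOn φ hmaps hinj T.finite_toSet
    _ ≤ _ := by
      rw [Set.ncard_coe_finset]
      refine (Multiset.toFinset_card_le _).trans ?_
      rw [Multiset.card_powerset]
      refine Nat.pow_le_pow_right two_pos ((card_roots' _).trans ?_)
      exact natDegree_map_le

theorem charpoly_dvd_minpoly_of_squarefree [PerfectField F] {A : Matrix (Fin n) (Fin n) F}
    (h : Squarefree A.charpoly) : A.charpoly ∣ minpoly F A := by
  let K := AlgebraicClosure F
  rw [← map_dvd_map' (algebraMap F K)]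
  have hm : minpoly F A ≠ 0 := minpoly.ne_zero (Matrix.isIntegral A)
  refine (IsAlgClosed.splits _).dvd_of_roots_le_roots (Polynomial.map_ne_zero A.charpoly_monic.ne_zero) ?_
  rw [Multiset.le_iff_subset
    (nodup_roots (PerfectField.separable_iff_squarefree.mpr h).map)]
  intro r hr
  rw [mem_roots (Polynomial.map_ne_zero hm)]
  have h1 : r ∈ spectrum K (A.map (algebraMap F K)) := by
    rw [Matrix.mem_spectrum_iff_isRoot_charpoly, Matrix.charpoly_map]
    exact isRoot_of_mem_roots hr
  have h2 := spectrum.subset_polynomial_aeval (A.map (algebraMap F K))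
    ((minpoly F A).map (algebraMap F K)) ⟨r, h1, rfl⟩
  have h3 : aeval (A.map (algebraMap F K)) ((minpoly F A).map (algebraMap F K)) = 0 := by
    have := congrArg (Algebra.ofId F K).mapMatrix (minpoly.aeval F A)
    rw [← aeval_algHom_apply, map_zero] at this
    rw [aeval_map_algebraMap]
    exact this
  have : Nontrivial (Matrix (Fin n) (Fin n) K) := by
    by_contra hn
    rw [not_nontrivial_iff_subsingleton] at hn
    rw [spectrum.of_subsingleton] at h1
    exact h1
  rw [h3, spectrum.zero_eq] at h2
  exact h2

theorem matrixModule_equiv_quotient [PerfectField F] {A : Matrix (Fin n) (Fin n) F}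
    (h : Squarefree A.charpoly) :
    Nonempty (MatrixModule A ≃ₗ[F[X]] (F[X] ⧸ Ideal.span {A.charpoly})) := by
  obtain ⟨x, hx⟩ := Module.exists_ker_toSpanSingleton_eq_annihilator F[X] (MatrixModule A)
  have hker : LinearMap.ker (LinearMap.toSpanSingleton F[X] (MatrixModule A) x) =
      Ideal.span {A.charpoly} := by
    refine le_antisymm ?_ ?_
    · intro f hf
      rw [hx, Module.AEval.annihilator_eq_ker_aeval, RingHom.mem_ker, aeval_toLin',
        LinearEquiv.map_eq_zero_iff] at hf
      exact Ideal.mem_span_singleton.mpr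
        ((charpoly_dvd_minpoly_of_squarefree h).trans (minpoly.dvd F A hf))
    · rw [Ideal.span_singleton_le_iff_mem]
      exact smul_matrixModule_eq_zero_of_aeval A.aeval_self_charpoly x
  let ψ : (F[X] ⧸ Ideal.span {A.charpoly}) →ₗ[F[X]] MatrixModule A :=
    Submodule.liftQ _ (LinearMap.toSpanSingleton F[X] (MatrixModule A) x) hker.ge
  have hinj : Function.Injective ψ := LinearMap.ker_eq_bot.mp
    (Submodule.ker_liftQ_eq_bot _ _ _ hker.le)
  have hdim : Module.finrank F (F[X] ⧸ Ideal.span {A.charpoly}) =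
      Module.finrank F (MatrixModule A) := by
    rw [← (Module.AEval'.of (Matrix.toLin' A)).finrank_eq, Module.finrank_fin_fun]
    have := (AdjoinRoot.powerBasis' A.charpoly_monic).finrank
    rw [AdjoinRoot.powerBasis'_dim, A.charpoly_natDegree_eq_dim, Fintype.card_fin] at this
    exact this
  have : FiniteDimensional F (F[X] ⧸ Ideal.span {A.charpoly}) :=
    (AdjoinRoot.powerBasis' A.charpoly_monic).finite
  have : FiniteDimensional F (MatrixModule A) :=
    Module.Finite.equiv (Module.AEval'.of (Matrix.toLin' A))
  have hsurj : Function.Surjective ψ :=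
    (LinearMap.injective_iff_surjective_of_finrank_eq_finrank (f := ψ.restrictScalars F) hdim).mp hinj
  exact ⟨(LinearEquiv.ofBijective ψ ⟨hinj, hsurj⟩).symm⟩

theorem isConj_of_squarefree_charpoly [PerfectField F] {A B : GL (Fin n) F}
    (h : Squarefree A.val.charpoly) (hAB : A.val.charpoly = B.val.charpoly) : IsConj A B := by
  obtain ⟨e⟩ := matrixModule_equiv_quotient h
  obtain ⟨e'⟩ := matrixModule_equiv_quotient (hAB ▸ h)
  rw [← hAB] at e'
  exact isConj_of_matrixModule_equiv (e.trans e'.symm)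

theorem exists_charpoly_eq {f : F[X]} (hf : f.Monic) (hn : f.natDegree = n)
    (h0 : f.coeff 0 ≠ 0) : ∃ A : GL (Fin n) F, A.val.charpoly = f := by
  let pb := AdjoinRoot.powerBasis' hf
  have hdim : pb.dim = n := by rw [AdjoinRoot.powerBasis'_dim, hn]
  let A := Matrix.reindex (finCongr hdim) (finCongr hdim) (Algebra.leftMulMatrix pb.basis pb.gen)
  have hA : A.charpoly = f := by
    rw [Matrix.charpoly_reindex, charpoly_leftMulMatrix]
    exact AdjoinRoot.minpoly_powerBasis_gen_of_monic hf
  have hdet : IsUnit A.det := by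
    rw [isUnit_iff_ne_zero, Matrix.det_eq_sign_charpoly_coeff, hA]
    exact mul_ne_zero (pow_ne_zero _ (by simp)) h0
  exact ⟨Matrix.GeneralLinearGroup.mk'' A hdet, hA⟩

theorem charpoly_smul_of_pow_eq_one {ξ : F} (hξ : ξ ^ n = 1) (hξ0 : ξ ≠ 0)
    (A : Matrix (Fin n) (Fin n) F) :
    (ξ • A).charpoly = A.charpoly.comp (C ξ⁻¹ * X) := by
  have h := RingHom.map_det (compRingHom (C ξ⁻¹ * X)) A.charmatrix
  change A.charpoly.comp (C ξ⁻¹ * X) = _ at h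
  rw [h, Matrix.charpoly]
  have h2 : (ξ • A).charmatrix =
      C ξ • (compRingHom (C ξ⁻¹ * X)).mapMatrix A.charmatrix := by
    have hc : C ξ * C ξ⁻¹ = 1 := by rw [← C_mul, mul_inv_cancel₀ hξ0, C_1]
    ext1 i j
    by_cases hij : i = j
    · subst hij
      simp [Matrix.charmatrix_apply_eq, mul_sub, ← mul_assoc, hc]
    · simp [Matrix.charmatrix_apply_ne _ _ _ hij]
  rw [h2, Matrix.det_smul, Fintype.card_fin, ← C_pow, hξ, C_1, one_mul]

end

section
variable {F : Type*} [Field F] {n : ℕ}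

/-- The characteristic polynomial of a conjugacy class of invertible matrices. -/
noncomputable def ConjClasses.charpoly (κ : ConjClasses (GL (Fin n) F)) : F[X] :=
  Quotient.lift (fun A : GL (Fin n) F => A.val.charpoly) (fun A B h => by
    obtain ⟨c, rfl⟩ := isConj_iff.mp h
    exact (Matrix.charpoly_units_conj c A.val).symm.trans (by simp)) κ

theorem ConjClasses.charpoly_mk (A : GL (Fin n) F) :
    (ConjClasses.mk A).charpoly = A.val.charpoly := rfl

theorem ConjClasses.charpoly_monic (κ : ConjClasses (GL (Fin n) F)) : κ.charpoly.Monic := by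
  obtain ⟨A, rfl⟩ := κ.exists_rep
  exact A.val.charpoly_monic

theorem ConjClasses.natDegree_charpoly (κ : ConjClasses (GL (Fin n) F)) :
    κ.charpoly.natDegree = n := by
  obtain ⟨A, rfl⟩ := κ.exists_rep
  exact A.val.charpoly_natDegree_eq_dim.trans (Fintype.card_fin n)

theorem ConjClasses.eq_of_squarefree_charpoly [PerfectField F]
    {κ κ' : ConjClasses (GL (Fin n) F)} (h : Squarefree κ.charpoly)
    (hκ : κ.charpoly = κ'.charpoly) : κ = κ' := by
  obtain ⟨A, rfl⟩ := κ.exists_rep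
  obtain ⟨B, rfl⟩ := κ'.exists_rep
  exact ConjClasses.mk_eq_mk_iff_isConj.mpr (isConj_of_squarefree_charpoly h hκ)

theorem ConjClasses.ncard_charpoly_eq_le (f : F[X]) :
    {κ : ConjClasses (GL (Fin n) F) | κ.charpoly = f}.ncard ≤ (2 ^ n) ^ n := by
  by_cases hf : f.Monic ∧ f.natDegree = n
  swap
  · have : {κ : ConjClasses (GL (Fin n) F) | κ.charpoly = f} = ∅ :=
      Set.eq_empty_of_forall_notMem fun κ hκ => by
        rw [Set.mem_ofPred_eq] at hκ
        exact hf ⟨hκ ▸ κ.charpoly_monic, hκ ▸ κ.natDegree_charpoly⟩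
    simp [this]
  obtain ⟨hfin, hcard⟩ := ncard_ideal_le hf.1.ne_zero
  rw [hf.2] at hcard
  have hI : ∀ κ ∈ {κ : ConjClasses (GL (Fin n) F) | κ.charpoly = f},
      ∃ I : Fin n → Ideal F[X], (∀ i, f ∈ I i) ∧ ∃ A : GL (Fin n) F, ConjClasses.mk A = κ ∧
        Nonempty (MatrixModule A.val ≃ₗ[F[X]] ((i : Fin n) → F[X] ⧸ I i)) := by
    rintro κ rfl
    obtain ⟨A, rfl⟩ := κ.exists_rep
    obtain ⟨I, h1, h2⟩ := exists_matrixModule_equiv_pi A.val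
    exact ⟨I, h1, A, rfl, h2⟩
  choose! I hI hA using hI
  have hinj : Set.InjOn I {κ : ConjClasses (GL (Fin n) F) | κ.charpoly = f} := by
    intro κ hκ κ' hκ' h
    obtain ⟨A, rfl, ⟨e⟩⟩ := hA κ hκ
    obtain ⟨B, rfl, ⟨e'⟩⟩ := hA κ' hκ'
    rw [← h] at e'
    exact ConjClasses.mk_eq_mk_iff_isConj.mpr (isConj_of_matrixModule_equiv (e.trans e'.symm))
  have hpi : (Set.univ.pi fun _ : Fin n => {I : Ideal F[X] | f ∈ I}).Finite :=
    Set.Finite.pi fun _ => hfin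
  refine (Set.ncard_le_ncard_of_injOn I (fun κ hκ => Set.mem_univ_pi.mpr (hI κ hκ)) hinj hpi).trans ?_
  have : (Set.univ.pi fun _ : Fin n => {I : Ideal F[X] | f ∈ I}).ncard =
      {I : Ideal F[X] | f ∈ I}.ncard ^ n := by
    rw [← Nat.card_coe_set_eq, Nat.card_congr (Equiv.Set.univPi _), Nat.card_pi]
    simp
  rw [this]
  exact Nat.pow_le_pow_left hcard n

/-- The scalar matrix `ξ • 1` as an invertible matrix. -/
def scalarGL (n : ℕ) (ξ : Fˣ) : GL (Fin n) F :=
  Units.map (Matrix.scalar (Fin n) : F →+* Matrix (Fin n) (Fin n) F).toMonoidHom ξ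

theorem val_scalarGL (ξ : Fˣ) :
    (scalarGL n ξ).val = (ξ : F) • (1 : Matrix (Fin n) (Fin n) F) := by
  rw [Matrix.smul_one_eq_diagonal]
  rfl

theorem val_scalarGL_mul (ξ : Fˣ) (A : GL (Fin n) F) :
    (scalarGL n ξ * A).val = (ξ : F) • A.val := by
  rw [Units.val_mul, val_scalarGL, Matrix.smul_mul, one_mul]

theorem scalarGL_commute (ξ : Fˣ) (A : GL (Fin n) F) : Commute (scalarGL n ξ) A := by
  refine Units.ext ?_
  rw [val_scalarGL_mul, Units.val_mul, val_scalarGL, Matrix.mul_smul, mul_one]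

variable {ξ : Fˣ}

theorem expand_contract_charpoly (hξ : ξ ^ n = 1) (hn : n ≠ 0) {κ : ConjClasses (GL (Fin n) F)}
    (hκ : κ ∈ ConjClasses.invariant (scalarGL n ξ)) :
    expand F (orderOf ξ) (contract (orderOf ξ) κ.charpoly) = κ.charpoly := by
  have hd : 0 < orderOf ξ := orderOf_pos_iff.mpr
    (isOfFinOrder_iff_pow_eq_one.mpr ⟨n, Nat.pos_of_ne_zero hn, hξ⟩)
  obtain ⟨A, rfl, h⟩ := hκ
  rw [← ConjClasses.mk_eq_mk_iff_isConj] at h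
  have h2 := congrArg ConjClasses.charpoly h
  rw [ConjClasses.charpoly_mk, ConjClasses.charpoly_mk, val_scalarGL_mul,
    charpoly_smul_of_pow_eq_one (by simpa using congrArg Units.val hξ) ξ.ne_zero] at h2
  rw [ConjClasses.charpoly_mk]
  ext i
  rw [coeff_expand hd, coeff_contract hd.ne']
  split_ifs with hi
  · rw [Nat.div_mul_cancel hi]
  · have h3 := congrArg (fun p => coeff p i) h2
    simp only [comp_C_mul_X_coeff] at h3
    by_contra hne
    apply hi
    rw [orderOf_dvd_iff_pow_eq_one]
    have h4 : ((ξ : F)⁻¹) ^ i = 1 := by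
      refine mul_left_cancel₀ (Ne.symm hne) ?_
      rw [← h3, mul_one]
    rw [inv_pow, inv_eq_one] at h4
    exact Units.ext (by simpa using h4)

theorem contract_charpoly_mem (hξ : ξ ^ n = 1) (hn : n ≠ 0) {κ : ConjClasses (GL (Fin n) F)}
    (hκ : κ ∈ ConjClasses.invariant (scalarGL n ξ)) :
    contract (orderOf ξ) κ.charpoly ∈ monicOfDegree F (n / orderOf ξ) := by
  have hd : 0 < orderOf ξ := orderOf_pos_iff.mpr
    (isOfFinOrder_iff_pow_eq_one.mpr ⟨n, Nat.pos_of_ne_zero hn, hξ⟩)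
  have h := expand_contract_charpoly hξ hn hκ
  constructor
  · rw [← monic_expand_iff hd, h]
    exact κ.charpoly_monic
  · have h2 := natDegree_expand (orderOf ξ) (contract (orderOf ξ) κ.charpoly)
    rw [h, κ.natDegree_charpoly] at h2
    exact (Nat.div_eq_of_eq_mul_left hd h2).symm

theorem exists_invariant_charpoly_eq_expand [PerfectField F] (hξ : ξ ^ n = 1) (hn : n ≠ 0)
    {g : F[X]} (hg : g ∈ monicOfDegree F (n / orderOf ξ)) (h0 : g.coeff 0 ≠ 0)
    (hsq : Squarefree g) :
    ∃ κ ∈ ConjClasses.invariant (scalarGL n ξ),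
      κ.charpoly = expand F (orderOf ξ) g ∧ Squarefree κ.charpoly := by
  have hd : 0 < orderOf ξ := orderOf_pos_iff.mpr
    (isOfFinOrder_iff_pow_eq_one.mpr ⟨n, Nat.pos_of_ne_zero hn, hξ⟩)
  have : NeZero (orderOf ξ) := ⟨hd.ne'⟩
  have hdF : (orderOf ξ : F) ≠ 0 :=
    ((IsPrimitiveRoot.orderOf ξ).map_of_injective (f := Units.coeHom F)
      Units.val_injective).neZero'.ne
  have hsq' := squarefree_expand hdF h0 hsq
  obtain ⟨A, hA⟩ := exists_charpoly_eq (n := n) (f := expand F (orderOf ξ) g)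
    ((monic_expand_iff hd).mpr hg.1)
    (by rw [natDegree_expand, hg.2, Nat.div_mul_cancel (orderOf_dvd_of_pow_eq_one hξ)])
    (by rw [coeff_expand hd]; simpa using h0)
  refine ⟨ConjClasses.mk A, ⟨A, rfl, ?_⟩, hA, by rwa [ConjClasses.charpoly_mk, hA]⟩
  refine isConj_of_squarefree_charpoly (hA ▸ hsq') ?_
  rw [val_scalarGL_mul,
    charpoly_smul_of_pow_eq_one (by simpa using congrArg Units.val hξ) ξ.ne_zero, hA]
  ext i
  rw [comp_C_mul_X_coeff, coeff_expand hd]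
  split_ifs with hi
  · obtain ⟨m, rfl⟩ := hi
    have : (ξ : F) ^ orderOf ξ = 1 := by
      rw [← Units.val_pow_eq_pow_val, pow_orderOf_eq_one, Units.val_one]
    rw [inv_pow, pow_mul, this, one_pow, inv_one, mul_one]
  · rw [zero_mul]

theorem ncard_invariant_bounds [Finite F] (hξ : ξ ^ n = 1) (hn : n ≠ 0) :
    Nat.card F ^ (n / orderOf ξ) ≤ (ConjClasses.invariant (scalarGL n ξ)).ncard +
        (degenerateOfDegree F (n / orderOf ξ)).ncard ∧
      (ConjClasses.invariant (scalarGL n ξ)).ncard ≤ Nat.card F ^ (n / orderOf ξ) +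
        (2 ^ n) ^ n * (degenerateOfDegree F (n / orderOf ξ)).ncard := by
  classical
  set d := orderOf ξ
  set S := ConjClasses.invariant (scalarGL n ξ)
  set M := monicOfDegree F (n / d)
  set D := degenerateOfDegree F (n / d)
  have hfinM : M.Finite := finite_monicOfDegree F _
  have hDM : D ⊆ M := Set.sep_subset _ _
  have hfinD : D.Finite := hfinM.subset hDM
  have hMD : (M \ D).ncard + D.ncard = Nat.card F ^ (n / d) := by
    rw [Set.ncard_sdiff_add_ncard_of_subset hDM hfinM, ncard_monicOfDegree]
  have hd : 0 < d := orderOf_pos_iff.mpr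
    (isOfFinOrder_iff_pow_eq_one.mpr ⟨n, Nat.pos_of_ne_zero hn, hξ⟩)
  have hgood : ∀ g ∈ M \ D, g.coeff 0 ≠ 0 ∧ Squarefree g := fun g hg => by
    by_contra h
    exact hg.2 ⟨hg.1, h⟩
  let ρ : ConjClasses (GL (Fin n) F) → F[X] := fun κ => contract d κ.charpoly
  have hsub : M \ D ⊆ ρ '' S := by
    intro g hg
    obtain ⟨κ, hκ, h, -⟩ := exists_invariant_charpoly_eq_expand hξ hn hg.1 (hgood g hg).1
      (hgood g hg).2
    exact ⟨κ, hκ, by rw [show ρ κ = contract d κ.charpoly from rfl, h, contract_expand _ hd.ne']⟩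
  have hfinS : S.Finite := Set.toFinite S
  refine ⟨?_, ?_⟩
  · rw [← hMD]
    gcongr
    exact (Set.ncard_le_ncard hsub (hfinS.image _)).trans (Set.ncard_image_le hfinS)
  · have hinj : Set.InjOn ρ {κ ∈ S | ρ κ ∉ D} := by
      rintro κ ⟨hκ, hκD⟩ κ' ⟨hκ', -⟩ h
      have hg : ρ κ ∈ M \ D := ⟨contract_charpoly_mem hξ hn hκ, hκD⟩
      obtain ⟨κ₀, -, h1, h2⟩ := exists_invariant_charpoly_eq_expand hξ hn hg.1 (hgood _ hg).1
        (hgood _ hg).2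
      have h3 : κ.charpoly = κ₀.charpoly := by
        rw [h1, ← expand_contract_charpoly hξ hn hκ]
      refine ConjClasses.eq_of_squarefree_charpoly (h3 ▸ h2) ?_
      rw [← expand_contract_charpoly hξ hn hκ, ← expand_contract_charpoly hξ hn hκ']
      exact congrArg _ h
    have h1 : {κ ∈ S | ρ κ ∉ D}.ncard ≤ (M \ D).ncard :=
      Set.ncard_le_ncard_of_injOn ρ
        (fun κ hκ => ⟨contract_charpoly_mem hξ hn hκ.1, hκ.2⟩) hinj (hfinM.subset Set.sdiff_subset)
    have h2 : {κ ∈ S | ρ κ ∈ D}.ncard ≤ (2 ^ n) ^ n * D.ncard := by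
      have hfin : {κ ∈ S | ρ κ ∈ D}.Finite := Set.toFinite _
      rw [Set.ncard_eq_toFinset_card _ hfin, Set.ncard_eq_toFinset_card _ hfinD]
      refine Finset.card_le_mul_card_image_of_maps_to (f := ρ)
        (fun κ hκ => hfinD.mem_toFinset.mpr (hfin.mem_toFinset.mp hκ).2) _ fun g _ => ?_
      rw [← Set.ncard_coe_finset]
      refine (Set.ncard_le_ncard ?_ (Set.toFinite _)).trans
        (ConjClasses.ncard_charpoly_eq_le (n := n) (expand F d g))
      intro κ hκ
      obtain ⟨h, rfl⟩ := Finset.mem_filter.mp (Finset.mem_coe.mp hκ)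
      exact (expand_contract_charpoly hξ hn (hfin.mem_toFinset.mp h).1).symm
    have h3 : S = {κ ∈ S | ρ κ ∉ D} ∪ {κ ∈ S | ρ κ ∈ D} := by
      ext κ
      simp only [Set.mem_union, Set.mem_ofPred_eq]
      tauto
    calc S.ncard ≤ _ := (congrArg Set.ncard h3).le.trans (Set.ncard_union_le _ _)
      _ ≤ _ := add_le_add (h1.trans (by omega)) h2

end

end helpers

/-- **Commutator fiber size over central elements of `SL_n(F_q)`.**
For fixed `n ≥ 2` there is a constant `C > 0`, depending only on `n`, such that for every
prime power `q`, every finite field `F` with `q` elements and every `ξ ∈ Fˣ` with `ξ^n = 1`,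
letting `d` be the multiplicative order of `ξ` and `c = ξ·I_n` the corresponding central
element of `SL_n(F)`, the number of pairs `(a, b) ∈ GL_n(F)²` with `a * b * a⁻¹ * b⁻¹ = c`
is `q^(n/d)·|GL_n(F)|` up to an error of at most `C·q^(n/d - 1)·|GL_n(F)|`. -/
theorem commutator_fiber_card_central (n : ℕ) (hn : 2 ≤ n) :
    ∃ C : ℝ, 0 < C ∧
      ∀ (q : ℕ), IsPrimePow q →
        ∀ (F : Type) [Field F] [Fintype F], Fintype.card F = q →
          ∀ ξ : Fˣ, ξ ^ n = 1 →
            |(Nat.card {p : GL (Fin n) F × GL (Fin n) F //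
                  ((p.1 * p.2 * p.1⁻¹ * p.2⁻¹ : GL (Fin n) F) : Matrix (Fin n) (Fin n) F) =
                    (ξ : F) • (1 : Matrix (Fin n) (Fin n) F)} : ℝ) -
                (q : ℝ) ^ (n / orderOf ξ) * (Nat.card (GL (Fin n) F) : ℝ)| ≤
              C * (q : ℝ) ^ (n / orderOf ξ - 1) * (Nat.card (GL (Fin n) F) : ℝ) := by
  have hn0 : n ≠ 0 := by omega
  refine ⟨((2 ^ n) ^ n * (n + 1) : ℝ), by positivity, ?_⟩
  intro q _ F _ _ hq ξ hξ
  have hqF : Nat.card F = q := by rw [Nat.card_eq_fintype_card, hq]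
  set k := n / orderOf ξ with hk
  have hk1 : 1 ≤ k := Nat.div_pos (orderOf_le_of_pow_eq_one (by omega) hξ)
    (orderOf_pos_iff.mpr (isOfFinOrder_iff_pow_eq_one.mpr ⟨n, by omega, hξ⟩))
  have hcount : Nat.card {p : GL (Fin n) F × GL (Fin n) F //
      ((p.1 * p.2 * p.1⁻¹ * p.2⁻¹ : GL (Fin n) F) : Matrix (Fin n) (Fin n) F) =
        (ξ : F) • (1 : Matrix (Fin n) (Fin n) F)} =
      (ConjClasses.invariant (scalarGL n ξ)).ncard * Nat.card (GL (Fin n) F) := by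
    rw [← card_commutator_eq (scalarGL_commute ξ)]
    refine Nat.card_congr (Equiv.subtypeEquivRight fun p => ?_)
    rw [← val_scalarGL, Units.val_inj]
  rw [hcount]
  obtain ⟨hlow, hup⟩ := ncard_invariant_bounds hξ hn0
  have hdeg : (degenerateOfDegree F k).ncard ≤ (n + 1) * q ^ (k - 1) := by
    refine (ncard_degenerateOfDegree_le F k hk1).trans ?_
    rw [hqF]
    exact Nat.mul_le_mul_right _ (Nat.succ_le_succ (Nat.div_le_self _ _))
  rw [hqF, ← hk] at hlow hup
  have hC : 1 ≤ (2 ^ n) ^ n := Nat.one_le_pow _ _ (by positivity)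
  have hlow' : q ^ k ≤ (ConjClasses.invariant (scalarGL n ξ)).ncard +
      (2 ^ n) ^ n * ((n + 1) * q ^ (k - 1)) :=
    hlow.trans (Nat.add_le_add_left (hdeg.trans (Nat.le_mul_of_pos_left _ hC)) _)
  have hup' : (ConjClasses.invariant (scalarGL n ξ)).ncard ≤ q ^ k +
      (2 ^ n) ^ n * ((n + 1) * q ^ (k - 1)) :=
    hup.trans (Nat.add_le_add_left (Nat.mul_le_mul_left _ hdeg) _)
  have hlowR : (q : ℝ) ^ k ≤ ((ConjClasses.invariant (scalarGL n ξ)).ncard : ℝ) +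
      (2 ^ n) ^ n * ((n + 1) * (q : ℝ) ^ (k - 1)) := by exact_mod_cast hlow'
  have hupR : ((ConjClasses.invariant (scalarGL n ξ)).ncard : ℝ) ≤ (q : ℝ) ^ k +
      (2 ^ n) ^ n * ((n + 1) * (q : ℝ) ^ (k - 1)) := by exact_mod_cast hup'
  rw [Nat.cast_mul, ← sub_mul, abs_mul, Nat.abs_cast]
  gcongr
  rw [abs_le]
  constructor <;> linarith
end

section
/- Let q ≥ 2 be a prime power, s ≥ 1 an integer, and κ an integer with 1 ≤ κ ≤ q^s − 1. Then the s residues κ, κq, κq², …, κq^{s−1} modulo q^s − 1 fail to be pairwise distinct if and only if there exists a divisor r of s with 1 ≤ r < s such that (q^s − 1)/(q^r − 1) divides κ. Equivalently, the complement of 𝔎_s in {1, …, q^s − 1} equals the union over proper divisors r of s of the sets {t·(q^s−1)/(q^r−1) : 1 ≤ t ≤ q^r − 1}. -/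
theorem Nat.pow_sub_one_div_dvd_iff {q r s : ℕ} (hq : 2 ≤ q) (hr : 1 ≤ r) (hrs : r ∣ s) (κ : ℕ) :
    (q ^ s - 1) / (q ^ r - 1) ∣ κ ↔ q ^ s - 1 ∣ κ * (q ^ r - 1) := by
  have hpos : 0 < q ^ r - 1 := Nat.sub_pos_of_lt (Nat.one_lt_pow (by omega) (by omega))
  obtain ⟨m, hm⟩ := Nat.pow_sub_one_dvd_pow_sub_one q hrs
  rw [hm, Nat.mul_div_cancel_left _ hpos, mul_comm, Nat.mul_dvd_mul_iff_right hpos]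

theorem Nat.pow_sub_one_dvd_of_mul_pow_mod_eq {q s κ i j : ℕ} (hq : 2 ≤ q) (hs : 1 ≤ s)
    (hij : i < j) (h : (κ * q ^ i) % (q ^ s - 1) = (κ * q ^ j) % (q ^ s - 1)) :
    q ^ s - 1 ∣ κ * (q ^ (j - i) - 1) := by
  have hd : q ^ s - 1 ∣ κ * q ^ j - κ * q ^ i :=
    (Nat.modEq_iff_dvd' (by gcongr; omega)).1 h
  have he : κ * q ^ j - κ * q ^ i = κ * (q ^ (j - i) - 1) * q ^ i := by
    rw [mul_assoc, Nat.sub_mul, ← pow_add, Nat.sub_add_cancel hij.le, one_mul, Nat.mul_sub]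
  have hc : Nat.Coprime (q ^ s - 1) (q ^ i) := by
    have h1 : Nat.Coprime (q ^ s - 1) (q ^ s) :=
      (Nat.coprime_self_sub_left (Nat.one_le_pow _ _ (by omega))).2 (Nat.coprime_one_left _)
    exact ((Nat.coprime_pow_right_iff hs _ _).1 h1).pow_right i
  exact hc.dvd_of_dvd_mul_right (he ▸ hd)

theorem Nat.not_mul_pow_mod_injective_iff {q s : ℕ} (hq : 2 ≤ q) (hs : 1 ≤ s) (κ : ℕ) :
    (¬ ∀ i j : ℕ, i < s → j < s → i ≠ j →
        (κ * q ^ i) % (q ^ s - 1) ≠ (κ * q ^ j) % (q ^ s - 1)) ↔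
      ∃ r : ℕ, r ∣ s ∧ 1 ≤ r ∧ r < s ∧ ((q ^ s - 1) / (q ^ r - 1)) ∣ κ := by
  constructor
  · intro h
    push Not at h
    obtain ⟨i, j, hi, hj, hne, h⟩ := h
    wlog hij : i < j generalizing i j
    · exact this j i hj hi hne.symm h.symm (by omega)
    have hr : 1 ≤ Nat.gcd (j - i) s := Nat.gcd_pos_of_pos_right _ hs
    have hle : Nat.gcd (j - i) s ≤ j - i := Nat.gcd_le_left _ (by omega)
    refine ⟨Nat.gcd (j - i) s, Nat.gcd_dvd_right _ _, hr, by omega, ?_⟩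
    rw [Nat.pow_sub_one_div_dvd_iff hq hr (Nat.gcd_dvd_right _ _),
      ← Nat.pow_sub_one_gcd_pow_sub_one, ← Nat.gcd_mul_left]
    exact Nat.dvd_gcd (Nat.pow_sub_one_dvd_of_mul_pow_mod_eq hq hs hij h) (Nat.dvd_mul_left _ _)
  · rintro ⟨r, hrs, hr, hlt, hd⟩ h
    rw [Nat.pow_sub_one_div_dvd_iff hq hr hrs, Nat.mul_sub] at hd
    refine h 0 r (by omega) hlt (by omega) ((Nat.modEq_iff_dvd' ?_).2 ?_)
    · gcongr <;> omega
    · simpa using hd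

/-- **Description of the complement of Green's set `𝔎_s`.**
For a prime power `q`, an integer `s ≥ 1` and `1 ≤ κ ≤ q^s − 1`, the residues
`κ, κq, …, κq^{s−1}` modulo `q^s − 1` fail to be pairwise distinct if and only if
`(q^s − 1)/(q^r − 1)` divides `κ` for some proper divisor `r` of `s`; equivalently, the
complement of `𝔎_s` in `{1, …, q^s − 1}` is the union over proper divisors `r ∣ s` of the
sets `{t·(q^s−1)/(q^r−1) : 1 ≤ t ≤ q^r − 1}`. -/
theorem complement_of_simplex_roots (q s : ℕ) (hq : IsPrimePow q) (hs : 1 ≤ s) :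
    (∀ κ : ℕ, 1 ≤ κ → κ ≤ q ^ s - 1 →
      ((¬ ∀ i j : ℕ, i < s → j < s → i ≠ j →
          (κ * q ^ i) % (q ^ s - 1) ≠ (κ * q ^ j) % (q ^ s - 1)) ↔
        ∃ r : ℕ, r ∣ s ∧ 1 ≤ r ∧ r < s ∧ ((q ^ s - 1) / (q ^ r - 1)) ∣ κ)) ∧
    {κ : ℕ | 1 ≤ κ ∧ κ ≤ q ^ s - 1 ∧
        ¬ ∀ i j : ℕ, i < s → j < s → i ≠ j →
          (κ * q ^ i) % (q ^ s - 1) ≠ (κ * q ^ j) % (q ^ s - 1)} =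
      ⋃ r ∈ {r : ℕ | r ∣ s ∧ 1 ≤ r ∧ r < s},
        (fun t => t * ((q ^ s - 1) / (q ^ r - 1))) '' Set.Icc 1 (q ^ r - 1) := by
  have hq2 : 2 ≤ q := hq.two_le
  refine ⟨fun κ _ _ => Nat.not_mul_pow_mod_injective_iff hq2 hs κ, ?_⟩
  ext κ
  simp only [Set.mem_ofPred_eq, Nat.not_mul_pow_mod_injective_iff hq2 hs, Set.mem_iUnion,
    Set.mem_image, Set.mem_Icc, exists_prop]
  have hN : 0 < q ^ s - 1 := Nat.sub_pos_of_lt (Nat.one_lt_pow (by omega) (by omega))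
  have hmul {r : ℕ} (hrs : r ∣ s) :
      (q ^ r - 1) * ((q ^ s - 1) / (q ^ r - 1)) = q ^ s - 1 :=
    Nat.mul_div_cancel' (Nat.pow_sub_one_dvd_pow_sub_one q hrs)
  have hM {r : ℕ} (hrs : r ∣ s) : 0 < (q ^ s - 1) / (q ^ r - 1) :=
    Nat.pos_of_ne_zero fun h0 => by
      have := hmul hrs
      rw [h0, mul_zero] at this
      omega
  constructor
  · rintro ⟨h1, h2, r, hrs, hr, hlt, t, rfl⟩
    refine ⟨r, ⟨hrs, hr, hlt⟩, t, ⟨Nat.pos_of_mul_pos_left h1, ?_⟩, mul_comm _ _⟩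
    refine Nat.le_of_mul_le_mul_right ?_ (hM hrs)
    rwa [hmul hrs, mul_comm]
  · rintro ⟨r, ⟨hrs, hr, hlt⟩, t, ⟨ht1, ht2⟩, rfl⟩
    refine ⟨Nat.mul_pos ht1 (hM hrs), ?_, r, hrs, hr, hlt, Nat.dvd_mul_left _ _⟩
    exact (Nat.mul_le_mul_right _ ht2).trans_eq (hmul hrs)
end

section
/- Let q ≥ 2 be a prime power, s ≥ 1 an integer, and let r and r′ be divisors of s. Then {t·(q^s−1)/(q^r−1) : 1 ≤ t ≤ q^r − 1} ∩ {t·(q^s−1)/(q^{r′}−1) : 1 ≤ t ≤ q^{r′} − 1} = {t·(q^s−1)/(q^g−1) : 1 ≤ t ≤ q^g − 1}, where g = gcd(r, r′). In particular, lcm((q^s−1)/(q^r−1), (q^s−1)/(q^{r′}−1)) = (q^s−1)/(q^{gcd(r,r′)}−1). -/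
theorem Nat.lcm_div_div_eq_div_gcd {N a b : ℕ} (hN : 0 < N) (ha : a ∣ N) (hb : b ∣ N) :
    Nat.lcm (N / a) (N / b) = N / Nat.gcd a b := by
  have ha0 : 0 < a := Nat.pos_of_dvd_of_pos ha hN
  have hb0 : 0 < b := Nat.pos_of_dvd_of_pos hb hN
  refine Nat.dvd_right_iff_eq.mp fun x => ?_
  rw [Nat.lcm_dvd_iff, Nat.div_dvd_iff_dvd_mul ha ha0, Nat.div_dvd_iff_dvd_mul hb hb0,
    Nat.div_dvd_iff_dvd_mul ((Nat.gcd_dvd_left a b).trans ha) (Nat.gcd_pos_of_pos_left b ha0),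
    ← Nat.gcd_mul_right, Nat.dvd_gcd_iff]

theorem Nat.mem_image_mul_div_iff {N a x : ℕ} (hN : 0 < N) (ha : a ∣ N) :
    x ∈ (fun t => t * (N / a)) '' Set.Icc 1 a ↔ N / a ∣ x ∧ 1 ≤ x ∧ x ≤ N := by
  obtain ⟨d, rfl⟩ := ha
  have ha0 : 0 < a := Nat.pos_of_mul_pos_right hN
  have hd0 : 0 < d := Nat.pos_of_mul_pos_left hN
  rw [Nat.mul_div_cancel_left d ha0]
  constructor
  · rintro ⟨t, ⟨ht, hta⟩, rfl⟩
    exact ⟨Nat.dvd_mul_left d t, Nat.mul_pos ht hd0, Nat.mul_le_mul_right d hta⟩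
  · rintro ⟨⟨t, rfl⟩, hx, hxN⟩
    refine ⟨t, ⟨Nat.pos_of_mul_pos_left hx, ?_⟩, Nat.mul_comm t d⟩
    exact Nat.le_of_mul_le_mul_left (by rwa [Nat.mul_comm d a]) hd0

/-- **Intersection of the progressions `(q^s−1)/(q^r−1)·{1,…,q^r−1}` for divisors `r ∣ s`.**
For a prime power `q`, `s ≥ 1` and divisors `r, r′` of `s`, one has
`{t·(q^s−1)/(q^r−1) : 1 ≤ t ≤ q^r−1} ∩ {t·(q^s−1)/(q^{r′}−1) : 1 ≤ t ≤ q^{r′}−1}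
  = {t·(q^s−1)/(q^g−1) : 1 ≤ t ≤ q^g−1}` with `g = gcd(r, r′)`; in particular
`lcm((q^s−1)/(q^r−1), (q^s−1)/(q^{r′}−1)) = (q^s−1)/(q^{gcd(r,r′)}−1)`. -/
theorem progressions_inter_gcd (q s : ℕ) (hq : IsPrimePow q) (hs : 1 ≤ s)
    (r r' : ℕ) (hr : r ∣ s) (hr' : r' ∣ s) :
    ((fun t => t * ((q ^ s - 1) / (q ^ r - 1))) '' Set.Icc 1 (q ^ r - 1)) ∩
        ((fun t => t * ((q ^ s - 1) / (q ^ r' - 1))) '' Set.Icc 1 (q ^ r' - 1)) =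
      (fun t => t * ((q ^ s - 1) / (q ^ Nat.gcd r r' - 1))) ''
        Set.Icc 1 (q ^ Nat.gcd r r' - 1) ∧
    Nat.lcm ((q ^ s - 1) / (q ^ r - 1)) ((q ^ s - 1) / (q ^ r' - 1)) =
      (q ^ s - 1) / (q ^ Nat.gcd r r' - 1) := by
  have hN : 0 < q ^ s - 1 := Nat.sub_pos_of_lt (Nat.one_lt_pow (by lia) hq.one_lt)
  have hdvd {m : ℕ} (hm : m ∣ s) : q ^ m - 1 ∣ q ^ s - 1 := by
    rw [← Nat.gcd_eq_left_iff_dvd, Nat.pow_sub_one_gcd_pow_sub_one, Nat.gcd_eq_left hm]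
  have hlcm := Nat.lcm_div_div_eq_div_gcd hN (hdvd hr) (hdvd hr')
  rw [Nat.pow_sub_one_gcd_pow_sub_one] at hlcm
  refine ⟨?_, hlcm⟩
  ext x
  rw [Set.mem_inter_iff, Nat.mem_image_mul_div_iff hN (hdvd hr),
    Nat.mem_image_mul_div_iff hN (hdvd hr'),
    Nat.mem_image_mul_div_iff hN (hdvd ((Nat.gcd_dvd_left r r').trans hr)),
    ← hlcm, Nat.lcm_dvd_iff]
  tauto
end

section
/- Let q be a prime power, s ≥ 1 an integer, K a finite field with q^s elements, θ : K^× → ℂ^× an injective group homomorphism, and ξ ∈ K^×. Then Σ_{κ ∈ 𝔎_s} θ(ξ)^κ = Σ_r μ(s/r)·(q^r − 1), where μ is the Möbius function and the right-hand sum ranges over all divisors r of s such that ξ^{(q^s−1)/(q^r−1)} = 1; in particular, the left-hand sum vanishes if no divisor r of s satisfies ξ^{(q^s−1)/(q^r−1)} = 1. -/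
/-- Divisor form of `μ * ζ = 1`, restricted to the multiples of `m`. -/
theorem sum_moebius_div_of_dvd {m s : ℕ} (hs : s ≠ 0) (hm : m ∣ s) :
    ∑ r ∈ s.divisors with m ∣ r, ArithmeticFunction.moebius (s / r) =
      if m = s then 1 else 0 := by
  have hm0 : m ≠ 0 := ne_zero_of_dvd_ne_zero hs hm
  have h1 : ∑ r ∈ s.divisors with m ∣ r, ArithmeticFunction.moebius (s / r) =
      ∑ d ∈ (s / m).divisors, ArithmeticFunction.moebius d := by
    refine Finset.sum_bij' (fun r _ => s / r) (fun d _ => s / d) ?_ ?_ ?_ ?_ ?_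
    · intro r hr
      simp only [Finset.mem_filter, Nat.mem_divisors] at hr ⊢
      obtain ⟨⟨⟨a, rfl⟩, _⟩, b, rfl⟩ := hr
      simp only [mul_ne_zero_iff] at hs
      rw [Nat.mul_div_cancel_left _ (by grind), mul_assoc,
        Nat.mul_div_cancel_left _ (by grind)]
      exact ⟨dvd_mul_left _ _, by grind⟩
    · intro d hd
      obtain ⟨k, rfl⟩ := hm
      simp only [Finset.mem_filter, Nat.mem_divisors] at hd ⊢
      rw [Nat.mul_div_cancel_left _ (by grind)] at hd
      obtain ⟨⟨b, rfl⟩, h⟩ := hd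
      simp only [mul_ne_zero_iff] at h
      have : m * (d * b) / d = m * b := by
        rw [show m * (d * b) = d * (m * b) by ring, Nat.mul_div_cancel_left _ (by grind)]
      rw [this]
      exact ⟨⟨⟨d, by ring⟩, hs⟩, dvd_mul_right _ _⟩
    · intro r hr
      simp only [Finset.mem_filter, Nat.mem_divisors] at hr
      exact Nat.div_div_self hr.1.1 hs
    · intro d hd
      exact Nat.div_div_self ((Nat.dvd_of_mem_divisors hd).trans (Nat.div_dvd_of_dvd hm)) hs
    · intro r hr
      rfl
  rw [h1, ← ArithmeticFunction.coe_mul_zeta_apply, ArithmeticFunction.moebius_mul_coe_zeta,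
    ArithmeticFunction.one_apply]
  refine if_congr ?_ rfl rfl
  obtain ⟨k, rfl⟩ := hm
  rw [Nat.mul_div_cancel_left _ (by grind)]
  constructor
  · rintro rfl
    simp
  · intro h
    exact Nat.eq_of_mul_eq_mul_left (Nat.pos_of_ne_zero hm0) (by rw [← h, mul_one])

theorem injOn_iterate_iff_minimalPeriod_eq {α : Type*} {f : α → α} {x : α} {s : ℕ} (hs : 0 < s)
    (h : Function.IsPeriodicPt f s x) :
    (∀ i j : ℕ, i < s → j < s → i ≠ j → f^[i] x ≠ f^[j] x) ↔ Function.minimalPeriod f x = s := by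
  have hle : Function.minimalPeriod f x ≤ s := Nat.le_of_dvd hs h.minimalPeriod_dvd
  constructor
  · intro H
    by_contra hne
    have hpos := h.minimalPeriod_pos hs
    refine H _ 0 (lt_of_le_of_ne hle hne) hs hpos.ne' ?_
    exact Function.isPeriodicPt_minimalPeriod f x
  · intro hm i j hi hj hij e
    rw [← hm] at hi hj
    exact hij (Function.iterate_injOn_Iio_minimalPeriod hi hj e)

/-- The indicator of `κ` having a `q`-orbit of full length `s` modulo `q ^ s - 1`, expanded by
Möbius inversion. -/
theorem sum_moebius_orbit_eq_ite {q s : ℕ} (hq : 1 < q) (hs : 0 < s) (κ : ℕ)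
    [Decidable (∀ i j : ℕ, i < s → j < s → i ≠ j →
      (κ * q ^ i) % (q ^ s - 1) ≠ (κ * q ^ j) % (q ^ s - 1))] :
    (∑ r ∈ s.divisors with q ^ s - 1 ∣ κ * (q ^ r - 1), ArithmeticFunction.moebius (s / r)) =
      if ∀ i j : ℕ, i < s → j < s → i ≠ j →
        (κ * q ^ i) % (q ^ s - 1) ≠ (κ * q ^ j) % (q ^ s - 1) then 1 else 0 := by
  let f : ZMod (q ^ s - 1) → ZMod (q ^ s - 1) := (· * (q : ZMod (q ^ s - 1)))
  have hit (i : ℕ) : f^[i] (κ : ZMod (q ^ s - 1)) = ((κ * q ^ i : ℕ) : ZMod (q ^ s - 1)) := by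
    simp [f, mul_right_iterate]
  have hper (r : ℕ) : Function.IsPeriodicPt f r (κ : ZMod (q ^ s - 1)) ↔
      q ^ s - 1 ∣ κ * (q ^ r - 1) := by
    rw [Function.IsPeriodicPt, Function.IsFixedPt, hit, eq_comm, ZMod.natCast_eq_natCast_iff,
      Nat.modEq_iff_dvd' (Nat.le_mul_of_pos_right _ (by positivity)), Nat.mul_sub, mul_one]
  have hs' : Function.IsPeriodicPt f s (κ : ZMod (q ^ s - 1)) := (hper s).2 (dvd_mul_left _ _)
  have key := injOn_iterate_iff_minimalPeriod_eq hs hs'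
  simp only [hit, ne_eq, ZMod.natCast_eq_natCast_iff] at key
  rw [Finset.filter_congr fun r _ => (hper r).symm.trans
    Function.isPeriodicPt_iff_minimalPeriod_dvd,
    sum_moebius_div_of_dvd hs.ne' hs'.minimalPeriod_dvd]
  exact if_congr key.symm rfl rfl

theorem sum_Icc_pow_of_pow_eq_one {F : Type*} [Field F] {z : F} {n : ℕ} (hz : z ^ n = 1)
    [Decidable (z = 1)] : ∑ t ∈ Finset.Icc 1 n, z ^ t = if z = 1 then (n : F) else 0 := by
  split_ifs with h
  · simp [h]
  · rw [← Finset.Ico_succ_right_eq_Icc, Nat.succ_eq_succ, Nat.succ_eq_add_one,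
      geom_sum_Ico h (by lia), pow_succ, hz]
    simp

/-- Summing the powers `z ^ κ` of a `c * d`-th root of unity over the multiples `κ` of `c`. -/
theorem sum_pow_multiples {F : Type*} [Field F] {z : F} {c d : ℕ} (hc : 0 < c) (hd : 0 < d)
    (hz : z ^ (c * d) = 1) [Decidable (z ^ c = 1)] :
    ∑ κ ∈ Finset.Icc 1 (c * d) with c * d ∣ κ * d, z ^ κ =
      if z ^ c = 1 then (d : F) else 0 := by
  rw [← sum_Icc_pow_of_pow_eq_one (z := z ^ c) (n := d) (by rw [← pow_mul, hz])]
  symm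
  refine Finset.sum_bij (fun t _ => c * t) ?_ ?_ ?_ ?_
  · intro t ht
    simp only [Finset.mem_filter, Finset.mem_Icc] at ht ⊢
    exact ⟨⟨Nat.mul_pos hc ht.1, Nat.mul_le_mul_left _ ht.2⟩, t, by ring⟩
  · intro a _ b _ h
    exact Nat.eq_of_mul_eq_mul_left hc h
  · intro κ hκ
    simp only [Finset.mem_filter, Finset.mem_Icc] at hκ
    obtain ⟨t, rfl⟩ := Nat.dvd_of_mul_dvd_mul_right hd hκ.2
    refine ⟨t, ?_, rfl⟩
    rw [Finset.mem_Icc]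
    exact ⟨Nat.pos_of_mul_pos_left hκ.1.1, Nat.le_of_mul_le_mul_left hκ.1.2 hc⟩
  · intro t _
    rw [pow_mul]

open scoped Classical in
/-- **Character sum over the roots of `s`-simplices (Lemma on `Σ_{κ ∈ 𝔎_s} θ^κ(ξ)`).**
Let `q` be a prime power, `s ≥ 1`, `K` a finite field with `q^s` elements,
`θ : Kˣ → ℂˣ` an injective character and `ξ ∈ Kˣ`.  Summing `θ(ξ)^κ` over the set `𝔎_s`
of `κ ∈ {1, …, q^s − 1}` whose residues `κ, κq, …, κq^{s−1}` mod `q^s − 1` are pairwise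
distinct gives `Σ_r μ(s/r)·(q^r − 1)`, the sum being over divisors `r ∣ s` with
`ξ^{(q^s−1)/(q^r−1)} = 1` (in particular the sum vanishes when there is no such divisor). -/
theorem sum_over_simplex_roots (q s : ℕ) (hq : IsPrimePow q) (hs : 1 ≤ s)
    (K : Type) [Field K] [Fintype K] (hK : Fintype.card K = q ^ s)
    (θ : Kˣ →* ℂˣ) (hθ : Function.Injective θ) (ξ : Kˣ) :
    ∑ κ ∈ (Finset.Icc 1 (q ^ s - 1)).filter
        (fun κ => ∀ i j : ℕ, i < s → j < s → i ≠ j →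
          (κ * q ^ i) % (q ^ s - 1) ≠ (κ * q ^ j) % (q ^ s - 1)),
        ((θ ξ : ℂˣ) : ℂ) ^ κ =
      ∑ r ∈ s.divisors.filter (fun r => ξ ^ ((q ^ s - 1) / (q ^ r - 1)) = 1),
        ((ArithmeticFunction.moebius (s / r) : ℤ) : ℂ) * ((q : ℂ) ^ r - 1) := by
  have hq1 : 1 < q := hq.one_lt
  have hcard : ξ ^ (q ^ s - 1) = 1 := by
    rw [← hK, ← Fintype.card_units]
    exact pow_card_eq_one
  have hz (n : ℕ) : ((θ ξ : ℂˣ) : ℂ) ^ n = 1 ↔ ξ ^ n = 1 := by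
    rw [← Units.val_pow_eq_pow_val, Units.val_eq_one, ← map_pow, map_eq_one_iff θ hθ]
  have hind (κ : ℕ) := congrArg (Int.cast : ℤ → ℂ) (sum_moebius_orbit_eq_ite hq1 hs κ)
  push_cast at hind
  rw [Finset.sum_filter]
  calc _ = ∑ κ ∈ Finset.Icc 1 (q ^ s - 1), ∑ r ∈ s.divisors,
        if q ^ s - 1 ∣ κ * (q ^ r - 1) then
          ((ArithmeticFunction.moebius (s / r) : ℤ) : ℂ) * ((θ ξ : ℂˣ) : ℂ) ^ κ else 0 := by
        refine Finset.sum_congr rfl fun κ _ => ?_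
        rw [← Finset.sum_filter, ← Finset.sum_mul, hind, ite_mul, one_mul, zero_mul]
    _ = _ := by
        rw [Finset.sum_comm, Finset.sum_filter]
        refine Finset.sum_congr rfl fun r hr => ?_
        have hrs := Nat.dvd_of_mem_divisors hr
        have hr0 : r ≠ 0 := (Nat.pos_of_mem_divisors hr).ne'
        have hd : 0 < q ^ r - 1 := Nat.sub_pos_of_lt (Nat.one_lt_pow hr0 hq1)
        have hN : 0 < q ^ s - 1 := Nat.sub_pos_of_lt (Nat.one_lt_pow (by lia) hq1)
        have hdvd : q ^ r - 1 ∣ q ^ s - 1 := Nat.pow_sub_one_dvd_pow_sub_one q hrs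
        have hcd := Nat.div_mul_cancel hdvd
        have hsum := sum_pow_multiples (z := ((θ ξ : ℂˣ) : ℂ))
          (Nat.div_pos (Nat.le_of_dvd hN hdvd) hd) hd (by rw [hcd, hz, hcard])
        rw [hcd] at hsum
        rw [← Finset.sum_filter, ← Finset.mul_sum, hsum, mul_ite, mul_zero,
          Nat.cast_sub (Nat.one_le_pow _ _ (by lia))]
        push_cast
        exact if_congr (hz _) rfl rfl
end

section
/- Let F be a finite field with q elements, a ∈ F^× an element of multiplicative order d, and s ≥ 1 an integer. If d divides s, then the set of divisors r of s satisfying a^{(q^s−1)/(q^r−1)} = 1 is exactly the set of divisors of s/d; in particular the largest such divisor is s/d. If d does not divide s, then no divisor r of s satisfies a^{(q^s−1)/(q^r−1)} = 1. -/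
theorem Units.pow_card_pow {F : Type*} [Field F] [Fintype F] (a : Fˣ) (n : ℕ) :
    a ^ Fintype.card F ^ n = a := by
  ext
  push_cast
  exact FiniteField.pow_card_pow n (a : F)

/-- The exponent `1 + q ^ r + ⋯ + q ^ (s - r)` acts on `Fˣ` as its number of terms `s / r`. -/
theorem Units.pow_card_pow_sub_one_div {F : Type*} [Field F] [Fintype F] (a : Fˣ) {r s : ℕ}
    (hr : r ≠ 0) (hrs : r ∣ s) :
    a ^ ((Fintype.card F ^ s - 1) / (Fintype.card F ^ r - 1)) = a ^ (s / r) := by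
  obtain ⟨m, rfl⟩ := hrs
  have hq : 2 ≤ Fintype.card F ^ r :=
    Nat.one_lt_pow hr Fintype.one_lt_card
  rw [Nat.mul_div_cancel_left m (Nat.pos_of_ne_zero hr), pow_mul, ← Nat.geomSum_eq hq,
    ← Finset.prod_pow_eq_pow_sum]
  simp [← pow_mul (Fintype.card F), Units.pow_card_pow]

/-- **Identity divisors (`id_s(a)`).**
Let `F` be a finite field with `q` elements, `a ∈ Fˣ` of multiplicative order `d`, and
`s ≥ 1`.  If `d ∣ s`, then the divisors `r` of `s` with `a^{(q^s−1)/(q^r−1)} = 1` are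
exactly the divisors of `s/d` (so the largest one is `s/d`); if `d ∤ s`, then no divisor
`r` of `s` satisfies `a^{(q^s−1)/(q^r−1)} = 1`. -/
theorem identity_divisors (q : ℕ) (hq : IsPrimePow q)
    (F : Type) [Field F] [Fintype F] (hF : Fintype.card F = q)
    (a : Fˣ) (s : ℕ) (hs : 1 ≤ s) :
    (orderOf a ∣ s →
      ∀ r : ℕ, (r ∣ s ∧ a ^ ((q ^ s - 1) / (q ^ r - 1)) = 1) ↔ r ∣ s / orderOf a) ∧
    (¬ orderOf a ∣ s →
      ∀ r : ℕ, r ∣ s → a ^ ((q ^ s - 1) / (q ^ r - 1)) ≠ 1) := by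
  subst hF
  have key {r : ℕ} (hr : r ∣ s) :
      a ^ ((Fintype.card F ^ s - 1) / (Fintype.card F ^ r - 1)) = 1 ↔ orderOf a ∣ s / r := by
    rw [Units.pow_card_pow_sub_one_div a (ne_zero_of_dvd_ne_zero (by omega) hr) hr,
      orderOf_dvd_iff_pow_eq_one]
  refine ⟨fun hd r => ⟨fun ⟨hr, h⟩ => ?_, fun h => ?_⟩, fun hd r hr h => ?_⟩
  · rw [key hr, Nat.dvd_div_iff_mul_dvd hr] at h
    rwa [Nat.dvd_div_iff_mul_dvd hd, mul_comm]
  · have hr : r ∣ s := h.trans (Nat.div_dvd_of_dvd hd)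
    rw [Nat.dvd_div_iff_mul_dvd hd] at h
    refine ⟨hr, (key hr).2 ?_⟩
    rwa [Nat.dvd_div_iff_mul_dvd hr, mul_comm]
  · exact hd (((key hr).1 h).trans (Nat.div_dvd_of_dvd hr))
end
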